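/- Let $K$ be an algebraically closed field and let $\Gamma$ be a finite tree with a cyclic ordering of the edges at each vertex (a Brauer tree of multiplicity one). Let $Q_\Gamma$ be the quiver whose vertices are the edges of $\Gamma$ and which has, for every vertex $v$ of $\Gamma$ and every edge $x$ at $v$, an arrow from $x$ to the edge following $x$ in the cyclic ordering at $v$ (a loop if $v$ is a leaf). The arrows belonging to one vertex $v$ form an oriented cycle. Let $A = KQ_\Gamma/I$ be the basic Brauer tree algebra, where $I$ is generated by all products of two consecutive arrows from different cycles and by the differences, for each edge $x$ of $\Gamma$, of the two full turns starting at $x$ around the two cycles through $x$. Products of arrows are written from left to right, and modules are finitely generated left $A$-modules. An $A$-cycle is a maximal ordered set of nonrepeating arrows of $Q_\Gamma$ such that the product of any two neighbouring arrows is nonzero in $A$; a loop at an edge ending in a leaf forms an $A$-cycle by itself, so that every vertex of $Q_\Gamma$ lies on two $A$-cycles. For a minimal projective presentation $P_0 \xrightarrow{f} P_1 \to M \to 0$ with $P_0=\bigoplus_{i\in I} Ae_{x_i}$ and $P_1=\bigoplus_{j\in J} Ae_{y_j}$, let $T = (P_0\xrightarrow{f}P_1)$, a complex concentrated in degrees $0$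 and $1$. The diagram of $T$ is the subgraph of $Q_\Gamma$ consisting of the vertices $x_i$ (the sources) and $y_j$ (the sinks) and, for every nonzero component $Ae_{x_i}\to Ae_{y_j}$ of $f$, of the path from $x_i$ to $y_j$ along a cycle of $Q_\Gamma$, with all its arrows and vertices. A degree-one source (sink) of $T$ is a source (sink) that is incident to exactly one arrow of the diagram. The vertices of $T$ are all the vertices of its diagram. A complex $T$ is partial tilting if $\mathrm{Hom}_{D^b(A)}(T,T[k])=0$ for all $k\neq 0$. Let $M_i$ and $M_j$ be nonisomorphic indecomposable nonprojective $A$-modules, and let $T_i$ and $T_j$ be the complexes of minimal projective presentations of them as above. Assume that $T_i\oplus T_j$ is partial tilting. Then $\mathrm{Hom}_{K^b(A)}(T_i,T_j)\neq 0$ if and only if at least one of the following holds: 1. there are an $A$-cycle $C$, a degree-one sink $x$ of $T_i$ and a degree-one sink $y$ of $T_j$ (possibly $x=y$) such that $x$ is the only vertex of $T_i$ on $C$ and $y$ is the only vertex of $T_j$ on $C$; 2. there are an $A$-cycle $C$, a degree-one source $x$ of $T_i$ and a degree-one source $y$ of $T_j$ (possibly $x=y$) such that $x$ is the only vertex of $T_i$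 on $C$ and $y$ is the only vertex of $T_j$ on $C$. -/

import Mathlib

open CategoryTheory CategoryTheory.Limits

universe u v w

/-- A Brauer tree of multiplicity one on the vertex set `V`: a tree together with a cyclic ordering
of the edges around each vertex.  A dart `d` stands for the half-edge of the edge `d.edge` at the
vertex `d.fst`; `next d` is the half-edge that follows `d` in the cyclic ordering at `d.fst`. -/
structure BrauerTree (V : Type v) where
  graph : SimpleGraph V
  isTree : graph.IsTree
  next : Equiv.Perm graph.Dart
  next_fst : ∀ d, (next d).fst = d.fst
  /-- the half-edges at one vertex form a single cycle -/
  next_cyclic : ∀ d d' : graph.Dart, d.fst = d'.fst → next.SameCycle d d'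

noncomputable section

namespace BrauerTree

variable {V : Type v} (Γ : BrauerTree V)

/-- The edges of the tree, i.e. the vertices of the Brauer quiver. -/
abbrev Edge : Type v := Γ.graph.edgeSet

/-- The arrows of the Brauer quiver: the half-edge `d` gives the arrow from its edge to the edge
following it in the cyclic ordering at `d.fst` (a loop if `d.fst` is a leaf). The arrows with the
same `fst` form the oriented cycle of the quiver at that vertex of the tree. -/
abbrev Arrow : Type v := Γ.graph.Dart

/-- The edge underlying a half-edge; this is the vertex of the quiver where the arrow starts. -/
def src (d : Γ.Arrow) : Γ.Edge := ⟨d.edge, d.edge_mem⟩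

/-- The vertex of the quiver where an arrow ends. -/
def tgt (d : Γ.Arrow) : Γ.Edge := Γ.src (Γ.next d)

section Algebra

variable (K : Type u) [Field K]

/-- The free algebra on the vertices and the arrows of the quiver. -/
abbrev Free : Type (max u v) := FreeAlgebra K (Γ.Edge ⊕ Γ.Arrow)

variable {K} in
/-- The generator of the free algebra given by the idempotent at a vertex of the quiver. -/
def freeIdem (x : Γ.Edge) : Γ.Free K := FreeAlgebra.ι K (Sum.inl x)

variable {K} in
/-- The generator of the free algebra given by an arrow of the quiver. -/
def freeArrow (a : Γ.Arrow) : Γ.Free K := FreeAlgebra.ι K (Sum.inr a)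

variable {K} in
/-- The product of all the arrows of the cycle at `d.fst`, once around, starting with `d`. -/
def freeTurn (d : Γ.Arrow) : Γ.Free K :=
  ((List.range (Function.minimalPeriod Γ.next d)).map
    fun k => Γ.freeArrow (K := K) (Γ.next^[k] d)).prod

/-- The relations of the Brauer tree algebra.  The first five families say that the free algebra
is cut down to the path algebra of the quiver, where `ab` is the path `a` followed by `b`; the
other two are the Brauer tree relations: arrows of different cycles have product zero, and the two
full turns starting at a vertex of the quiver are equal. -/
inductive Rel : Γ.Free K → Γ.Free K → Prop
  | idem (x : Γ.Edge) : Rel (Γ.freeIdem x * Γ.freeIdem x) (Γ.freeIdem x)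
  | orth (x y : Γ.Edge) (h : x ≠ y) : Rel (Γ.freeIdem x * Γ.freeIdem y) 0
  | sum_one : Rel (∑ᶠ x : Γ.Edge, Γ.freeIdem x) 1
  | src_mul (a : Γ.Arrow) : Rel (Γ.freeIdem (Γ.src a) * Γ.freeArrow a) (Γ.freeArrow a)
  | mul_tgt (a : Γ.Arrow) : Rel (Γ.freeArrow a * Γ.freeIdem (Γ.tgt a)) (Γ.freeArrow a)
  | zero (a b : Γ.Arrow) (h : a.fst ≠ b.fst) : Rel (Γ.freeArrow a * Γ.freeArrow b) 0
  | turn (d : Γ.Arrow) : Rel (Γ.freeTurn d) (Γ.freeTurn d.symm)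

/-- The basic Brauer tree algebra of `Γ` with multiplicity one. -/
def Alg : Type (max u v) := RingQuot (Γ.Rel K)

instance : Ring (Γ.Alg K) := inferInstanceAs (Ring (RingQuot (Γ.Rel K)))

instance : Algebra K (Γ.Alg K) := inferInstanceAs (Algebra K (RingQuot (Γ.Rel K)))

/-- The quotient map from the free algebra. -/
def ofFree : Γ.Free K →ₐ[K] Γ.Alg K := RingQuot.mkAlgHom K (Γ.Rel K)

/-- The idempotent of the algebra at a vertex of the quiver. -/
def idem (x : Γ.Edge) : Γ.Alg K := Γ.ofFree K (Γ.freeIdem x)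

/-- The element of the algebra given by an arrow of the quiver. -/
def arrow (a : Γ.Arrow) : Γ.Alg K := Γ.ofFree K (Γ.freeArrow a)

/-- The indecomposable projective left module `A e_x`. -/
abbrev proj (x : Γ.Edge) : Ideal (Γ.Alg K) := Ideal.span {Γ.idem K x}

/-- A nonempty ordered set of nonrepeating arrows in which the product of any two neighbouring
arrows is not zero. -/
def IsArrowSequence (C : List Γ.Arrow) : Prop :=
  C ≠ [] ∧ C.Nodup ∧ C.IsChain fun a b => Γ.arrow K a * Γ.arrow K b ≠ 0

/-- An `A`-cycle: a maximal ordered set of nonrepeating arrows in which the product of any two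
neighbouring arrows is not zero.  The loop at an edge that ends in a leaf has product zero with
every arrow, so it is an `A`-cycle by itself: it is the formal loop that gives
every vertex of the quiver a second `A`-cycle. -/
def IsACycle (C : List Γ.Arrow) : Prop :=
  Γ.IsArrowSequence K C ∧ ∀ C', Γ.IsArrowSequence K C' → C <:+: C' → C' = C

/-- The vertices of the quiver that belong to a sequence of arrows. -/
def vertices (C : List Γ.Arrow) : Set Γ.Edge :=
  {x | ∃ a ∈ C, x = Γ.src a ∨ x = Γ.tgt a}

/-- A submodule is superfluous if it has no proper supplement. -/
def IsSuperfluous {R : Type*} [Ring R] {M : Type*} [AddCommGroup M] [Module R M]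
    (N : Submodule R M) : Prop :=
  ∀ L : Submodule R M, N ⊔ L = ⊤ → L = ⊤

/-- A minimal projective presentation `P₀ → P₁ → M → 0` of a module `M`, with `P₀` and `P₁`
written as finite direct sums of the modules `A e_x`: both `P₁ → M` and `P₀ → ker (P₁ → M)` are
projective covers. -/
structure MinPresentation (M : ModuleCat.{max u v} (Γ.Alg K)) where
  rank₀ : ℕ
  rank₁ : ℕ
  index₀ : Fin rank₀ → Γ.Edge
  index₁ : Fin rank₁ → Γ.Edge
  map : (∀ i, Γ.proj K (index₀ i)) →ₗ[Γ.Alg K] (∀ j, Γ.proj K (index₁ j))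
  cover : (∀ j, Γ.proj K (index₁ j)) →ₗ[Γ.Alg K] M
  cover_surjective : Function.Surjective cover
  exact : Function.Exact map cover
  superfluous_ker_cover : IsSuperfluous (LinearMap.ker cover)
  superfluous_ker_map : IsSuperfluous (LinearMap.ker map)

namespace MinPresentation

variable {Γ K} {M : ModuleCat.{max u v} (Γ.Alg K)} (T : Γ.MinPresentation K M)

/-- The two-term complex `P₀ → P₁`, concentrated in degrees `0` and `1`. -/
def complex : CochainComplex (ModuleCat.{max u v} (Γ.Alg K)) ℤ :=
  HomologicalComplex.double (c := ComplexShape.up ℤ) (i₀ := 0) (i₁ := 1)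
    (ModuleCat.ofHom T.map) rfl

/-- The component of the differential between two of the summands. -/
def component (i : Fin T.rank₀) (j : Fin T.rank₁) :
    Γ.proj K (T.index₀ i) →ₗ[Γ.Alg K] Γ.proj K (T.index₁ j) :=
  LinearMap.proj j ∘ₗ T.map ∘ₗ
    LinearMap.single (Γ.Alg K) (fun i => (Γ.proj K (T.index₀ i))) i

/-- The arrows of the diagram of `T`: whenever the component from `A e_x` to `A e_y` is not zero,
the diagram contains the shortest nontrivial path from `x` to `y` inside a cycle of the quiver,
namely `d, next d, …, next^[m - 1] d`, where `d` starts at `x` and `m` is the least positive number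
for which `next^[m] d` starts at `y`. -/
def diagramArrows : Set Γ.Arrow :=
  {a | ∃ i j, T.component i j ≠ 0 ∧ ∃ (d : Γ.Arrow) (m : ℕ),
    Γ.src d = T.index₀ i ∧ 0 < m ∧ Γ.src (Γ.next^[m] d) = T.index₁ j ∧
    (∀ k, 0 < k → k < m → Γ.src (Γ.next^[k] d) ≠ T.index₁ j) ∧
    ∃ k < m, a = Γ.next^[k] d}

/-- The vertices of the diagram of `T`: the marked vertices and those on the marked paths. -/
def diagramVertices : Set Γ.Edge :=
  Set.range T.index₀ ∪ Set.range T.index₁ ∪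
    {x | ∃ a ∈ T.diagramArrows, x = Γ.src a ∨ x = Γ.tgt a}

/-- `x` is an end point of the diagram: exactly one arrow of the diagram is incident to it. -/
def IsEndPoint (x : Γ.Edge) : Prop :=
  {a ∈ T.diagramArrows | x = Γ.src a ∨ x = Γ.tgt a}.ncard = 1

/-- `x` is a degree-one source of the diagram; the sources index the summands of `P₀`. -/
def IsDegreeOneSource (x : Γ.Edge) : Prop := x ∈ Set.range T.index₀ ∧ T.IsEndPoint x

/-- `x` is a degree-one sink of the diagram; the sinks index the summands of `P₁`. -/
def IsDegreeOneSink (x : Γ.Edge) : Prop := x ∈ Set.range T.index₁ ∧ T.IsEndPoint x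

/-- `x` is the only vertex of the diagram of `T` that belongs to `C`. -/
def IsOnlyVertexOn (C : List Γ.Arrow) (x : Γ.Edge) : Prop :=
  T.diagramVertices ∩ Γ.vertices C = {x}

end MinPresentation

end Algebra

end BrauerTree

/-- A complex `T` is partial tilting if `Hom(T, T[k]) = 0` in the derived category for all `k ≠ 0`. -/
def IsPartialTilting {C : Type*} [Category* C] [Abelian C] [HasDerivedCategory.{w} C]
    (T : CochainComplex C ℤ) : Prop :=
  ∀ k : ℤ, k ≠ 0 → ∀ φ : DerivedCategory.Q.obj T ⟶ (DerivedCategory.Q.obj T)⟦k⟧, φ = 0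

end

noncomputable section

namespace BrauerTree

variable {V : Type v} (Γ : BrauerTree V)

/-! ### Darts and edges -/

instance finite_arrow [Finite V] : Finite Γ.Arrow :=
  Finite.of_injective (fun d : Γ.Arrow => d.toProd) SimpleGraph.Dart.toProd_injective

variable {Γ}

theorem src_eq_iff {d d' : Γ.Arrow} : Γ.src d = Γ.src d' ↔ d = d' ∨ d = d'.symm := by
  rw [← SimpleGraph.dart_edge_eq_iff]
  simp [src, Subtype.ext_iff]

@[simp] theorem src_symm (d : Γ.Arrow) : Γ.src d.symm = Γ.src d :=
  src_eq_iff.2 (Or.inr rfl)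

theorem symm_fst_ne (d : Γ.Arrow) : d.symm.fst ≠ d.fst := fun h => d.adj.ne h.symm

theorem eq_of_src_eq_of_fst_eq {d d' : Γ.Arrow} (h : Γ.src d = Γ.src d') (hf : d.fst = d'.fst) :
    d = d' := by
  rcases src_eq_iff.1 h with h | h
  · exact h
  · subst h
    exact absurd hf (symm_fst_ne d')

theorem mem_src_iff {d : Γ.Arrow} {w : V} : w ∈ (Γ.src d).1 ↔ w = d.fst ∨ w = d.snd := by
  change w ∈ d.edge ↔ _
  rw [SimpleGraph.Dart.edge, Sym2.mk, ← Sym2.mem_iff]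

theorem fst_mem_src (d : Γ.Arrow) : d.fst ∈ (Γ.src d).1 := mem_src_iff.2 (Or.inl rfl)

theorem snd_mem_src (d : Γ.Arrow) : d.snd ∈ (Γ.src d).1 := mem_src_iff.2 (Or.inr rfl)

theorem exists_dart_of_mem {x : Γ.Edge} {w : V} (h : w ∈ x.1) :
    ∃ d : Γ.Arrow, Γ.src d = x ∧ d.fst = w := by
  obtain ⟨x, hx⟩ := x
  obtain ⟨z, rfl⟩ := Sym2.mem_iff_exists.1 h
  exact ⟨⟨(w, z), hx⟩, rfl, rfl⟩

theorem exists_dart (x : Γ.Edge) : ∃ d : Γ.Arrow, Γ.src d = x := by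
  obtain ⟨x, hx⟩ := x
  induction x using Sym2.ind with
  | _ a b => exact ⟨⟨(a, b), hx⟩, rfl⟩

@[simp] theorem iterate_next_fst (d : Γ.Arrow) (n : ℕ) : (Γ.next^[n] d).fst = d.fst := by
  induction n generalizing d with
  | zero => rfl
  | succ n ih => rw [Function.iterate_succ_apply, ih, Γ.next_fst]

variable (Γ) in
/-- The number of edges at the vertex of a half-edge. -/
abbrev period (d : Γ.Arrow) : ℕ := Function.minimalPeriod Γ.next d

theorem period_pos [Finite V] (d : Γ.Arrow) : 0 < Γ.period d :=
  Function.minimalPeriod_pos_of_mem_periodicPts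
    (Function.Injective.mem_periodicPts Γ.next.injective d)

theorem iterate_period (d : Γ.Arrow) : Γ.next^[Γ.period d] d = d :=
  Function.iterate_minimalPeriod

theorem period_iterate [Finite V] (d : Γ.Arrow) (n : ℕ) : Γ.period (Γ.next^[n] d) = Γ.period d :=
  Function.minimalPeriod_apply_iterate (Function.Injective.mem_periodicPts Γ.next.injective d) n

theorem iterate_ne_self {d : Γ.Arrow} {n : ℕ} (h0 : 0 < n) (hn : n < Γ.period d) :
    Γ.next^[n] d ≠ d :=
  Function.not_isPeriodicPt_of_pos_of_lt_minimalPeriod h0.ne' hn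

theorem exists_iterate_eq [Finite V] {d d' : Γ.Arrow} (h : d.fst = d'.fst) :
    ∃ n < Γ.period d, Γ.next^[n] d = d' := by
  obtain ⟨n, hn⟩ := (Γ.next_cyclic d d' h).exists_nat_pow_eq
  rw [← Equiv.Perm.iterate_eq_pow] at hn
  exact ⟨n % Γ.period d, Nat.mod_lt _ (period_pos d), by
    rw [Function.iterate_mod_minimalPeriod_eq, hn]⟩

/-! ### Relations in the algebra -/

section Algebra

variable (Γ) (K : Type u) [Field K]

theorem ofFree_eq_of_rel {a b : Γ.Free K} (h : Γ.Rel K a b) : Γ.ofFree K a = Γ.ofFree K b :=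
  RingQuot.mkAlgHom_rel K h

@[simp] theorem idem_mul_self (x : Γ.Edge) : Γ.idem K x * Γ.idem K x = Γ.idem K x := by
  have := Γ.ofFree_eq_of_rel K (.idem x)
  rwa [map_mul] at this

theorem idem_mul_of_ne {x y : Γ.Edge} (h : x ≠ y) : Γ.idem K x * Γ.idem K y = 0 := by
  have := Γ.ofFree_eq_of_rel K (.orth x y h)
  rwa [map_mul, map_zero] at this

theorem sum_idem [Fintype Γ.Edge] : ∑ x, Γ.idem K x = 1 := by
  have := Γ.ofFree_eq_of_rel K .sum_one
  rwa [finsum_eq_sum_of_fintype, map_sum, map_one] at this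

@[simp] theorem idem_mul_arrow (a : Γ.Arrow) : Γ.idem K (Γ.src a) * Γ.arrow K a = Γ.arrow K a := by
  have := Γ.ofFree_eq_of_rel K (.src_mul a)
  rwa [map_mul] at this

@[simp] theorem arrow_mul_idem (a : Γ.Arrow) : Γ.arrow K a * Γ.idem K (Γ.tgt a) = Γ.arrow K a := by
  have := Γ.ofFree_eq_of_rel K (.mul_tgt a)
  rwa [map_mul] at this

theorem arrow_mul_arrow_of_fst_ne {a b : Γ.Arrow} (h : a.fst ≠ b.fst) :
    Γ.arrow K a * Γ.arrow K b = 0 := by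
  have := Γ.ofFree_eq_of_rel K (.zero a b h)
  rwa [map_mul, map_zero] at this

theorem arrow_mul_arrow_of_ne {a b : Γ.Arrow} (h : b ≠ Γ.next a) :
    Γ.arrow K a * Γ.arrow K b = 0 := by
  by_cases hf : a.fst = b.fst
  · have : Γ.tgt a ≠ Γ.src b := fun e =>
      h (eq_of_src_eq_of_fst_eq e (by rw [Γ.next_fst, hf])).symm
    rw [← Γ.arrow_mul_idem, ← Γ.idem_mul_arrow K b, mul_assoc, ← mul_assoc (Γ.idem K _),
      Γ.idem_mul_of_ne K this, zero_mul, mul_zero]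
  · exact Γ.arrow_mul_arrow_of_fst_ne K hf

/-- The path of length `n` around the cycle at `d.fst` that starts with `d`. -/
def pth : Γ.Arrow → ℕ → Γ.Alg K
  | d, 0 => Γ.idem K (Γ.src d)
  | d, n + 1 => Γ.arrow K d * pth (Γ.next d) n

theorem pth_zero (d : Γ.Arrow) : Γ.pth K d 0 = Γ.idem K (Γ.src d) := rfl

theorem pth_succ (d : Γ.Arrow) (n : ℕ) :
    Γ.pth K d (n + 1) = Γ.arrow K d * Γ.pth K (Γ.next d) n := rfl

theorem pth_one (d : Γ.Arrow) : Γ.pth K d 1 = Γ.arrow K d := by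
  rw [pth_succ, pth_zero]
  exact Γ.arrow_mul_idem K d

@[simp] theorem idem_mul_pth (d : Γ.Arrow) (n : ℕ) :
    Γ.idem K (Γ.src d) * Γ.pth K d n = Γ.pth K d n := by
  cases n with
  | zero => simp [pth_zero]
  | succ n => rw [pth_succ, ← mul_assoc, idem_mul_arrow]

theorem pth_mul_pth (d : Γ.Arrow) (m n : ℕ) :
    Γ.pth K d m * Γ.pth K (Γ.next^[m] d) n = Γ.pth K d (m + n) := by
  induction m generalizing d with
  | zero => simp [pth_zero]
  | succ m ih =>
    rw [pth_succ, mul_assoc, Function.iterate_succ_apply, ih, Nat.succ_add, pth_succ]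

@[simp] theorem pth_mul_idem (d : Γ.Arrow) (n : ℕ) :
    Γ.pth K d n * Γ.idem K (Γ.src (Γ.next^[n] d)) = Γ.pth K d n :=
  Γ.pth_mul_pth K d n 0

theorem ofFree_freeTurn (d : Γ.Arrow) :
    Γ.ofFree K (Γ.freeTurn d) =
      ((List.range (Γ.period d)).map fun k => Γ.arrow K (Γ.next^[k] d)).prod := by
  rw [freeTurn, map_list_prod, List.map_map]
  rfl

theorem pth_eq_prod (d : Γ.Arrow) {n : ℕ} (hn : 0 < n) :
    Γ.pth K d n = ((List.range n).map fun k => Γ.arrow K (Γ.next^[k] d)).prod := by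
  obtain ⟨n, rfl⟩ := Nat.exists_eq_add_one.2 hn
  clear hn
  induction n generalizing d with
  | zero => simp [pth_one]
  | succ n ih =>
    rw [pth_succ, ih, List.range_succ_eq_map (n := n + 1)]
    simp [Function.comp_def]

variable {Γ}

theorem pth_period_eq_symm [Finite V] (d : Γ.Arrow) :
    Γ.pth K d (Γ.period d) = Γ.pth K d.symm (Γ.period d.symm) := by
  rw [pth_eq_prod _ _ _ (period_pos _), pth_eq_prod _ _ _ (period_pos _), ← ofFree_freeTurn,
    ← ofFree_freeTurn]
  exact Γ.ofFree_eq_of_rel K (.turn d)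

theorem pth_mul_arrow_of_fst_ne {d a : Γ.Arrow} {n : ℕ} (hn : 0 < n) (h : d.fst ≠ a.fst) :
    Γ.pth K d n * Γ.arrow K a = 0 := by
  obtain ⟨n, rfl⟩ := Nat.exists_eq_add_one.2 hn
  rw [← pth_mul_pth, pth_one, mul_assoc, arrow_mul_arrow_of_fst_ne, mul_zero]
  simpa using h

theorem pth_eq_zero_of_period_lt [Finite V] {d : Γ.Arrow} {n : ℕ} (h : Γ.period d < n) :
    Γ.pth K d n = 0 := by
  obtain ⟨m, rfl⟩ := Nat.exists_eq_add_of_lt h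
  rw [show Γ.period d + m + 1 = Γ.period d + (m + 1) by ring, ← pth_mul_pth, iterate_period,
    pth_succ, ← mul_assoc, pth_period_eq_symm,
    pth_mul_arrow_of_fst_ne K (period_pos _) (symm_fst_ne d), zero_mul]

/-- Products of paths of different cycles vanish. -/
theorem pth_mul_pth_of_fst_ne {d d' : Γ.Arrow} {m n : ℕ} (hm : 0 < m) (hn : 0 < n)
    (h : d.fst ≠ d'.fst) : Γ.pth K d m * Γ.pth K d' n = 0 := by
  obtain ⟨n, rfl⟩ := Nat.exists_eq_add_one.2 hn
  rw [pth_succ, ← mul_assoc, pth_mul_arrow_of_fst_ne K hm h, zero_mul]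

/-- The algebra is spanned by the paths around the cycles. -/
theorem span_pth [Finite V] [Nonempty Γ.Edge] :
    Submodule.span K (Set.range fun p : Γ.Arrow × ℕ => Γ.pth K p.1 p.2) = ⊤ := by
  set S := Submodule.span K (Set.range fun p : Γ.Arrow × ℕ => Γ.pth K p.1 p.2)
  have mem (d n) : Γ.pth K d n ∈ S := Submodule.subset_span ⟨(d, n), rfl⟩
  have : Fintype Γ.Edge := Fintype.ofFinite _
  have one : (1 : Γ.Alg K) ∈ S := by
    rw [← Γ.sum_idem K]
    refine Submodule.sum_mem _ fun x _ => ?_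
    obtain ⟨d, rfl⟩ := exists_dart x
    exact mem d 0
  have step (a : Γ.Free K) : ∀ s ∈ S, Γ.ofFree K a * s ∈ S := by
    induction a using FreeAlgebra.induction with
    | grade0 r =>
      intro s hs
      rw [AlgHom.commutes, ← Algebra.smul_def]
      exact S.smul_mem r hs
    | grade1 g =>
      intro s hs
      induction hs using Submodule.span_induction with
      | zero => simp
      | add _ _ _ _ h1 h2 => rw [mul_add]; exact S.add_mem h1 h2
      | smul r _ _ h => rw [mul_smul_comm]; exact S.smul_mem r h
      | mem _ h =>
        obtain ⟨⟨d, n⟩, rfl⟩ := h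
        dsimp only
        cases g with
        | inl x =>
          change Γ.idem K x * _ ∈ S
          by_cases hx : x = Γ.src d
          · subst hx; rw [idem_mul_pth]; exact mem d n
          · rw [← idem_mul_pth, ← mul_assoc, Γ.idem_mul_of_ne K hx, zero_mul]; exact S.zero_mem
        | inr a =>
          change Γ.arrow K a * _ ∈ S
          cases n with
          | zero =>
            rw [pth_zero]
            by_cases hx : Γ.tgt a = Γ.src d
            · rw [← hx, arrow_mul_idem, ← pth_one]; exact mem a 1
            · rw [← arrow_mul_idem, mul_assoc, Γ.idem_mul_of_ne K hx, mul_zero]; exact S.zero_mem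
          | succ n =>
            by_cases hx : d = Γ.next a
            · rw [hx, ← pth_succ]; exact mem a _
            · rw [pth_succ, ← mul_assoc, Γ.arrow_mul_arrow_of_ne K hx, zero_mul]
              exact S.zero_mem
    | mul a b ha hb => intro s hs; rw [map_mul, mul_assoc]; exact ha _ (hb _ hs)
    | add a b ha hb => intro s hs; rw [map_add, add_mul]; exact S.add_mem (ha _ hs) (hb _ hs)
  rw [eq_top_iff]
  intro a _
  obtain ⟨a, rfl⟩ := RingQuot.mkAlgHom_surjective K (Γ.Rel K) a
  simpa using! step a 1 one

/-! ### A representation in which paths do not vanish -/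

/-- The linear map given by a partial map of the basis. -/
def partialMap {B : Type*} (g : B → Option B) : Module.End K (B →₀ K) :=
  Finsupp.linearCombination K fun b => (g b).elim 0 (Finsupp.single · 1)

theorem partialMap_single {B : Type*} (g : B → Option B) (b : B) :
    partialMap K g (Finsupp.single b 1) = (g b).elim 0 (Finsupp.single · 1) := by
  simp [partialMap]

theorem partialMap_mul {B : Type*} (g h : B → Option B) :
    partialMap K g * partialMap K h = partialMap K fun b => (h b).bind g := by
  refine Finsupp.lhom_ext' fun b => LinearMap.ext_ring ?_
  simp only [Module.End.mul_apply, LinearMap.comp_apply, Finsupp.lsingle_apply, partialMap_single]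
  cases h b <;> simp [partialMap_single]

theorem partialMap_eq_zero {B : Type*} {g : B → Option B} (h : ∀ b, g b = none) :
    partialMap K g = 0 := by
  refine Finsupp.lhom_ext' fun b => LinearMap.ext_ring ?_
  simp [partialMap_single, h]

theorem partialMap_some {B : Type*} : partialMap K (some : B → Option B) = 1 := by
  refine Finsupp.lhom_ext' fun b => LinearMap.ext_ring ?_
  simp [partialMap_single]

open scoped Classical in
/-- The action of a vertex of the quiver on the basis of the representation at `d₀`. -/
def actIdem (d₀ : Γ.Arrow) (x : Γ.Edge) : Option Γ.Arrow → Option (Option Γ.Arrow)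
  | none => if x = Γ.src d₀ then some none else none
  | some d => if x = Γ.src d then some (some d) else none

open scoped Classical in
/-- The normal form of the basis vector given by a half-edge: the two half-edges of the edge
of `d₀` give the same vector. -/
def rep (d₀ a : Γ.Arrow) : Γ.Arrow := if a = d₀.symm then d₀ else a

open scoped Classical in
/-- The action of an arrow on the basis of the representation at `d₀`. The basis vector `none`
stands for the trivial path, `some d` for the shortest nontrivial path from `d` to the edge of `d₀`. -/
def actArrow (d₀ a : Γ.Arrow) : Option Γ.Arrow → Option (Option Γ.Arrow)
  | none => if Γ.next a = d₀ ∨ Γ.next a = d₀.symm then some (some (rep d₀ a)) else none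
  | some d => if d = Γ.next a ∧ d ≠ d₀ ∧ d ≠ d₀.symm ∧ (d.fst = d₀.fst ∨ d.fst = d₀.snd) then
      some (some (rep d₀ a)) else none

theorem src_rep (d₀ a : Γ.Arrow) : Γ.src (rep d₀ a) = Γ.src a := by
  unfold rep
  split_ifs with h
  · simp [h]
  · rfl

/-- The action of a path on the basis of the representation at `d₀`. -/
def actPath (d₀ : Γ.Arrow) : Γ.Arrow → ℕ → Option Γ.Arrow → Option (Option Γ.Arrow)
  | _, 0 => some
  | d, n + 1 => fun b => (actPath d₀ (Γ.next d) n b).bind (actArrow d₀ d)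

theorem actPath_succ (d₀ d : Γ.Arrow) (n : ℕ) (b : Option Γ.Arrow) :
    actPath d₀ d (n + 1) b = (actPath d₀ (Γ.next d) n b).bind (actArrow d₀ d) := rfl

theorem prod_partialMap_actArrow (d₀ d : Γ.Arrow) (n : ℕ) :
    ((List.range n).map fun k => partialMap K (actArrow d₀ (Γ.next^[k] d))).prod =
      partialMap K (actPath d₀ d n) := by
  induction n generalizing d with
  | zero => simp [actPath, partialMap_some]
  | succ n ih =>
    rw [List.range_succ_eq_map]
    simp only [List.map_cons, List.map_map, List.prod_cons, Function.comp_def,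
      Function.iterate_succ_apply, Function.iterate_zero, id, ih, partialMap_mul]
    rfl

theorem actPath_none {d₀ d : Γ.Arrow} {n : ℕ} (hn : 0 < n) (hp : n ≤ Γ.period d) [Finite V]
    (h : Γ.next^[n] d = d₀ ∨ Γ.next^[n] d = d₀.symm) :
    actPath d₀ d n none = some (some (rep d₀ d)) := by
  obtain ⟨n, rfl⟩ := Nat.exists_eq_add_one.2 hn
  clear hn
  induction n generalizing d with
  | zero => simp only [actPath, actArrow, Option.bind_some]; exact if_pos h
  | succ n ih =>
    have hper : Γ.period (Γ.next d) = Γ.period d := period_iterate d 1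
    rw [actPath_succ, ih (by rw [hper]; omega) (by simpa using! h)]
    have hfst : Γ.next d ≠ Γ.next^[n + 2] d := by
      rw [show n + 2 = (n + 1) + 1 from rfl, Function.iterate_succ_apply]
      exact (iterate_ne_self (by omega) (by omega)).symm
    have hsymm : Γ.next d ≠ (Γ.next^[n + 2] d).symm := fun e => by
      have := congrArg (fun a : Γ.Arrow => a.fst) e
      simp only [Γ.next_fst] at this
      exact symm_fst_ne (Γ.next^[n + 2] d) (by rw [← this, iterate_next_fst])
    have hmem : d.fst = d₀.fst ∨ d.fst = d₀.snd := by
      rcases h with h | h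
      · left; rw [← h, iterate_next_fst]
      · right; rw [show d₀.snd = d₀.symm.fst from rfl, ← h, iterate_next_fst]
    have h0 : Γ.next d ≠ d₀ ∧ Γ.next d ≠ d₀.symm := by
      rcases h with h | h
      · rw [← h]; exact ⟨hfst, hsymm⟩
      · rw [← h, ← SimpleGraph.Dart.symm_symm d₀, ← h]; exact ⟨hsymm, hfst⟩
    have hr : rep d₀ (Γ.next d) = Γ.next d := if_neg h0.2
    simp [actArrow, hr, h0, Γ.next_fst, hmem]

theorem actPath_some_eq_some {d₀ d d₁ : Γ.Arrow} {n : ℕ} {b : Option Γ.Arrow}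
    (h : actPath d₀ d n (some d₁) = some b) : ∃ d', b = some d' := by
  cases n with
  | zero => exact ⟨d₁, by simpa [actPath] using h.symm⟩
  | succ n =>
    rw [actPath_succ] at h
    obtain ⟨c, -, hc⟩ := Option.bind_eq_some_iff.1 h
    cases c <;> simp only [actArrow] at hc <;> split_ifs at hc <;>
      exact ⟨_, (Option.some.inj hc).symm⟩

theorem actPath_some_eq_none {d₀ d d₁ : Γ.Arrow} {n k : ℕ} (hk : 0 < k) (hkn : k ≤ n)
    (h : Γ.next^[k] d = d₀ ∨ Γ.next^[k] d = d₀.symm) : actPath d₀ d n (some d₁) = none := by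
  induction n generalizing d k with
  | zero => omega
  | succ n ih =>
    rw [actPath_succ]
    obtain ⟨k, rfl⟩ := Nat.exists_eq_add_one.2 hk
    by_cases h0 : k = 0
    · subst h0
      cases hb : actPath d₀ (Γ.next d) n (some d₁) with
      | none => rfl
      | some b =>
        obtain ⟨d', rfl⟩ := actPath_some_eq_some hb
        rw [Option.bind_some]
        simp only [actArrow]
        rw [if_neg]
        rintro ⟨rfl, h1, h2, -⟩
        simp at h
        tauto
    · rw [ih (k := k) (by omega) (by omega) (by simpa using! h)]
      rfl

theorem actPath_some_of_fst {d₀ d d₁ : Γ.Arrow} {n : ℕ} (hn : 0 < n)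
    (h : d.fst ≠ d₀.fst ∧ d.fst ≠ d₀.snd) : actPath d₀ d n (some d₁) = none := by
  obtain ⟨n, rfl⟩ := Nat.exists_eq_add_one.2 hn
  rw [actPath_succ]
  cases hb : actPath d₀ (Γ.next d) n (some d₁) with
  | none => rfl
  | some b =>
    obtain ⟨d', rfl⟩ := actPath_some_eq_some hb
    rw [Option.bind_some]
    simp only [actArrow]
    rw [if_neg]
    rintro ⟨rfl, -, -, h'⟩
    rw [Γ.next_fst] at h'
    tauto

theorem actPath_none_of_src_ne {d₀ d : Γ.Arrow} {n : ℕ} (hn : 0 < n)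
    (h : Γ.src (Γ.next^[n] d) ≠ Γ.src d₀) : actPath d₀ d n none = none := by
  obtain ⟨n, rfl⟩ := Nat.exists_eq_add_one.2 hn
  clear hn
  induction n generalizing d with
  | zero =>
    rw [Ne, src_eq_iff] at h
    simpa [actPath, actArrow] using h
  | succ n ih => rw [actPath_succ, ih (by simpa using! h)]; rfl

theorem actPath_period [Finite V] (d₀ d : Γ.Arrow) :
    actPath d₀ d (Γ.period d) = actPath d₀ d.symm (Γ.period d.symm) := by
  have key (d d₁ : Γ.Arrow) : actPath d₀ d (Γ.period d) (some d₁) = none := by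
    have go (e : Γ.Arrow) (he : e = d₀ ∨ e = d₀.symm) (hf : d.fst = e.fst) :
        actPath d₀ d (Γ.period d) (some d₁) = none := by
      obtain ⟨n, hn, hne⟩ := exists_iterate_eq hf
      rcases Nat.eq_zero_or_pos n with rfl | h0
      · refine actPath_some_eq_none (period_pos d) le_rfl ?_
        rw [iterate_period]; rw [Function.iterate_zero, id] at hne; rwa [hne]
      · exact actPath_some_eq_none h0 hn.le (by rwa [hne])
    by_cases h1 : d.fst = d₀.fst
    · exact go d₀ (Or.inl rfl) h1
    by_cases h2 : d.fst = d₀.snd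
    · exact go d₀.symm (Or.inr rfl) h2
    exact actPath_some_of_fst (period_pos d) ⟨h1, h2⟩
  funext b
  cases b with
  | some d₁ => rw [key, key]
  | none =>
    by_cases h : Γ.src d = Γ.src d₀
    · have h' := src_eq_iff.1 h
      have h'' := src_eq_iff.1 ((src_symm d).trans h)
      rw [actPath_none (period_pos _) le_rfl (by rwa [iterate_period]),
        actPath_none (period_pos _) le_rfl (by rwa [iterate_period])]
      have hne : d ≠ d.symm := fun e => symm_fst_ne d (by rw [← e])
      rcases h' with rfl | rfl <;> simp [rep]
    · rw [actPath_none_of_src_ne (period_pos _) (by rwa [iterate_period]),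
        actPath_none_of_src_ne (period_pos _) (by rwa [iterate_period, src_symm])]

/-- The action of the free algebra on the representation at `d₀`. -/
def freeRep (d₀ : Γ.Arrow) : Γ.Free K →ₐ[K] Module.End K (Option Γ.Arrow →₀ K) :=
  FreeAlgebra.lift K (Sum.elim (fun x => partialMap K (actIdem d₀ x))
    fun a => partialMap K (actArrow d₀ a))

theorem freeRep_idem (d₀ : Γ.Arrow) (x : Γ.Edge) :
    freeRep K d₀ (Γ.freeIdem x) = partialMap K (actIdem d₀ x) := by
  simp [freeRep, freeIdem]

theorem freeRep_arrow (d₀ a : Γ.Arrow) :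
    freeRep K d₀ (Γ.freeArrow a) = partialMap K (actArrow d₀ a) := by
  simp [freeRep, freeArrow]

theorem freeRep_turn (d₀ d : Γ.Arrow) :
    freeRep K d₀ (Γ.freeTurn d) = partialMap K (actPath d₀ d (Γ.period d)) := by
  rw [freeTurn, map_list_prod, List.map_map, ← prod_partialMap_actArrow]
  simp only [Function.comp_def, freeRep_arrow]

theorem freeRep_rel [Finite V] (d₀ : Γ.Arrow) {a b : Γ.Free K} (h : Γ.Rel K a b) :
    freeRep K d₀ a = freeRep K d₀ b := by
  cases h with
  | idem x =>
    rw [map_mul, freeRep_idem, partialMap_mul]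
    congr 1
    funext b
    cases b <;> simp only [actIdem] <;> split_ifs with h <;> simp [actIdem, h]
  | orth x y h =>
    rw [map_mul, freeRep_idem, freeRep_idem, partialMap_mul, map_zero]
    refine partialMap_eq_zero K fun b => ?_
    cases b <;> simp only [actIdem] <;> split_ifs with h' <;> simp [actIdem] <;>
      exact fun e => h (e.trans h'.symm)
  | sum_one =>
    have : Fintype Γ.Edge := Fintype.ofFinite _
    rw [finsum_eq_sum_of_fintype, map_sum, map_one]
    refine Finsupp.lhom_ext' fun b => LinearMap.ext_ring ?_
    simp only [freeRep_idem, LinearMap.comp_apply, Finsupp.lsingle_apply, LinearMap.sum_apply,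
      partialMap_single, Module.End.one_apply]
    cases b with
    | none =>
      rw [Finset.sum_eq_single (Γ.src d₀)]
      · simp [actIdem]
      · intro y _ hy; simp [actIdem, hy]
      · simp
    | some d =>
      rw [Finset.sum_eq_single (Γ.src d)]
      · simp [actIdem]
      · intro y _ hy; simp [actIdem, hy]
      · simp
  | src_mul a =>
    rw [map_mul, freeRep_idem, freeRep_arrow, partialMap_mul]
    congr 1
    funext b
    cases b <;> simp only [actArrow] <;> split_ifs with h <;> simp [actIdem, src_rep]
  | mul_tgt a =>
    rw [map_mul, freeRep_idem, freeRep_arrow, partialMap_mul]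
    congr 1
    funext b
    cases b with
    | none =>
      simp only [actIdem]
      by_cases h : Γ.tgt a = Γ.src d₀
      · rw [if_pos h, Option.bind_some]
      · rw [if_neg h, Option.bind_none]
        exact (if_neg (mt src_eq_iff.2 h)).symm
    | some d =>
      simp only [actIdem]
      by_cases h : Γ.tgt a = Γ.src d
      · rw [if_pos h, Option.bind_some]
      · rw [if_neg h, Option.bind_none]
        exact (if_neg fun h' => h (by rw [h'.1]; rfl)).symm
  | zero a b h =>
    rw [map_mul, freeRep_arrow, freeRep_arrow, partialMap_mul, map_zero]
    have aux : actArrow d₀ a (some (rep d₀ b)) = none := by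
      simp only [actArrow]
      rw [if_neg]
      rintro ⟨h1, h2, -⟩
      unfold rep at h1 h2
      split_ifs at h1 h2 with h3
      · exact h2 rfl
      · exact h (by rw [h1, Γ.next_fst])
    refine partialMap_eq_zero K fun c => ?_
    cases c <;> simp only [actArrow] <;> split_ifs <;> first | exact aux | rfl
  | turn d => rw [freeRep_turn, freeRep_turn, actPath_period]

/-- The representation of the algebra at `d₀`; it is the projective module of the edge of `d₀`. -/
def algRep [Finite V] (d₀ : Γ.Arrow) : Γ.Alg K →ₐ[K] Module.End K (Option Γ.Arrow →₀ K) :=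
  RingQuot.liftAlgHom K ⟨freeRep K d₀, fun _ _ h => freeRep_rel K d₀ h⟩

theorem algRep_ofFree [Finite V] (d₀ : Γ.Arrow) (a : Γ.Free K) :
    algRep K d₀ (Γ.ofFree K a) = freeRep K d₀ a :=
  RingQuot.liftAlgHom_mkAlgHom_apply K _ _ _

theorem algRep_pth [Finite V] (d₀ d : Γ.Arrow) {n : ℕ} (hn : 0 < n) :
    algRep K d₀ (Γ.pth K d n) = partialMap K (actPath d₀ d n) := by
  rw [pth_eq_prod _ _ _ hn, map_list_prod, List.map_map, ← prod_partialMap_actArrow]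
  simp only [Function.comp_def, arrow, algRep_ofFree, freeRep_arrow]

theorem algRep_pth_none [Finite V] {d : Γ.Arrow} {n : ℕ} (hn : 0 < n) (hp : n ≤ Γ.period d) :
    algRep K (Γ.next^[n] d) (Γ.pth K d n) (Finsupp.single none 1) =
      Finsupp.single (some (rep (Γ.next^[n] d) d)) 1 := by
  rw [algRep_pth _ _ _ hn, partialMap_single, actPath_none hn hp (Or.inl rfl)]
  rfl

theorem algRep_idem_none [Finite V] (d₀ : Γ.Arrow) :
    algRep K d₀ (Γ.idem K (Γ.src d₀)) (Finsupp.single none 1) = Finsupp.single none 1 := by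
  rw [idem, algRep_ofFree, freeRep_idem, partialMap_single]
  simp [actIdem]

theorem pth_ne_zero [Finite V] {d : Γ.Arrow} {n : ℕ} (hp : n ≤ Γ.period d) :
    Γ.pth K d n ≠ 0 := by
  intro h
  rcases Nat.eq_zero_or_pos n with rfl | hn
  · have := algRep_idem_none K d
    rw [← pth_zero, h] at this
    rw [map_zero, LinearMap.zero_apply] at this
    exact one_ne_zero (Finsupp.single_eq_zero.1 this.symm)
  · have := algRep_pth_none K hn hp
    rw [h] at this
    rw [map_zero, LinearMap.zero_apply] at this
    exact one_ne_zero (Finsupp.single_eq_zero.1 this.symm)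

theorem linearIndependent_idem_pth_period [Finite V] (d : Γ.Arrow) :
    LinearIndependent K ![Γ.idem K (Γ.src d), Γ.pth K d (Γ.period d)] := by
  rw [LinearIndependent.pair_iff]
  intro s t h
  have := congrArg (fun a => algRep K d a (Finsupp.single none 1)) h
  have h1 := algRep_pth_none K (period_pos d) le_rfl
  rw [iterate_period] at h1
  simp only [map_add, map_smul, LinearMap.add_apply, LinearMap.smul_apply, algRep_idem_none, h1,
    map_zero, LinearMap.zero_apply] at this
  have h2 := DFunLike.congr_fun this none
  have h3 := DFunLike.congr_fun this (some (rep d d))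
  constructor
  · simpa using h2
  · simpa using h3

end Algebra

end BrauerTree

end

noncomputable section

namespace BrauerTree

variable {V : Type v} {Γ : BrauerTree V}

/-! ### Positions around a vertex -/

/-- The number of steps from `d` to `d'` around their common vertex. -/
def pos (d d' : Γ.Arrow) : ℕ := sInf {n | Γ.next^[n] d = d'}

section Pos

variable [Finite V]

theorem iterate_pos {d d' : Γ.Arrow} (h : d.fst = d'.fst) : Γ.next^[pos d d'] d = d' := by
  obtain ⟨n, -, hn⟩ := exists_iterate_eq h
  exact Nat.sInf_mem (s := {n | Γ.next^[n] d = d'}) ⟨n, hn⟩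

theorem pos_lt {d d' : Γ.Arrow} (h : d.fst = d'.fst) : pos d d' < Γ.period d := by
  obtain ⟨n, hn, hn'⟩ := exists_iterate_eq h
  exact (Nat.sInf_le (s := {n | Γ.next^[n] d = d'}) hn').trans_lt hn

theorem pos_eq_of_iterate {d d' : Γ.Arrow} {n : ℕ} (hn : n < Γ.period d)
    (h : Γ.next^[n] d = d') : pos d d' = n := by
  have hf : d.fst = d'.fst := by rw [← h, iterate_next_fst]
  exact Function.iterate_injOn_Iio_minimalPeriod (pos_lt hf) hn ((iterate_pos hf).trans h.symm)

@[simp] theorem pos_self (d : Γ.Arrow) : pos d d = 0 := pos_eq_of_iterate (period_pos d) rfl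

theorem pos_eq_zero_iff {d d' : Γ.Arrow} (h : d.fst = d'.fst) : pos d d' = 0 ↔ d = d' := by
  refine ⟨fun h0 => ?_, fun e => by rw [e, pos_self]⟩
  simpa [h0] using iterate_pos h

theorem pos_inj {b d d' : Γ.Arrow} (h : b.fst = d.fst) (h' : b.fst = d'.fst)
    (e : pos b d = pos b d') : d = d' := by
  rw [← iterate_pos h, e, iterate_pos h']

theorem period_eq_of_fst {d d' : Γ.Arrow} (h : d.fst = d'.fst) : Γ.period d = Γ.period d' := by
  rw [← iterate_pos h, period_iterate]

/-- Distances around a vertex, measured from a base half-edge `b`. -/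
theorem pos_add_pos {b d d' : Γ.Arrow} (h : b.fst = d.fst) (h' : b.fst = d'.fst) :
    pos b d + pos d d' = pos b d' + if pos b d ≤ pos b d' then 0 else Γ.period b := by
  have hp := period_eq_of_fst h
  have hl := pos_lt h
  have hl' := pos_lt h'
  have go (k : ℕ) : Γ.next^[k] d = Γ.next^[k + pos b d] b := by
    rw [Function.iterate_add_apply, iterate_pos h]
  split_ifs with hle
  · have := pos_eq_of_iterate (d := d) (d' := d') (n := pos b d' - pos b d) (by omega)
      (by rw [go, Nat.sub_add_cancel hle, iterate_pos h'])
    omega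
  · have := pos_eq_of_iterate (d := d) (d' := d') (n := pos b d' + Γ.period b - pos b d) (by omega)
      (by rw [go, Nat.sub_add_cancel (by omega), Function.iterate_add_apply, iterate_period,
        iterate_pos h'])
    omega

end Pos

/-- The half-edge of the edge `x` at the vertex `w` (some half-edge of `x` if `w` is not an end). -/
def half (w : V) (x : Γ.Edge) : Γ.Arrow :=
  open Classical in if h : w ∈ x.1 then (exists_dart_of_mem h).choose else (exists_dart x).choose

@[simp] theorem src_half (w : V) (x : Γ.Edge) : Γ.src (half w x) = x := by
  unfold half
  split_ifs with h
  · exact (exists_dart_of_mem h).choose_spec.1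
  · exact (exists_dart x).choose_spec

theorem half_fst {w : V} {x : Γ.Edge} (h : w ∈ x.1) : (half w x).fst = w := by
  unfold half
  rw [dif_pos h]
  exact (exists_dart_of_mem h).choose_spec.2

theorem eq_half {d : Γ.Arrow} {w : V} (h : d.fst = w) : d = half w (Γ.src d) := by
  have : w ∈ (Γ.src d).1 := h ▸ fst_mem_src d
  exact eq_of_src_eq_of_fst_eq (src_half _ _).symm (by rw [h, half_fst this])

theorem half_inj {w w' : V} {x y : Γ.Edge} (h : half w x = half w' y) : x = y := by
  rw [← src_half w x, h, src_half]

theorem half_fst_eq {w : V} {x y : Γ.Edge} (hx : w ∈ x.1) (hy : w ∈ y.1) :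
    (half w x).fst = (half w y).fst := by rw [half_fst hx, half_fst hy]

/-- The number of steps from the edge `x` to the edge `y` around the vertex `w`. -/
def dpos (w : V) (x y : Γ.Edge) : ℕ := pos (half w x) (half w y)

theorem eq_of_mem_of_mem {x y : Γ.Edge} {w w' : V} (hw : w ≠ w') (hx : w ∈ x.1) (hx' : w' ∈ x.1)
    (hy : w ∈ y.1) (hy' : w' ∈ y.1) : x = y :=
  Subtype.ext (Sym2.eq_of_ne_mem hw hx hx' hy hy')

section Pos

variable [Finite V]

@[simp] theorem dpos_self (w : V) (x : Γ.Edge) : dpos w x x = 0 := pos_self _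

theorem dpos_pos {w : V} {x y : Γ.Edge} (hx : w ∈ x.1) (hy : w ∈ y.1) (h : x ≠ y) :
    0 < dpos w x y := by
  rw [Nat.pos_iff_ne_zero, Ne, dpos, pos_eq_zero_iff (half_fst_eq hx hy)]
  exact fun e => h (half_inj e)

theorem dpos_inj {w : V} {b x y : Γ.Edge} (hb : w ∈ b.1) (hx : w ∈ x.1) (hy : w ∈ y.1)
    (e : dpos w b x = dpos w b y) : x = y :=
  half_inj (pos_inj (half_fst_eq hb hx) (half_fst_eq hb hy) e)

theorem dpos_lt {w : V} {x y : Γ.Edge} (hx : w ∈ x.1) (hy : w ∈ y.1) :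
    dpos w x y < Γ.period (half w x) := pos_lt (half_fst_eq hx hy)

theorem dpos_add_dpos {w : V} {b x y : Γ.Edge} (hb : w ∈ b.1) (hx : w ∈ x.1) (hy : w ∈ y.1) :
    dpos w b x + dpos w x y =
      dpos w b y + if dpos w b x ≤ dpos w b y then 0 else Γ.period (half w b) :=
  pos_add_pos (half_fst_eq hb hx) (half_fst_eq hb hy)

/-- The edges `x`, `y`, `z` at `w` occur in this cyclic order; `x = y` and `y = z` are allowed. -/
theorem dpos_le_dpos_iff {w : V} {b x y z : Γ.Edge} (hb : w ∈ b.1) (hx : w ∈ x.1) (hy : w ∈ y.1)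
    (hz : w ∈ z.1) : dpos w x y ≤ dpos w x z ↔
      (dpos w b x ≤ dpos w b y ∧ dpos w b y ≤ dpos w b z) ∨
      (dpos w b y ≤ dpos w b z ∧ dpos w b z < dpos w b x) ∨
      (dpos w b z < dpos w b x ∧ dpos w b x ≤ dpos w b y) := by
  have h1 := dpos_add_dpos hb hx hy
  have h2 := dpos_add_dpos hb hx hz
  have := dpos_lt hb hx
  have := dpos_lt hb hy
  have := dpos_lt hb hz
  split_ifs at h1 h2 <;> omega

end Pos

section Algebra

variable (K : Type u) [Field K]

/-- The path from `x` to `y` around the vertex `w`. -/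
def qpath (w : V) (x y : Γ.Edge) : Γ.Alg K := Γ.pth K (half w x) (dpos w x y)

variable {K} in
theorem idem_mul_qpath (w : V) (x y : Γ.Edge) :
    Γ.idem K x * qpath K w x y = qpath K w x y := by
  have := Γ.idem_mul_pth K (half w x) (dpos w x y)
  rwa [src_half] at this

section

variable [Finite V]

@[simp] theorem qpath_self (w : V) (x : Γ.Edge) : qpath K w x x = Γ.idem K x := by
  rw [qpath, dpos_self, pth_zero, src_half]

variable {K} in
theorem qpath_mul_idem {w : V} {x y : Γ.Edge} (hx : w ∈ x.1) (hy : w ∈ y.1) :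
    qpath K w x y * Γ.idem K y = qpath K w x y := by
  have := Γ.pth_mul_idem K (half w x) (dpos w x y)
  rwa [dpos, iterate_pos (half_fst_eq hx hy), src_half] at this

variable {K} in
theorem qpath_mul_qpath {w : V} {x y z : Γ.Edge} (hx : w ∈ x.1) (hy : w ∈ y.1) (hz : w ∈ z.1)
    (hxz : x ≠ z) : qpath K w x y * qpath K w y z =
      if dpos w x y ≤ dpos w x z then qpath K w x z else 0 := by
  have h : qpath K w x y * qpath K w y z = Γ.pth K (half w x) (dpos w x y + dpos w y z) := by
    rw [← pth_mul_pth, dpos, iterate_pos (half_fst_eq hx hy)]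
    rfl
  have := dpos_pos hx hz hxz
  rw [h, dpos_add_dpos hx hy hz]
  split_ifs with hle
  · rfl
  · exact pth_eq_zero_of_period_lt K (by omega)

variable {K} in
theorem qpath_mul_qpath_of_ne {w w' : V} {x y z : Γ.Edge} (hx : w ∈ x.1) (hy : w ∈ y.1)
    (hy' : w' ∈ y.1) (hz : w' ∈ z.1) (hxy : x ≠ y) (hyz : y ≠ z) (hw : w ≠ w') :
    qpath K w x y * qpath K w' y z = 0 :=
  pth_mul_pth_of_fst_ne K (dpos_pos hx hy hxy) (dpos_pos hy' hz hyz)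
    (by rwa [half_fst hx, half_fst hy'])

theorem qpath_ne_zero {w : V} {x y : Γ.Edge} (hx : w ∈ x.1) (hy : w ∈ y.1) :
    qpath K w x y ≠ 0 :=
  pth_ne_zero K (dpos_lt hx hy).le

end

/-- The elements `a` of the algebra with `e_x a = a = a e_y`. -/
def peirce (x y : Γ.Edge) : Submodule K (Γ.Alg K) where
  carrier := {a | Γ.idem K x * a = a ∧ a * Γ.idem K y = a}
  add_mem' := by
    rintro a b ⟨h1, h2⟩ ⟨h3, h4⟩
    exact ⟨by rw [mul_add, h1, h3], by rw [add_mul, h2, h4]⟩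
  zero_mem' := ⟨mul_zero _, zero_mul _⟩
  smul_mem' := by
    rintro c a ⟨h1, h2⟩
    exact ⟨by rw [mul_smul_comm, h1], by rw [smul_mul_assoc, h2]⟩

variable {K}

theorem mul_mem_peirce {x y z : Γ.Edge} {a b : Γ.Alg K} (ha : a ∈ peirce K x y)
    (hb : b ∈ peirce K y z) : a * b ∈ peirce K x z :=
  ⟨by rw [← mul_assoc, ha.1], by rw [mul_assoc, hb.2]⟩

theorem idem_mem_peirce (x : Γ.Edge) : Γ.idem K x ∈ peirce K x x :=
  ⟨Γ.idem_mul_self K x, Γ.idem_mul_self K x⟩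

section

variable [Finite V]

theorem qpath_mem_peirce {w : V} {x y : Γ.Edge} (hx : w ∈ x.1) (hy : w ∈ y.1) :
    qpath K w x y ∈ peirce K x y :=
  ⟨idem_mul_qpath w x y, qpath_mul_idem hx hy⟩

theorem peirce_le_span (x y : Γ.Edge) :
    peirce K x y ≤ Submodule.span K {a | ∃ (d : Γ.Arrow) (n : ℕ), n ≤ Γ.period d ∧ Γ.src d = x ∧
      Γ.src (Γ.next^[n] d) = y ∧ a = Γ.pth K d n} := by
  have : Nonempty Γ.Edge := ⟨x⟩
  rintro a ⟨h1, h2⟩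
  have ha : a ∈ Submodule.span K (Set.range fun p : Γ.Arrow × ℕ => Γ.pth K p.1 p.2) := by
    rw [span_pth]; trivial
  have key : ∀ b ∈ Submodule.span K (Set.range fun p : Γ.Arrow × ℕ => Γ.pth K p.1 p.2),
      Γ.idem K x * b * Γ.idem K y ∈ Submodule.span K {a | ∃ (d : Γ.Arrow) (n : ℕ),
        n ≤ Γ.period d ∧ Γ.src d = x ∧ Γ.src (Γ.next^[n] d) = y ∧ a = Γ.pth K d n} := by
    intro b hb
    induction hb using Submodule.span_induction with
    | zero => simp
    | add _ _ _ _ h1 h2 => rw [mul_add, add_mul]; exact Submodule.add_mem _ h1 h2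
    | smul r _ _ h => rw [mul_smul_comm, smul_mul_assoc]; exact Submodule.smul_mem _ r h
    | mem _ h =>
      obtain ⟨⟨d, n⟩, rfl⟩ := h
      dsimp only
      by_cases hn : n ≤ Γ.period d
      swap
      · rw [pth_eq_zero_of_period_lt K (not_le.1 hn)]; simp
      by_cases hx : x = Γ.src d
      swap
      · rw [← idem_mul_pth, ← mul_assoc, Γ.idem_mul_of_ne K hx]; simp
      by_cases hy : Γ.src (Γ.next^[n] d) = y
      swap
      · rw [← pth_mul_idem, mul_assoc, mul_assoc, Γ.idem_mul_of_ne K hy]; simp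
      subst hx hy
      rw [idem_mul_pth, pth_mul_idem]
      exact Submodule.subset_span ⟨d, n, hn, rfl, rfl, rfl⟩
  have := key a ha
  rwa [h1, h2] at this

theorem peirce_eq_bot {x y : Γ.Edge} (h : ∀ w, w ∈ x.1 → w ∉ y.1) : peirce K x y = ⊥ := by
  rw [eq_bot_iff]
  refine (peirce_le_span x y).trans (Submodule.span_le.2 ?_)
  rintro _ ⟨d, n, -, rfl, rfl, rfl⟩
  refine absurd (fst_mem_src (Γ.next^[n] d)) ?_
  rw [iterate_next_fst]
  exact h _ (fst_mem_src d)

theorem peirce_eq_span_qpath {w : V} {x y : Γ.Edge} (hx : w ∈ x.1) (hy : w ∈ y.1) (h : x ≠ y) :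
    peirce K x y = K ∙ qpath K w x y := by
  apply le_antisymm
  · refine (peirce_le_span x y).trans (Submodule.span_le.2 ?_)
    rintro _ ⟨d, n, hn, rfl, hd, rfl⟩
    have hw : d.fst = w := by
      by_contra hne
      refine h (eq_of_mem_of_mem hne (fst_mem_src d) hx ?_ hy)
      rw [← hd, ← iterate_next_fst d n]
      exact fst_mem_src _
    have hn' : n < Γ.period d := lt_of_le_of_ne hn fun e => h (by rw [← hd, e, iterate_period])
    have : n = dpos w (Γ.src d) y := by
      rw [dpos, ← eq_half hw, ← hd, ← eq_half (by simpa using hw), pos_eq_of_iterate hn' rfl]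
    have : Γ.pth K d n = qpath K w (Γ.src d) y := by rw [qpath, ← this, ← eq_half hw]
    rw [this]
    exact Submodule.mem_span_singleton_self _
  · rw [Submodule.span_singleton_le_iff_mem]
    exact qpath_mem_peirce hx hy

theorem peirce_self (d : Γ.Arrow) : peirce K (Γ.src d) (Γ.src d) =
    Submodule.span K (Set.range ![Γ.idem K (Γ.src d), Γ.pth K d (Γ.period d)]) := by
  rw [Matrix.range_cons, Matrix.range_cons, Matrix.range_empty, Set.union_empty]
  apply le_antisymm
  · refine (peirce_le_span _ _).trans (Submodule.span_le.2 ?_)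
    rintro _ ⟨e, n, hn, he, hn', rfl⟩
    have hs : Γ.next^[n] e = e := eq_of_src_eq_of_fst_eq (by rw [hn', he]) (by simp)
    have : n = 0 ∨ n = Γ.period e := by
      by_contra! hne
      exact iterate_ne_self (Nat.pos_of_ne_zero hne.1) (lt_of_le_of_ne hn hne.2) hs
    apply Submodule.subset_span
    rcases this with rfl | rfl
    · left; rw [pth_zero, he]; rfl
    · right
      rcases src_eq_iff.1 he with rfl | rfl
      · rfl
      · rw [Set.mem_singleton_iff, pth_period_eq_symm, SimpleGraph.Dart.symm_symm]
  · rw [Submodule.span_le]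
    rintro _ (rfl | rfl)
    · exact idem_mem_peirce _
    · refine ⟨idem_mul_pth _ _ _ _, ?_⟩
      have := Γ.pth_mul_idem K d (Γ.period d)
      rwa [iterate_period] at this

instance finite_peirce (x y : Γ.Edge) : Module.Finite K (peirce K x y) := by
  have hfin : {a | ∃ (d : Γ.Arrow) (n : ℕ), n ≤ Γ.period d ∧ Γ.src d = x ∧
      Γ.src (Γ.next^[n] d) = y ∧ a = Γ.pth K d n}.Finite := by
    refine ((Set.finite_univ (α := Γ.Arrow)).biUnion fun d _ =>
      (Set.finite_Iic (Γ.period d)).image (Γ.pth K d)).subset ?_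
    rintro _ ⟨d, n, hn, -, -, rfl⟩
    exact Set.mem_biUnion (Set.mem_univ d) ⟨n, hn, rfl⟩
  have := Module.Finite.span_of_finite K hfin
  exact Submodule.finiteDimensional_of_le (peirce_le_span x y)

open scoped Classical in
/-- The incidence number of a vertex and an edge. -/
def inc (v : V) (x : Γ.Edge) : ℤ := if v ∈ x.1 then 1 else 0

/-- The dimension of `e_x A e_y` is the number of common vertices of `x` and `y`. -/
theorem finrank_peirce [Fintype V] (x y : Γ.Edge) :
    (Module.finrank K (peirce K x y) : ℤ) = ∑ v, inc v x * inc v y := by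
  classical
  obtain ⟨d, rfl⟩ := exists_dart x
  by_cases hxy : y = Γ.src d
  · subst hxy
    rw [peirce_self, finrank_span_eq_card (linearIndependent_idem_pth_period K d)]
    have : ∀ v, inc v (Γ.src d) * inc v (Γ.src d) =
        (if v = d.fst then (1 : ℤ) else 0) + if v = d.snd then 1 else 0 := by
      intro v
      have hne : d.fst ≠ d.snd := d.adj.ne
      simp only [inc, mem_src_iff]
      by_cases h1 : v = d.fst
      · subst h1; simp [hne]
      · simp [h1]
    simp [this, Finset.sum_add_distrib]
  · by_cases hw : ∃ w, w ∈ (Γ.src d).1 ∧ w ∈ y.1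
    · obtain ⟨w, hx, hy⟩ := hw
      rw [peirce_eq_span_qpath hx hy (Ne.symm hxy), finrank_span_singleton (qpath_ne_zero K hx hy),
        Finset.sum_eq_single w]
      · simp [inc, hx, hy]
      · intro v _ hv
        simp only [inc]
        by_cases h1 : v ∈ (Γ.src d).1
        · by_cases h2 : v ∈ y.1
          · exact absurd (eq_of_mem_of_mem hv h1 hx h2 hy) (Ne.symm hxy)
          · simp [h2]
        · simp [h1]
      · simp
    · push Not at hw
      rw [peirce_eq_bot hw, finrank_bot, Finset.sum_eq_zero]
      · rfl
      · intro v _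
        simp only [inc]
        by_cases h1 : v ∈ (Γ.src d).1
        · simp [hw v h1]
        · simp [h1]

end

/-! ### Characters -/

open scoped Classical in
variable (K) in
/-- The character of the free algebra given by the simple module at `x`. -/
def freeChar (x : Γ.Edge) : Γ.Free K →ₐ[K] K :=
  FreeAlgebra.lift K (Sum.elim (fun y => if x = y then 1 else 0) fun _ => 0)

variable [Finite V]

theorem freeChar_rel (x : Γ.Edge) {a b : Γ.Free K} (h : Γ.Rel K a b) :
    freeChar K x a = freeChar K x b := by
  have turn (d : Γ.Arrow) : freeChar K x (Γ.freeTurn d) = 0 := by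
    rw [freeTurn, map_list_prod]
    refine List.prod_eq_zero ?_
    rw [List.map_map, List.mem_map]
    exact ⟨0, List.mem_range.2 (period_pos d), by simp [freeChar, freeArrow]⟩
  cases h with
  | idem y => simp [freeChar, freeIdem]
  | orth y z h =>
    simp only [freeChar, freeIdem, map_mul, FreeAlgebra.lift_ι_apply, Sum.elim_inl, map_zero]
    by_cases h1 : x = y
    · subst h1; simp [h]
    · simp [h1]
  | sum_one =>
    have : Fintype Γ.Edge := Fintype.ofFinite _
    rw [finsum_eq_sum_of_fintype, map_sum]
    simp [freeChar, freeIdem]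
  | src_mul a => simp [freeChar, freeArrow]
  | mul_tgt a => simp [freeChar, freeArrow]
  | zero a b h => simp [freeChar, freeArrow]
  | turn d => rw [turn, turn]

variable (K) in
/-- The character of the algebra given by the simple module at `x`. -/
def chr (x : Γ.Edge) : Γ.Alg K →ₐ[K] K :=
  RingQuot.liftAlgHom K ⟨freeChar K x, fun _ _ h => freeChar_rel x h⟩

theorem chr_ofFree (x : Γ.Edge) (a : Γ.Free K) : chr K x (Γ.ofFree K a) = freeChar K x a :=
  RingQuot.liftAlgHom_mkAlgHom_apply K _ _ _

@[simp] theorem chr_idem_self (x : Γ.Edge) : chr K x (Γ.idem K x) = 1 := by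
  rw [idem, chr_ofFree]
  simp [freeChar, freeIdem]

theorem chr_idem_of_ne {x y : Γ.Edge} (h : x ≠ y) : chr K x (Γ.idem K y) = 0 := by
  rw [idem, chr_ofFree]
  simp [freeChar, freeIdem, h]

theorem chr_eq_zero_of_peirce_left {x y z : Γ.Edge} {a : Γ.Alg K} (ha : a ∈ peirce K y z)
    (h : x ≠ y) : chr K x a = 0 := by
  rw [← ha.1, map_mul, chr_idem_of_ne h, zero_mul]

theorem chr_eq_zero_of_peirce_right {x y z : Γ.Edge} {a : Γ.Alg K} (ha : a ∈ peirce K y z)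
    (h : x ≠ z) : chr K x a = 0 := by
  rw [← ha.2, map_mul, chr_idem_of_ne h, mul_zero]

end Algebra

end BrauerTree

end

noncomputable section

/-! ### Two-term complexes in the homotopy category and in the derived category -/

namespace TwoTerm

open HomologicalComplex

variable {C : Type*} [Category* C] [Abelian C]

theorem rel_zero_one : (ComplexShape.up ℤ).Rel 0 1 := rfl

/-- The two-term complex in degrees `0` and `1` given by a morphism. -/
abbrev cpx {P₀ P₁ : C} (f : P₀ ⟶ P₁) : CochainComplex C ℤ :=
  double (c := ComplexShape.up ℤ) (i₀ := 0) (i₁ := 1) f rel_zero_one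

variable {P₀ P₁ Q₀ Q₁ : C} (f : P₀ ⟶ P₁) (g : Q₀ ⟶ Q₁)

/-- The degree `0` term of a two-term complex. -/
abbrev iso₀ : (cpx f).X 0 ≅ P₀ := doubleXIso₀ f rel_zero_one

/-- The degree `1` term of a two-term complex. -/
abbrev iso₁ : (cpx f).X 1 ≅ P₁ := doubleXIso₁ f rel_zero_one (by decide)

theorem d_eq : (cpx f).d 0 1 = (iso₀ f).hom ≫ f ≫ (iso₁ f).inv := double_d f rel_zero_one (by decide)

instance isKProjective [Projective P₀] [Projective P₁] : (cpx f).IsKProjective := by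
  have : (cpx f).IsStrictlyLE 1 := by
    rw [CochainComplex.isStrictlyLE_iff]
    intro i hi
    exact isZero_double_X f rel_zero_one i (by omega) (by omega)
  have (n : ℤ) : Projective ((cpx f).X n) := by
    by_cases h0 : n = 0
    · subst h0; exact Projective.of_iso (iso₀ f).symm inferInstance
    by_cases h1 : n = 1
    · subst h1; exact Projective.of_iso (iso₁ f).symm inferInstance
    exact Projective.of_iso ((isZero_double_X f rel_zero_one n h0 h1).isoZero).symm inferInstance
  exact CochainComplex.isKProjective_of_projective _ 1

theorem homotopy_of_Q_map_eq_zero [HasDerivedCategory.{w} C] {K L : CochainComplex C ℤ}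
    [K.IsKProjective] (α : K ⟶ L) (h : DerivedCategory.Q.map α = 0) : Nonempty (Homotopy α 0) := by
  refine ⟨HomotopyCategory.homotopyOfEq _ _ ?_⟩
  refine (CochainComplex.IsKProjective.Qh_map_bijective K
    ((HomotopyCategory.quotient _ _).obj L)).injective ?_
  have := (DerivedCategory.quotientCompQhIso C).hom.naturality α
  rw [h, comp_zero] at this
  rw [Functor.map_zero, Functor.map_zero]
  exact (cancel_mono ((DerivedCategory.quotientCompQhIso C).hom.app L)).1 (by
    rw [zero_comp]; exact this)

theorem homotopy_of_isPartialTilting [HasDerivedCategory.{w} C] {Z K L : CochainComplex C ℤ}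
    [K.IsKProjective] (hZ : IsPartialTilting.{w} Z) (i : K ⟶ Z) (p : Z ⟶ K) (hip : i ≫ p = 𝟙 K)
    (j : L ⟶ Z) (q : Z ⟶ L) (hjq : j ≫ q = 𝟙 L) {n : ℤ} (hn : n ≠ 0) (α : K ⟶ L⟦n⟧) :
    Nonempty (Homotopy α 0) := by
  apply homotopy_of_Q_map_eq_zero
  have h := hZ n hn (DerivedCategory.Q.map (p ≫ α ≫ j⟦n⟧') ≫
    (DerivedCategory.Q.commShiftIso n).hom.app Z)
  have h' : DerivedCategory.Q.map (p ≫ α ≫ j⟦n⟧') = 0 :=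
    (cancel_mono ((DerivedCategory.Q.commShiftIso n).hom.app Z)).1 (by rw [zero_comp]; exact h)
  have : α = i ≫ (p ≫ α ≫ j⟦n⟧') ≫ q⟦n⟧' := by
    rw [Category.assoc, Category.assoc, ← Functor.map_comp, hjq, CategoryTheory.Functor.map_id, Category.comp_id,
      ← Category.assoc, hip, Category.id_comp]
  rw [this, Functor.map_comp, Functor.map_comp, h', zero_comp, comp_zero]

variable {f} in
theorem exists_of_homotopy_zero {L : CochainComplex C ℤ} {α : cpx f ⟶ L} (h : Homotopy α 0) :
    (∃ (a : P₀ ⟶ L.X (-1)) (b : P₁ ⟶ L.X 0),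
      (iso₀ f).inv ≫ α.f 0 = a ≫ L.d (-1) 0 + f ≫ b) ∧
    ∃ b : P₁ ⟶ L.X 0, (iso₁ f).inv ≫ α.f 1 = b ≫ L.d 0 1 := by
  constructor
  · have h0 := h.comm 0
    rw [dNext_eq h.hom (show (ComplexShape.up ℤ).Rel 0 1 by simp),
      prevD_eq h.hom (show (ComplexShape.up ℤ).Rel (-1) 0 by simp), d_eq] at h0
    refine ⟨(iso₀ f).inv ≫ h.hom 0 (-1), (iso₁ f).inv ≫ h.hom 1 0, ?_⟩
    rw [h0]
    simp [add_comm]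
  · have h1 := h.comm 1
    rw [dNext_eq h.hom (show (ComplexShape.up ℤ).Rel 1 2 by simp),
      prevD_eq h.hom (show (ComplexShape.up ℤ).Rel 0 1 by simp),
      double_d_eq_zero₀ f rel_zero_one 1 2 (by decide)] at h1
    refine ⟨(iso₁ f).inv ≫ h.hom 1 0, ?_⟩
    rw [h1]
    simp

/-- The degree `0` term of a two-term complex moved one step to the left. -/
def shiftIso₁ : ((cpx g)⟦(1 : ℤ)⟧).X 0 ≅ Q₁ := iso₁ g

/-- The degree `-1` term of a two-term complex moved one step to the left. -/
def shiftIso₀ : ((cpx g)⟦(1 : ℤ)⟧).X (-1) ≅ Q₀ := iso₀ g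

theorem shift_d : ((cpx g)⟦(1 : ℤ)⟧).d (-1) 0 = -((shiftIso₀ g).hom ≫ g ≫ (shiftIso₁ g).inv) := by
  rw [CochainComplex.shiftFunctor_obj_d']
  change Int.negOnePow 1 • (cpx g).d 0 1 = _
  rw [Int.negOnePow_one, Units.neg_smul, one_smul, d_eq]
  rfl

theorem shift_d_zero : ((cpx g)⟦(1 : ℤ)⟧).d 0 1 = 0 := by
  rw [CochainComplex.shiftFunctor_obj_d']
  change Int.negOnePow 1 • (cpx g).d 1 2 = _
  rw [double_d_eq_zero₀ g rel_zero_one 1 2 (by decide), smul_zero]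
  rfl

/-- The degree `1` term of a two-term complex moved one step to the right. -/
def unshiftIso₀ : ((cpx g)⟦(-1 : ℤ)⟧).X 1 ≅ Q₀ := iso₀ g

/-- The degree `2` term of a two-term complex moved one step to the right. -/
def unshiftIso₁ : ((cpx g)⟦(-1 : ℤ)⟧).X 2 ≅ Q₁ := iso₁ g

theorem unshift_d :
    ((cpx g)⟦(-1 : ℤ)⟧).d 1 2 = -((unshiftIso₀ g).hom ≫ g ≫ (unshiftIso₁ g).inv) := by
  rw [CochainComplex.shiftFunctor_obj_d']
  change Int.negOnePow (-1) • (cpx g).d 0 1 = _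
  rw [show Int.negOnePow (-1) = -1 from rfl, Units.neg_smul, one_smul, d_eq]
  rfl

theorem unshift_d_zero : ((cpx g)⟦(-1 : ℤ)⟧).d 0 1 = 0 := by
  rw [CochainComplex.shiftFunctor_obj_d']
  change Int.negOnePow (-1) • (cpx g).d (-1) 0 = _
  rw [double_d_eq_zero₀ g rel_zero_one (-1) 0 (by decide), smul_zero]
  rfl

/-- If there are no extensions between two two-term complexes, then every morphism `P₀ ⟶ Q₁`
comes from a homotopy. -/
theorem exists_eq_add_of_homotopy
    (H : ∀ α : cpx f ⟶ (cpx g)⟦(1 : ℤ)⟧, Nonempty (Homotopy α 0)) (φ : P₀ ⟶ Q₁) :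
    ∃ (a : P₀ ⟶ Q₀) (b : P₁ ⟶ Q₁), φ = a ≫ g + f ≫ b := by
  obtain ⟨h⟩ := H (mkHomFromDouble (f := f) rel_zero_one (by decide) (φ ≫ (shiftIso₁ g).inv) 0
    (by rw [comp_zero, shift_d_zero, comp_zero]) (fun _ _ => zero_comp))
  obtain ⟨⟨a, b, hab⟩, -⟩ := exists_of_homotopy_zero h
  rw [mkHomFromDouble_f₀, Iso.inv_hom_id_assoc, shift_d] at hab
  refine ⟨-(a ≫ (shiftIso₀ g).hom), b ≫ (shiftIso₁ g).hom, ?_⟩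
  rw [← cancel_mono (shiftIso₁ g).inv, hab, Preadditive.add_comp, Preadditive.neg_comp,
    Preadditive.neg_comp, Preadditive.comp_neg, Category.assoc, Category.assoc, Category.assoc,
    Category.assoc, Iso.hom_inv_id, Category.comp_id]

/-- If there are no morphisms from a two-term complex to another one moved to the right, then
morphisms `P₁ ⟶ Q₀` that are killed by both differentials vanish. -/
theorem eq_zero_of_homotopy
    (H : ∀ α : cpx f ⟶ (cpx g)⟦(-1 : ℤ)⟧, Nonempty (Homotopy α 0)) (φ : P₁ ⟶ Q₀)
    (h₁ : f ≫ φ = 0) (h₂ : φ ≫ g = 0) : φ = 0 := by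
  obtain ⟨h⟩ := H (mkHomFromDouble (f := f) rel_zero_one (by decide) 0 (φ ≫ (unshiftIso₀ g).inv)
    (by rw [zero_comp, reassoc_of% h₁, zero_comp]) (by
      intro k hk
      obtain rfl : k = 2 := by simpa using hk.symm
      rw [unshift_d, Preadditive.comp_neg, Category.assoc, Iso.inv_hom_id_assoc, reassoc_of% h₂,
        zero_comp, neg_zero]))
  obtain ⟨-, b, hb⟩ := exists_of_homotopy_zero h
  rw [mkHomFromDouble_f₁, Iso.inv_hom_id_assoc, unshift_d_zero, comp_zero] at hb
  rw [← cancel_mono (unshiftIso₀ g).inv, hb, zero_comp]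

/-- The morphism of two-term complexes given by a commutative square. -/
def mkHom (a : P₀ ⟶ Q₀) (b : P₁ ⟶ Q₁) (h : a ≫ g = f ≫ b) : cpx f ⟶ cpx g :=
  mkHomFromDouble (f := f) rel_zero_one (by decide) (a ≫ (iso₀ g).inv) (b ≫ (iso₁ g).inv)
    (by rw [d_eq]; simp [reassoc_of% h])
    (fun k _ => by rw [double_d_eq_zero₀ g rel_zero_one 1 k (by decide), comp_zero])

variable {f g} in
theorem homotopy_zero_of_factor {φ : cpx f ⟶ cpx g} (h : P₁ ⟶ Q₀)
    (h₀ : φ.f 0 = (iso₀ f).hom ≫ f ≫ h ≫ (iso₀ g).inv)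
    (h₁ : φ.f 1 = (iso₁ f).hom ≫ h ≫ g ≫ (iso₁ g).inv) : Nonempty (Homotopy φ 0) := by
  let s (i j : ℤ) : (cpx f).X i ⟶ (cpx g).X j :=
    if hij : i = 1 ∧ j = 0 then
      eqToHom (by rw [hij.1]) ≫ (iso₁ f).hom ≫ h ≫ (iso₀ g).inv ≫ eqToHom (by rw [hij.2])
    else 0
  have s10 : s 1 0 = (iso₁ f).hom ≫ h ≫ (iso₀ g).inv := by simp [s]
  have sz (i j : ℤ) (hij : ¬ (i = 1 ∧ j = 0)) : s i j = 0 := dif_neg hij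
  have : φ = Homotopy.nullHomotopicMap' (fun i j _ => s i j) := by
    refine from_double_hom_ext ?_ ?_
    · rw [Homotopy.nullHomotopicMap'_f (show (ComplexShape.up ℤ).Rel (-1) 0 by simp)
        (show (ComplexShape.up ℤ).Rel 0 1 by simp), s10, sz 0 (-1) (by omega), d_eq, h₀]
      simp
    · rw [Homotopy.nullHomotopicMap'_f (show (ComplexShape.up ℤ).Rel 0 1 by simp)
        (show (ComplexShape.up ℤ).Rel 1 2 by simp), s10, sz 2 1 (by omega), d_eq, h₁]
      simp
  exact ⟨(Homotopy.ofEq this).trans (Homotopy.nullHomotopy' _)⟩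

/-- Morphisms of two-term complexes up to homotopy. -/
theorem exists_quotient_ne_zero_iff :
    (∃ φ : (HomotopyCategory.quotient _ _).obj (cpx f) ⟶
        (HomotopyCategory.quotient _ _).obj (cpx g), φ ≠ 0) ↔
      ∃ (a : P₀ ⟶ Q₀) (b : P₁ ⟶ Q₁), a ≫ g = f ≫ b ∧
        ∀ h : P₁ ⟶ Q₀, ¬ (a = f ≫ h ∧ b = h ≫ g) := by
  constructor
  · rintro ⟨φ, hφ⟩
    obtain ⟨φ, rfl⟩ := (HomotopyCategory.quotient _ _).map_surjective φ
    refine ⟨(iso₀ f).inv ≫ φ.f 0 ≫ (iso₀ g).hom, (iso₁ f).inv ≫ φ.f 1 ≫ (iso₁ g).hom, ?_, ?_⟩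
    · have := φ.comm 0 1
      rw [d_eq, d_eq] at this
      rw [← cancel_mono (iso₁ g).inv, ← cancel_epi (iso₀ f).hom]
      simpa using this
    · rintro h ⟨h₀, h₁⟩
      obtain ⟨H⟩ := homotopy_zero_of_factor (φ := φ) h
        (by rw [← reassoc_of% h₀]; simp) (by rw [← reassoc_of% h₁]; simp)
      exact hφ ((HomotopyCategory.eq_of_homotopy _ _ H).trans (Functor.map_zero _ _ _))
  · rintro ⟨a, b, hab, hne⟩
    refine ⟨(HomotopyCategory.quotient _ _).map (mkHom f g a b hab), fun h0 => ?_⟩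
    have H := HomotopyCategory.homotopyOfEq (mkHom f g a b hab) 0
      (h0.trans (Functor.map_zero _ _ _).symm)
    have h0 := H.comm 0
    have h1 := H.comm 1
    rw [dNext_eq H.hom (show (ComplexShape.up ℤ).Rel 0 1 by simp),
      prevD_eq H.hom (show (ComplexShape.up ℤ).Rel (-1) 0 by simp), d_eq,
      double_d_eq_zero₀ g rel_zero_one (-1) 0 (by decide)] at h0
    erw [mkHomFromDouble_f₀] at h0
    rw [dNext_eq H.hom (show (ComplexShape.up ℤ).Rel 1 2 by simp),
      prevD_eq H.hom (show (ComplexShape.up ℤ).Rel 0 1 by simp), d_eq,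
      double_d_eq_zero₀ f rel_zero_one 1 2 (by decide)] at h1
    erw [mkHomFromDouble_f₁] at h1
    refine hne ((iso₁ f).inv ≫ H.hom 1 0 ≫ (iso₀ g).hom) ⟨?_, ?_⟩
    · rw [← cancel_mono (iso₀ g).inv, ← cancel_epi (iso₀ f).hom, h0]
      simp
    · rw [← cancel_mono (iso₁ g).inv, ← cancel_epi (iso₁ f).hom, h1]
      simp

end TwoTerm

end

noncomputable section

set_option linter.unusedSectionVars false

namespace BrauerTree

variable {V : Type v} {Γ : BrauerTree V} {K : Type u} [Field K]

/-! ### Sums of indecomposable projective modules -/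

theorem mem_proj {x : Γ.Edge} {a : Γ.Alg K} : a ∈ Γ.proj K x ↔ a * Γ.idem K x = a := by
  rw [Ideal.mem_span_singleton']
  constructor
  · rintro ⟨b, rfl⟩
    rw [mul_assoc, idem_mul_self]
  · exact fun h => ⟨a, h⟩

theorem mem_proj_of_peirce {x y : Γ.Edge} {a : Γ.Alg K} (h : a ∈ peirce K x y) :
    a ∈ Γ.proj K y := mem_proj.2 h.2

section Sums

variable {I J L : Type*}

variable (K) in
/-- The direct sum of the modules `A e_{x i}`. -/
abbrev ProjSum (x : I → Γ.Edge) : Type _ := ∀ i, Γ.proj K (x i)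

variable [Fintype I] [DecidableEq I] [Fintype J] [DecidableEq J] [Fintype L] [DecidableEq L]

/-- The generator of a summand. -/
def gen (x : I → Γ.Edge) (i : I) : ProjSum K x :=
  Pi.single i ⟨Γ.idem K (x i), mem_proj.2 (idem_mul_self _ _ _)⟩

theorem gen_self (x : I → Γ.Edge) (i : I) : (gen (K := K) x i i : Γ.Alg K) = Γ.idem K (x i) := by
  simp [gen]

theorem gen_of_ne (x : I → Γ.Edge) {i i' : I} (h : i' ≠ i) :
    (gen (K := K) x i i' : Γ.Alg K) = 0 := by
  simp [gen, Pi.single_eq_of_ne h]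

theorem idem_smul_gen (x : I → Γ.Edge) (i : I) :
    Γ.idem K (x i) • gen (K := K) x i = gen x i := by
  rw [gen, ← Pi.single_smul]
  congr 1
  exact Subtype.ext (idem_mul_self _ _ _)

theorem sum_smul_gen (x : I → Γ.Edge) (p : ProjSum K x) :
    ∑ i, (p i : Γ.Alg K) • gen x i = p := by
  funext i
  refine Subtype.ext ?_
  rw [Finset.sum_apply, AddSubmonoidClass.coe_finsetSum, Finset.sum_eq_single i]
  · rw [Pi.smul_apply, Submodule.coe_smul, gen_self, smul_eq_mul, mem_proj.1 (p i).2]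
  · intro j _ hj
    rw [Pi.smul_apply, Submodule.coe_smul, gen_of_ne _ hj.symm, smul_zero]
  · simp

/-- The matrix of a homomorphism. -/
def entry {x : I → Γ.Edge} {y : J → Γ.Edge} (f : ProjSum K x →ₗ[Γ.Alg K] ProjSum K y)
    (i : I) (j : J) : Γ.Alg K := f (gen x i) j

theorem entry_mem {x : I → Γ.Edge} {y : J → Γ.Edge} (f : ProjSum K x →ₗ[Γ.Alg K] ProjSum K y)
    (i : I) (j : J) : entry f i j ∈ peirce K (x i) (y j) := by
  refine ⟨?_, mem_proj.1 (f (gen x i) j).2⟩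
  have := congrArg (fun p => (f p j : Γ.Alg K)) (idem_smul_gen (K := K) x i)
  simpa [entry] using this

theorem apply_eq_sum_entry {x : I → Γ.Edge} {y : J → Γ.Edge}
    (f : ProjSum K x →ₗ[Γ.Alg K] ProjSum K y) (p : ProjSum K x) (j : J) :
    (f p j : Γ.Alg K) = ∑ i, (p i : Γ.Alg K) * entry f i j := by
  conv_lhs => rw [← sum_smul_gen x p]
  rw [map_sum, Finset.sum_apply, AddSubmonoidClass.coe_finsetSum]
  simp [entry]

/-- The homomorphism given by a matrix. -/
def ofEntry {x : I → Γ.Edge} {y : J → Γ.Edge} (φ : I → J → Γ.Alg K)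
    (h : ∀ i j, φ i j ∈ peirce K (x i) (y j)) : ProjSum K x →ₗ[Γ.Alg K] ProjSum K y where
  toFun p j := ⟨∑ i, (p i : Γ.Alg K) * φ i j, Submodule.sum_mem _ fun i _ =>
    Ideal.mul_mem_left _ _ (mem_proj_of_peirce (h i j))⟩
  map_add' p q := by
    funext j
    refine Subtype.ext ?_
    simp [add_mul, Finset.sum_add_distrib]
  map_smul' a p := by
    funext j
    refine Subtype.ext ?_
    simp [mul_assoc, Finset.mul_sum]

theorem ofEntry_apply {x : I → Γ.Edge} {y : J → Γ.Edge} (φ : I → J → Γ.Alg K)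
    (h : ∀ i j, φ i j ∈ peirce K (x i) (y j)) (p : ProjSum K x) (j : J) :
    (ofEntry φ h p j : Γ.Alg K) = ∑ i, (p i : Γ.Alg K) * φ i j := rfl

theorem entry_ofEntry {x : I → Γ.Edge} {y : J → Γ.Edge} (φ : I → J → Γ.Alg K)
    (h : ∀ i j, φ i j ∈ peirce K (x i) (y j)) (i : I) (j : J) :
    entry (ofEntry φ h) i j = φ i j := by
  rw [entry, ofEntry_apply, Finset.sum_eq_single i]
  · rw [gen_self, (h i j).1]
  · intro i' _ hi; rw [gen_of_ne _ hi, zero_mul]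
  · simp

theorem ext_entry {x : I → Γ.Edge} {y : J → Γ.Edge} {f g : ProjSum K x →ₗ[Γ.Alg K] ProjSum K y}
    (h : ∀ i j, entry f i j = entry g i j) : f = g := by
  refine LinearMap.ext fun p => funext fun j => Subtype.ext ?_
  rw [apply_eq_sum_entry, apply_eq_sum_entry]
  simp [h]

theorem entry_comp {x : I → Γ.Edge} {y : J → Γ.Edge} {z : L → Γ.Edge}
    (g : ProjSum K y →ₗ[Γ.Alg K] ProjSum K z) (f : ProjSum K x →ₗ[Γ.Alg K] ProjSum K y)
    (i : I) (l : L) : entry (g ∘ₗ f) i l = ∑ j, entry f i j * entry g j l := by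
  rw [entry, LinearMap.comp_apply, apply_eq_sum_entry]
  rfl

/-- Homomorphisms are matrices. -/
def entryEquiv (x : I → Γ.Edge) (y : J → Γ.Edge) :
    (ProjSum K x →ₗ[Γ.Alg K] ProjSum K y) ≃ₗ[K] ∀ i j, peirce K (x i) (y j) where
  toFun f i j := ⟨entry f i j, entry_mem f i j⟩
  map_add' f g := rfl
  map_smul' c f := rfl
  invFun φ := ofEntry (fun i j => φ i j) fun i j => (φ i j).2
  left_inv f := ext_entry fun i j => entry_ofEntry _ _ i j
  right_inv φ := by
    funext i j
    exact Subtype.ext (entry_ofEntry (fun i j => (φ i j : Γ.Alg K)) (fun i j => (φ i j).2) i j)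

instance finite_hom [Finite V] (x : I → Γ.Edge) (y : J → Γ.Edge) :
    Module.Finite K (ProjSum K x →ₗ[Γ.Alg K] ProjSum K y) :=
  Module.Finite.equiv (entryEquiv x y).symm

theorem finrank_hom [Fintype V] (x : I → Γ.Edge) (y : J → Γ.Edge) :
    (Module.finrank K (ProjSum K x →ₗ[Γ.Alg K] ProjSum K y) : ℤ) =
      ∑ v, (∑ i, inc v (x i)) * ∑ j, inc v (y j) := by
  classical
  rw [(entryEquiv x y).finrank_eq, Module.finrank_pi_fintype]
  simp_rw [Module.finrank_pi_fintype]
  push_cast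
  simp_rw [finrank_peirce, Finset.sum_mul_sum]
  rw [Finset.sum_comm' (t' := Finset.univ) (s' := fun _ => Finset.univ) (by simp)]
  rw [Finset.sum_comm]
  conv_rhs => rw [Finset.sum_comm]
  refine Finset.sum_congr rfl fun i _ => ?_
  rw [Finset.sum_comm]

instance projective_projSum (x : I → Γ.Edge) : Module.Projective (Γ.Alg K) (ProjSum K x) :=
  Module.Projective.of_split (M := I → Γ.Alg K)
    (LinearMap.pi fun i => (Γ.proj K (x i)).subtype ∘ₗ LinearMap.proj i)
    (LinearMap.pi fun i => LinearMap.codRestrict (Γ.proj K (x i))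
      (LinearMap.toSpanSingleton (Γ.Alg K) (Γ.Alg K) (Γ.idem K (x i)) ∘ₗ LinearMap.proj i)
      (fun a => mem_proj.2 (by simp [mul_assoc])))
    (by
      refine LinearMap.ext fun p => funext fun i => Subtype.ext ?_
      simpa using mem_proj.1 (p i).2)

end Sums

end BrauerTree

end

noncomputable section

namespace BrauerTree

variable {V : Type v} {Γ : BrauerTree V} {K : Type u} [Field K]

/-! ### Euler form -/

section Euler

variable {R : Type*} [Ring R] [Algebra K R]
  {P₀ P₁ Q₀ Q₁ : Type*} [AddCommGroup P₀] [Module R P₀] [AddCommGroup P₁] [Module R P₁]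
  [AddCommGroup Q₀] [Module R Q₀] [Module K Q₀] [IsScalarTower K R Q₀]
  [AddCommGroup Q₁] [Module R Q₁] [Module K Q₁] [IsScalarTower K R Q₁]

variable (K) in
/-- The Euler form of two-term complexes: if `Hom(T, T'[1]) = 0` and `Hom(T, T'[-1]) = 0`, then
`Hom(T, T') ≠ 0` is a statement about dimensions. -/
theorem exists_chainMap_iff_finrank (f : P₀ →ₗ[R] P₁) (g : Q₀ →ₗ[R] Q₁)
    [Module.Finite K (P₀ →ₗ[R] Q₀)] [Module.Finite K (P₁ →ₗ[R] Q₁)]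
    [Module.Finite K (P₁ →ₗ[R] Q₀)]
    (h₁ : ∀ φ : P₀ →ₗ[R] Q₁, ∃ (a : P₀ →ₗ[R] Q₀) (b : P₁ →ₗ[R] Q₁), φ = g ∘ₗ a + b ∘ₗ f)
    (h₂ : ∀ h : P₁ →ₗ[R] Q₀, h ∘ₗ f = 0 → g ∘ₗ h = 0 → h = 0) :
    (∃ (a : P₀ →ₗ[R] Q₀) (b : P₁ →ₗ[R] Q₁), g ∘ₗ a = b ∘ₗ f ∧
      ∀ h : P₁ →ₗ[R] Q₀, ¬ (a = h ∘ₗ f ∧ b = g ∘ₗ h)) ↔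
    Module.finrank K (P₁ →ₗ[R] Q₀) + Module.finrank K (P₀ →ₗ[R] Q₁) <
      Module.finrank K (P₀ →ₗ[R] Q₀) + Module.finrank K (P₁ →ₗ[R] Q₁) := by
  let Φ : ((P₀ →ₗ[R] Q₀) × (P₁ →ₗ[R] Q₁)) →ₗ[K] (P₀ →ₗ[R] Q₁) :=
    { toFun := fun p => g ∘ₗ p.1 - p.2 ∘ₗ f
      map_add' := fun p q => by
        ext z; simp; abel
      map_smul' := fun c p => by
        ext z; simp [smul_sub] }
  let Ψ : (P₁ →ₗ[R] Q₀) →ₗ[K] ((P₀ →ₗ[R] Q₀) × (P₁ →ₗ[R] Q₁)) :=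
    { toFun := fun h => (h ∘ₗ f, g ∘ₗ h)
      map_add' := fun p q => by
        ext z <;> simp
      map_smul' := fun c p => by
        ext z <;> simp }
  have hΦ : Function.Surjective Φ := fun φ => by
    obtain ⟨a, b, rfl⟩ := h₁ φ
    exact ⟨(a, -b), by simp [Φ]⟩
  have hΨ : Function.Injective Ψ := by
    rw [← LinearMap.ker_eq_bot, eq_bot_iff]
    intro h hh
    have hh : (h ∘ₗ f, g ∘ₗ h) = 0 := hh
    exact h₂ h (congrArg Prod.fst hh) (congrArg Prod.snd hh)
  have hle : LinearMap.range Ψ ≤ LinearMap.ker Φ := by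
    rintro _ ⟨h, rfl⟩
    rw [LinearMap.mem_ker]
    simp only [Φ, Ψ, LinearMap.coe_mk, AddHom.coe_mk, LinearMap.comp_assoc, sub_self]
  have e1 := LinearMap.finrank_range_add_finrank_ker Φ
  rw [LinearMap.range_eq_top.2 hΦ, finrank_top, Module.finrank_prod] at e1
  have e2 := LinearMap.finrank_range_of_inj hΨ
  have e3 : (∃ (a : P₀ →ₗ[R] Q₀) (b : P₁ →ₗ[R] Q₁), g ∘ₗ a = b ∘ₗ f ∧
      ∀ h : P₁ →ₗ[R] Q₀, ¬ (a = h ∘ₗ f ∧ b = g ∘ₗ h)) ↔ LinearMap.range Ψ < LinearMap.ker Φ := by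
    rw [SetLike.lt_iff_le_and_exists]
    constructor
    · rintro ⟨a, b, hab, hne⟩
      refine ⟨hle, (a, b), by rw [LinearMap.mem_ker]; exact sub_eq_zero.2 hab, ?_⟩
      rintro ⟨h, hh⟩
      exact hne h ⟨(congrArg Prod.fst hh).symm, (congrArg Prod.snd hh).symm⟩
    · rintro ⟨-, ⟨a, b⟩, hab, hne⟩
      exact ⟨a, b, sub_eq_zero.1 hab, fun h hh => hne ⟨h, Prod.ext hh.1.symm hh.2.symm⟩⟩
  rw [e3]
  constructor
  · intro h
    have := Submodule.finrank_lt_finrank_of_lt h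
    omega
  · intro h
    refine lt_of_le_of_ne hle fun e => ?_
    rw [← e] at e1
    omega

end Euler

/-! ### Consequences of being partial tilting -/

namespace MinPresentation

section Tilting

variable {M N : ModuleCat.{max u v} (Γ.Alg K)} (S : Γ.MinPresentation K M)
  (T : Γ.MinPresentation K N)

/-- `Hom(S, T[1]) = 0`, in terms of the differentials. -/
def NoExt : Prop := ∀ φ : ProjSum K S.index₀ →ₗ[Γ.Alg K] ProjSum K T.index₁,
  ∃ (a : ProjSum K S.index₀ →ₗ[Γ.Alg K] ProjSum K T.index₀)
    (b : ProjSum K S.index₁ →ₗ[Γ.Alg K] ProjSum K T.index₁), φ = T.map ∘ₗ a + b ∘ₗ S.map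

/-- `Hom(S, T[-1]) = 0`, in terms of the differentials. -/
def NoNegExt : Prop := ∀ h : ProjSum K S.index₁ →ₗ[Γ.Alg K] ProjSum K T.index₀,
  h ∘ₗ S.map = 0 → T.map ∘ₗ h = 0 → h = 0

instance projective_of {n : ℕ} (x : Fin n → Γ.Edge) :
    Projective (ModuleCat.of.{max u v} (Γ.Alg K) (ProjSum K x)) :=
  (IsProjective.iff_projective _).1 inferInstance

instance isKProjective_complex : S.complex.IsKProjective :=
  TwoTerm.isKProjective (ModuleCat.ofHom S.map)

theorem noExt_of_retract [HasDerivedCategory.{w} (ModuleCat.{max u v} (Γ.Alg K))]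
    {Z : CochainComplex (ModuleCat.{max u v} (Γ.Alg K)) ℤ} (hZ : IsPartialTilting.{w} Z)
    (i : S.complex ⟶ Z) (p : Z ⟶ S.complex) (hip : i ≫ p = 𝟙 _)
    (j : T.complex ⟶ Z) (q : Z ⟶ T.complex) (hjq : j ≫ q = 𝟙 _) : S.NoExt T := by
  intro φ
  obtain ⟨a, b, h⟩ := TwoTerm.exists_eq_add_of_homotopy (ModuleCat.ofHom S.map)
    (ModuleCat.ofHom T.map)
    (fun α => TwoTerm.homotopy_of_isPartialTilting (K := S.complex) (L := T.complex) hZ i p hip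
      j q hjq (n := 1) (by decide) α) (ModuleCat.ofHom φ)
  refine ⟨a.hom, b.hom, ?_⟩
  simpa using congrArg ModuleCat.Hom.hom h

theorem noNegExt_of_retract [HasDerivedCategory.{w} (ModuleCat.{max u v} (Γ.Alg K))]
    {Z : CochainComplex (ModuleCat.{max u v} (Γ.Alg K)) ℤ} (hZ : IsPartialTilting.{w} Z)
    (i : S.complex ⟶ Z) (p : Z ⟶ S.complex) (hip : i ≫ p = 𝟙 _)
    (j : T.complex ⟶ Z) (q : Z ⟶ T.complex) (hjq : j ≫ q = 𝟙 _) : S.NoNegExt T := by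
  intro φ h₁ h₂
  have := TwoTerm.eq_zero_of_homotopy (ModuleCat.ofHom S.map)
    (ModuleCat.ofHom T.map)
    (fun α => TwoTerm.homotopy_of_isPartialTilting (K := S.complex) (L := T.complex) hZ i p hip
      j q hjq (n := -1) (by decide) α) (ModuleCat.ofHom φ)
    (by rw [← ModuleCat.ofHom_comp, h₁]; rfl) (by rw [← ModuleCat.ofHom_comp, h₂]; rfl)
  exact congrArg ModuleCat.Hom.hom this

/-- The class of the complex in the Grothendieck group: number of sources minus number of
sinks at a vertex of the tree. -/
def weight (v : V) : ℤ := ∑ i, inc v (S.index₀ i) - ∑ j, inc v (S.index₁ j)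

theorem exists_quotient_hom_ne_zero_iff [Fintype V] (h₁ : S.NoExt T) (h₂ : S.NoNegExt T) :
    (∃ φ : (HomotopyCategory.quotient _ _).obj S.complex ⟶
        (HomotopyCategory.quotient _ _).obj T.complex, φ ≠ 0) ↔
      0 < ∑ v, S.weight v * T.weight v := by
  refine (TwoTerm.exists_quotient_ne_zero_iff (ModuleCat.ofHom S.map)
    (ModuleCat.ofHom T.map)).trans ?_
  have e := exists_chainMap_iff_finrank K S.map T.map h₁ h₂
  have : (0 < ∑ v, S.weight v * T.weight v) ↔
      Module.finrank K (ProjSum K S.index₁ →ₗ[Γ.Alg K] ProjSum K T.index₀) +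
        Module.finrank K (ProjSum K S.index₀ →ₗ[Γ.Alg K] ProjSum K T.index₁) <
      Module.finrank K (ProjSum K S.index₀ →ₗ[Γ.Alg K] ProjSum K T.index₀) +
        Module.finrank K (ProjSum K S.index₁ →ₗ[Γ.Alg K] ProjSum K T.index₁) := by
    zify
    rw [finrank_hom, finrank_hom, finrank_hom, finrank_hom, ← Finset.sum_add_distrib,
      ← Finset.sum_add_distrib]
    conv_rhs => rw [← sub_pos, ← Finset.sum_sub_distrib]
    simp only [weight]
    refine iff_of_eq (congrArg _ (Finset.sum_congr rfl fun v _ => ?_))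
    ring
  rw [this, ← e]
  constructor
  · rintro ⟨a, b, hab, hne⟩
    refine ⟨a.hom, b.hom, by simpa using congrArg ModuleCat.Hom.hom hab, fun h hh => ?_⟩
    refine hne (ModuleCat.ofHom h) ⟨ModuleCat.hom_ext ?_, ModuleCat.hom_ext ?_⟩
    · simpa using hh.1
    · simpa using hh.2
  · rintro ⟨a, b, hab, hne⟩
    refine ⟨ModuleCat.ofHom a, ModuleCat.ofHom b, by rw [← ModuleCat.ofHom_comp, hab]; rfl,
      fun h hh => ?_⟩
    refine hne h.hom ⟨?_, ?_⟩
    · simpa using congrArg ModuleCat.Hom.hom hh.1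
    · simpa using congrArg ModuleCat.Hom.hom hh.2

end Tilting

end MinPresentation

end BrauerTree

end

noncomputable section

/-- Fitting: an endomorphism of an indecomposable module of finite length is bijective or
nilpotent. -/
theorem bijective_or_isNilpotent_of_indecomposable {R : Type u} [Ring R] {M : ModuleCat.{v} R}
    [IsNoetherian R M] [IsArtinian R M] (hM : Indecomposable M) (φ : Module.End R M) :
    Function.Bijective φ ∨ ∃ n, φ ^ n = 0 := by
  obtain ⟨n, hn⟩ := Filter.eventually_atTop.1 φ.eventually_isCompl_ker_pow_range_pow
  have hc := hn (n + 1) (by omega)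
  have e : M ≅ ModuleCat.of R (LinearMap.ker (φ ^ (n + 1))) ⊞
      ModuleCat.of R (LinearMap.range (φ ^ (n + 1))) :=
    (Submodule.prodEquivOfIsCompl _ _ hc).symm.toModuleIso ≪≫
      (ModuleCat.biprodIsoProd (ModuleCat.of R (LinearMap.ker (φ ^ (n + 1))))
        (ModuleCat.of R (LinearMap.range (φ ^ (n + 1))))).symm
  rcases hM.2 _ _ e with h | h
  · left
    have h1 : LinearMap.ker (φ ^ (n + 1)) = ⊥ :=
      Submodule.subsingleton_iff_eq_bot.1 (ModuleCat.subsingleton_of_isZero h)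
    have h2 : LinearMap.range (φ ^ (n + 1)) = ⊤ := by
      have := hc.sup_eq_top
      rwa [h1, bot_sup_eq] at this
    constructor
    · rw [← LinearMap.ker_eq_bot, eq_bot_iff, ← h1, pow_succ]
      exact LinearMap.ker_le_ker_comp φ (φ ^ n)
    · rw [← LinearMap.range_eq_top, eq_top_iff, ← h2, pow_succ']
      exact LinearMap.range_comp_le_range (φ ^ n) φ
  · right
    exact ⟨n + 1, LinearMap.range_eq_bot.1
      (Submodule.subsingleton_iff_eq_bot.1 (ModuleCat.subsingleton_of_isZero h))⟩

namespace BrauerTree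

variable {V : Type v} {Γ : BrauerTree V} {K : Type u} [Field K] [Finite V]

instance finite_alg : Module.Finite K (Γ.Alg K) := by
  rcases isEmpty_or_nonempty Γ.Edge with h | h
  · have : (1 : Γ.Alg K) = 0 := by
      have : Fintype Γ.Edge := Fintype.ofFinite _
      have := Γ.sum_idem K
      simpa using this.symm
    have : Subsingleton (Γ.Alg K) := subsingleton_of_zero_eq_one this.symm
    infer_instance
  · have hfin : (⋃ d : Γ.Arrow, (Γ.pth K d) '' Set.Iic (Γ.period d)).Finite :=
      Set.finite_iUnion fun d => (Set.finite_Iic _).image _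
    refine ⟨hfin.toFinset, ?_⟩
    rw [eq_top_iff, ← span_pth, Submodule.span_le]
    rintro _ ⟨⟨d, n⟩, rfl⟩
    by_cases hn : n ≤ Γ.period d
    · exact Submodule.subset_span (by simpa using ⟨d, n, hn, rfl⟩)
    · rw [SetLike.mem_coe]
      dsimp only
      rw [pth_eq_zero_of_period_lt K (not_le.1 hn)]
      exact Submodule.zero_mem _

instance isArtinianRing_alg : IsArtinianRing (Γ.Alg K) := IsArtinianRing.of_finite K _

instance isNoetherianRing_alg : IsNoetherianRing (Γ.Alg K) := IsNoetherianRing.of_finite K _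

section Top

variable {I J : Type*} [Fintype I] [DecidableEq I] [Fintype J] [DecidableEq J]

/-- Superfluous submodules lie in the radical. -/
theorem chr_eq_zero_of_isSuperfluous {y : J → Γ.Edge} {N : Submodule (Γ.Alg K) (ProjSum K y)}
    (hN : IsSuperfluous N) {p : ProjSum K y} (hp : p ∈ N) (j : J) : chr K (y j) (p j) = 0 := by
  by_contra hne
  let L : Submodule (Γ.Alg K) (ProjSum K y) :=
    { carrier := {q | chr K (y j) (q j) = 0}
      add_mem' := fun {a b} ha hb => by
        change chr K (y j) (a j) = 0 at ha
        change chr K (y j) (b j) = 0 at hb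
        change chr K (y j) ((a + b) j) = 0
        rw [Pi.add_apply, Submodule.coe_add, map_add, ha, hb, add_zero]
      zero_mem' := by simp
      smul_mem' := fun c q hq => by
        change chr K (y j) (q j) = 0 at hq
        change chr K (y j) ((c • q) j) = 0
        rw [Pi.smul_apply, Submodule.coe_smul, smul_eq_mul, map_mul, hq, mul_zero] }
  have hL : L = ⊤ := by
    apply hN
    rw [eq_top_iff]
    intro q _
    set c : K := chr K (y j) (q j) * (chr K (y j) (p j))⁻¹
    have : q = algebraMap K (Γ.Alg K) c • p + (q - algebraMap K (Γ.Alg K) c • p) := by abel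
    rw [this]
    refine Submodule.add_mem_sup (N.smul_mem _ hp) ?_
    change chr K (y j) ((q - algebraMap K (Γ.Alg K) c • p) j) = 0
    rw [Pi.sub_apply, Pi.smul_apply, Submodule.coe_sub, Submodule.coe_smul, smul_eq_mul, map_sub,
      map_mul, AlgHom.commutes, Algebra.algebraMap_self, RingHom.id_apply, inv_mul_cancel_right₀ hne,
      sub_self]
  have : gen y j ∈ L := by rw [hL]; trivial
  have h1 : chr K (y j) (gen (K := K) y j j) = 0 := this
  rw [gen_self, chr_idem_self] at h1
  exact one_ne_zero h1

/-- Homomorphisms preserve the radical. -/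
theorem chr_apply_eq_zero {x : I → Γ.Edge} {y : J → Γ.Edge}
    (f : ProjSum K x →ₗ[Γ.Alg K] ProjSum K y) {p : ProjSum K x}
    (hp : ∀ i, chr K (x i) (p i) = 0) (j : J) : chr K (y j) (f p j) = 0 := by
  rw [apply_eq_sum_entry, map_sum]
  refine Finset.sum_eq_zero fun i _ => ?_
  rw [map_mul]
  by_cases h : y j = x i
  · rw [h, hp i, zero_mul]
  · rw [chr_eq_zero_of_peirce_left (entry_mem f i j) h, mul_zero]

end Top

namespace MinPresentation

variable {M : ModuleCat.{max u v} (Γ.Alg K)} (T : Γ.MinPresentation K M)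

theorem chr_map_eq_zero (p : ProjSum K T.index₀) (j : Fin T.rank₁) :
    chr K (T.index₁ j) (T.map p j) = 0 :=
  chr_eq_zero_of_isSuperfluous T.superfluous_ker_cover
    (LinearMap.mem_ker.2 ((T.exact (T.map p)).2 ⟨p, rfl⟩)) j

/-- The sources and the sinks of a rigid complex are different. -/
theorem index₀_ne_index₁ (hT : T.NoExt T) (i : Fin T.rank₀) (j : Fin T.rank₁) :
    T.index₀ i ≠ T.index₁ j := by
  intro h
  obtain ⟨a, b, hab⟩ := hT (ofEntry (fun i' j' => if i' = i ∧ j' = j then Γ.idem K (T.index₀ i)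
    else 0) (fun i' j' => by
      split_ifs with hh
      · rw [hh.1, hh.2, ← h]; exact idem_mem_peirce _
      · exact Submodule.zero_mem _))
  have := congrArg (fun f => chr K (T.index₁ j) (f (gen T.index₀ i) j)) hab
  rw [LinearMap.add_apply, Pi.add_apply, Submodule.coe_add, map_add, LinearMap.comp_apply,
    LinearMap.comp_apply, chr_map_eq_zero, chr_apply_eq_zero b (fun j' => T.chr_map_eq_zero _ j')]
    at this
  change chr K (T.index₁ j) (entry _ i j) = _ at this
  rw [entry_ofEntry, if_pos ⟨rfl, rfl⟩, h, chr_idem_self, add_zero] at this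
  exact one_ne_zero this

/-- An endomorphism of the presentation of an indecomposable module that is not nilpotent
modulo the radical is surjective. -/
theorem surjective_of_indecomposable (hM : Indecomposable M)
    (a : ProjSum K T.index₀ →ₗ[Γ.Alg K] ProjSum K T.index₀)
    (b : ProjSum K T.index₁ →ₗ[Γ.Alg K] ProjSum K T.index₁) (hab : T.map ∘ₗ a = b ∘ₗ T.map)
    (h : (∃ p j, ∀ n, chr K (T.index₁ j) ((b ^ n) p j) ≠ 0) ∨
      (b = 0 ∧ ∃ p i, chr K (T.index₀ i) (a p i) ≠ 0)) :
    Function.Surjective a ∧ Function.Surjective b := by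
  have hfin : Module.Finite (Γ.Alg K) M := Module.Finite.of_surjective T.cover T.cover_surjective
  have hker : LinearMap.ker T.cover ≤ LinearMap.ker (T.cover ∘ₗ b) := by
    intro p hp
    obtain ⟨q, rfl⟩ := (T.exact p).1 hp
    rw [LinearMap.mem_ker, LinearMap.comp_apply, ← LinearMap.comp_apply b, ← hab,
      LinearMap.comp_apply]
    exact (T.exact _).2 ⟨_, rfl⟩
  let φ : Module.End (Γ.Alg K) M := (LinearMap.ker T.cover).liftQ (T.cover ∘ₗ b) hker ∘ₗ
    (T.cover.quotKerEquivOfSurjective T.cover_surjective).symm.toLinearMap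
  have hφ (p) : φ (T.cover p) = T.cover (b p) := by
    have : (T.cover.quotKerEquivOfSurjective T.cover_surjective).symm (T.cover p) =
        Submodule.Quotient.mk p := by
      rw [LinearEquiv.symm_apply_eq]
      rfl
    simp only [φ, LinearMap.comp_apply, LinearEquiv.coe_coe, this]
    rfl
  have hφn (n : ℕ) (p) : (φ ^ n) (T.cover p) = T.cover ((b ^ n) p) := by
    induction n generalizing p with
    | zero => rfl
    | succ n ih => rw [pow_succ, pow_succ, Module.End.mul_apply, Module.End.mul_apply, hφ, ih]
  have hbij : Function.Bijective φ := by
    rcases bijective_or_isNilpotent_of_indecomposable hM φ with hb | ⟨n, hn⟩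
    · exact hb
    exfalso
    rcases h with ⟨p, j, hne⟩ | ⟨hb0, p, i, hne⟩
    · refine hne n (chr_eq_zero_of_isSuperfluous T.superfluous_ker_cover ?_ j)
      rw [LinearMap.mem_ker, ← hφn, hn]
      rfl
    · refine hne (chr_eq_zero_of_isSuperfluous T.superfluous_ker_map ?_ i)
      rw [LinearMap.mem_ker, ← LinearMap.comp_apply, hab, hb0]
      rfl
  have hb : Function.Surjective b := by
    rw [← LinearMap.range_eq_top]
    apply T.superfluous_ker_cover
    rw [eq_top_iff]
    intro p _
    obtain ⟨m, hm⟩ := hbij.2 (T.cover p)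
    obtain ⟨q, rfl⟩ := T.cover_surjective m
    rw [hφ] at hm
    have : p = (p - b q) + b q := by abel
    rw [this]
    refine Submodule.add_mem_sup ?_ ⟨q, rfl⟩
    rw [LinearMap.mem_ker, map_sub, hm, sub_self]
  refine ⟨?_, hb⟩
  rw [← LinearMap.range_eq_top]
  apply T.superfluous_ker_map
  rw [eq_top_iff]
  intro p _
  obtain ⟨q, hq⟩ := hb (T.map p)
  have hq' : T.cover q = 0 := by
    apply hbij.1
    rw [hφ, hq, map_zero]
    exact (T.exact _).2 ⟨_, rfl⟩
  obtain ⟨r, rfl⟩ := (T.exact q).1 hq'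
  have : p = (p - a r) + a r := by abel
  rw [this]
  refine Submodule.add_mem_sup ?_ ⟨r, rfl⟩
  rw [LinearMap.mem_ker, map_sub, sub_eq_zero, ← hq, ← LinearMap.comp_apply, ← LinearMap.comp_apply,
    hab]

end MinPresentation

end BrauerTree

end

set_option linter.unusedSectionVars false

noncomputable section

/-! ### Linear relations -/

namespace LocalStep

variable {K : Type*} [Field K]

theorem exists_comp_eq {W X : Type*} [AddCommGroup W] [Module K W] [AddCommGroup X] [Module K X]
    (φ : W →ₗ[K] K) (τ : W →ₗ[K] X) (h : LinearMap.ker τ ≤ LinearMap.ker φ) :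
    ∃ ψ : X →ₗ[K] K, ψ ∘ₗ τ = φ := by
  have : φ ∈ (LinearMap.ker τ).dualAnnihilator := by
    rw [Submodule.mem_dualAnnihilator]
    exact fun w hw => h hw
  rw [← LinearMap.range_dualMap_eq_dualAnnihilator_ker] at this
  obtain ⟨ψ, hψ⟩ := this
  exact ⟨ψ, hψ⟩

/-- Transport of a pair of subspaces along the linear relation `{(ρ w, σ w)}`. -/
theorem exists_lt_and_forall_exists {W E E' : Type*} [AddCommGroup W] [Module K W]
    [AddCommGroup E] [Module K E] [AddCommGroup E'] [Module K E']
    (ρ : W →ₗ[K] E) (σ : W →ₗ[K] E') {Y Z : Submodule K E} (hZY : Z ≤ Y)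
    (h₁ : ∃ w, ρ w ∈ Y ∧ ρ w ∉ Z) (h₂ : ∀ w, σ w = 0 → ρ w ∈ Y → ρ w ∈ Z) :
    ∃ Y' Z' : Submodule K E', Z' < Y' ∧ (∀ s ∈ Y', ∃ w, ρ w ∈ Y ∧ σ w = s) ∧
      ∀ d : E' →ₗ[K] K, (∀ s ∈ Z', d s = 0) →
        ∃ c : E →ₗ[K] K, (∀ z ∈ Z, c z = 0) ∧ ∀ w, c (ρ w) = d (σ w) := by
  refine ⟨(Y.comap ρ).map σ, (Z.comap ρ).map σ, ?_, ?_, ?_⟩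
  · refine lt_of_le_not_ge (Submodule.map_mono (Submodule.comap_mono hZY)) fun hle => ?_
    obtain ⟨w, hY, hZ⟩ := h₁
    obtain ⟨w', hw', e⟩ := hle ⟨w, hY, rfl⟩
    refine hZ ?_
    have := h₂ (w - w') (by rw [map_sub, e, sub_self])
      (by rw [map_sub]; exact Y.sub_mem hY (hZY hw'))
    have := Z.add_mem this hw'
    rwa [map_sub, sub_add_cancel] at this
  · rintro _ ⟨w, hw, rfl⟩
    exact ⟨w, hw, rfl⟩
  · intro d hd
    obtain ⟨ψ, hψ⟩ := exists_comp_eq (d ∘ₗ σ) (Z.mkQ ∘ₗ ρ) (fun w hw => by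
      rw [LinearMap.mem_ker, LinearMap.comp_apply, Submodule.mkQ_apply,
        Submodule.Quotient.mk_eq_zero] at hw
      exact hd _ ⟨w, hw, rfl⟩)
    refine ⟨ψ ∘ₗ Z.mkQ, fun z hz => ?_, fun w => DFunLike.congr_fun hψ w⟩
    rw [LinearMap.comp_apply, Submodule.mkQ_apply, (Submodule.Quotient.mk_eq_zero Z).2 hz, map_zero]

variable {I J : Type*} [Fintype I] [Fintype J]

/-- The pairing of vectors and covectors. -/
def pair (c u : I → K) : K := ∑ i, c i * u i

theorem exists_pair_eq (φ : (I → K) →ₗ[K] K) : ∃ c : I → K, ∀ u, φ u = pair c u := by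
  classical
  refine ⟨fun i => φ (Pi.single i 1), fun u => ?_⟩
  rw [LinearMap.pi_apply_eq_sum_univ φ u]
  exact Finset.sum_congr rfl fun i _ => by
    rw [smul_eq_mul, mul_comm]
    congr 2
    funext j
    simp [Pi.single_apply, eq_comm]

/-- The covector `c`, as a linear form. -/
def pairₗ (c : I → K) : (I → K) →ₗ[K] K := ∑ i, c i • LinearMap.proj i

theorem pairₗ_apply (c u : I → K) : pairₗ c u = pair c u := by simp [pairₗ, pair]

theorem exists_pair_eq_one {Z : Submodule K (I → K)} {u : I → K} (hu : u ∉ Z) :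
    ∃ c : I → K, (∀ z ∈ Z, pair c z = 0) ∧ pair c u = 1 := by
  obtain ⟨f, hf, hZ⟩ := Submodule.exists_le_ker_of_notMem hu
  obtain ⟨c, hc⟩ := exists_pair_eq ((f u)⁻¹ • f)
  refine ⟨c, fun z hz => ?_, ?_⟩
  · rw [← hc, LinearMap.smul_apply, LinearMap.mem_ker.1 (hZ hz), smul_zero]
  · rw [← hc, LinearMap.smul_apply, smul_eq_mul, inv_mul_cancel₀ hf]

/-- Solvability of a linear system of equations. -/
theorem exists_mulVec_eq (A : I → J → K) (g : I → K)
    (h : ∀ t : I → K, (∀ j, ∑ i, t i * A i j = 0) → ∑ i, t i * g i = 0) :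
    ∃ b : J → K, ∀ i, ∑ j, A i j * b j = g i := by
  classical
  let τ : (I → K) →ₗ[K] (J → K) :=
    { toFun := fun t j => ∑ i, t i * A i j
      map_add' := fun t s => by ext j; simp [add_mul, Finset.sum_add_distrib]
      map_smul' := fun r t => by ext j; simp [mul_assoc, Finset.mul_sum] }
  obtain ⟨ψ, hψ⟩ := exists_comp_eq (pairₗ g) τ (fun t ht => by
    rw [LinearMap.mem_ker, pairₗ_apply, pair]
    rw [← h t fun j => congrFun (LinearMap.mem_ker.1 ht) j]
    exact Finset.sum_congr rfl fun i _ => mul_comm _ _)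
  obtain ⟨b, hb⟩ := exists_pair_eq ψ
  refine ⟨b, fun i => ?_⟩
  have := DFunLike.congr_fun hψ (Pi.single i 1)
  rw [LinearMap.comp_apply, hb, pairₗ_apply] at this
  simp only [pair, τ, LinearMap.coe_mk, AddHom.coe_mk, Pi.single_apply] at this
  simp only [ite_mul, one_mul, zero_mul, Finset.sum_ite_eq', Finset.mem_univ, if_true, mul_ite,
    mul_one, mul_zero] at this
  rw [← this]
  exact Finset.sum_congr rfl fun j _ => mul_comm _ _

/-! ### The matrix problem around a vertex -/

/-- The positions `a`, `b`, `c` occur in this cyclic order; `a = b` and `b = c` are allowed. -/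
def Cyc (a b c : ℕ) : Prop := (a ≤ b ∧ b ≤ c) ∨ (b ≤ c ∧ c < a) ∨ (c < a ∧ a ≤ b)

instance (a b c : ℕ) : Decidable (Cyc a b c) := inferInstanceAs (Decidable (_ ∨ _))

variable (F : I → J → K) (p : I → ℕ) (r : J → ℕ)

/-- The rows `u` and `s` at the positions `a` (sources) and `b` (sinks) can be completed to a
morphism into the complex. -/
def LinkA (E : Set I) (a : ℕ) (G : Set J) (b : ℕ) (u : I → K) (s : J → K) : Prop :=
  ∃ (t : I → K) (τ : J → K), (∀ i ∈ E, t i = u i) ∧ (∀ j ∈ G, τ j = s j) ∧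
    ∀ j, ∑ i, t i * (if Cyc a (p i) (r j) then F i j else 0) = if Cyc a b (r j) then τ j else 0

/-- The columns `c` and `d` at the positions `a` (sources) and `b` (sinks) can be completed to a
morphism out of the complex. -/
def LinkB (E : Set I) (a : ℕ) (G : Set J) (b : ℕ) (c : I → K) (d : J → K) : Prop :=
  ∃ (e : J → K) (η : I → K), (∀ j ∈ G, e j = d j) ∧ (∀ i ∈ E, η i = c i) ∧
    ∀ i, ∑ j, (if Cyc (p i) (r j) b then F i j else 0) * e j = if Cyc (p i) a b then η i else 0

/-- The row `u` at the position `a` is annihilated. -/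
def StopA (E : Set I) (a : ℕ) (u : I → K) : Prop :=
  ∃ t : I → K, (∀ i ∈ E, t i = u i) ∧
    ∀ j, ∑ i, t i * (if Cyc a (p i) (r j) then F i j else 0) = 0

/-- The column `d` at the position `b` is annihilated. -/
def StopB (G : Set J) (b : ℕ) (d : J → K) : Prop :=
  ∃ e : J → K, (∀ j ∈ G, e j = d j) ∧
    ∀ i, ∑ j, (if Cyc (p i) (r j) b then F i j else 0) * e j = 0

section Source

/-- The linear map `t ↦ t N`. -/
def vecMul (N : I → J → K) : (I → K) →ₗ[K] (J → K) where
  toFun t j := ∑ i, t i * N i j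
  map_add' t s := by ext j; simp [add_mul, Finset.sum_add_distrib]
  map_smul' r t := by ext j; simp [mul_assoc, Finset.mul_sum]

theorem vecMul_apply (N : I → J → K) (t : I → K) (j : J) : vecMul N t j = ∑ i, t i * N i j := rfl

open scoped Classical in
/-- Restriction of a vector to a set of coordinates. -/
def restrict (E : Set I) : (I → K) →ₗ[K] (I → K) where
  toFun t i := if i ∈ E then t i else 0
  map_add' t s := by ext i; by_cases h : i ∈ E <;> simp [h]
  map_smul' r t := by ext i; by_cases h : i ∈ E <;> simp [h]

theorem restrict_of_mem {E : Set I} {t : I → K} {i : I} (h : i ∈ E) : restrict E t i = t i :=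
  if_pos h

theorem restrict_of_notMem {E : Set I} {t : I → K} {i : I} (h : i ∉ E) : restrict E t i = 0 :=
  if_neg h

theorem restrict_eq_self {E : Set I} {u : I → K} (h : ∀ i, i ∉ E → u i = 0) :
    restrict E u = u := by
  ext i
  by_cases hi : i ∈ E
  · exact restrict_of_mem hi
  · rw [restrict_of_notMem hi, h i hi]

variable {F p r}

/-- The step at a vertex that is entered through a source. -/
theorem source_step {E : Set I} {J₀ : Set J} (hE : ∀ i ∈ E, p i = 0)
    (hE' : ∀ i j, F i j ≠ 0 → p i = 0 → i ∈ E)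
    (hJ₀ : ∀ i j, F i j ≠ 0 → j ∈ J₀)
    {Y Z : Submodule K (I → K)} (hZY : Z < Y) (hY : ∀ u ∈ Y, ∀ i, i ∉ E → u i = 0) :
    (∃ u ∈ Y, ∃ c : I → K, (∀ z ∈ Z, pair c z = 0) ∧ pair c u = 1 ∧ StopA F p r E 0 u) ∨
    ∃ k, ∃ Y' Z' : Submodule K (J → K), Z' < Y' ∧
      (∀ s ∈ Y', ∀ j, ¬ (j ∈ J₀ ∧ r j = k) → s j = 0) ∧
      ∀ s ∈ Y', ∀ d : J → K, (∀ z ∈ Z', pair d z = 0) → pair d s = 1 →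
        ∃ u ∈ Y, ∃ c : I → K, (∀ z ∈ Z, pair c z = 0) ∧ pair c u = 1 ∧
          LinkA F p r E 0 {j | j ∈ J₀ ∧ r j = k} k u s ∧
          LinkB F p r E 0 {j | j ∈ J₀ ∧ r j = k} k c d := by
  classical
  set N : I → J → K := fun i j => if p i ≤ r j then F i j else 0 with hN
  have hcyc (a b : ℕ) : Cyc 0 a b ↔ a ≤ b := by simp only [Cyc]; omega
  let D (m : ℕ) : Submodule K (I → K) :=
    ((LinearMap.ker (restrict {j | r j < m} ∘ₗ vecMul N)).map (restrict E))
  have hD (m : ℕ) (u : I → K) : u ∈ D m ↔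
      ∃ t, (∀ j, r j < m → ∑ i, t i * N i j = 0) ∧ restrict E t = u := by
    constructor
    · rintro ⟨t, ht, rfl⟩
      refine ⟨t, fun j hj => ?_, rfl⟩
      have := congrFun (LinearMap.mem_ker.1 ht) j
      rwa [LinearMap.comp_apply, restrict_of_mem (by exact hj)] at this
    · rintro ⟨t, ht, rfl⟩
      refine ⟨t, LinearMap.mem_ker.2 (funext fun j => ?_), rfl⟩
      rw [LinearMap.comp_apply]
      by_cases hj : r j < m
      · rw [restrict_of_mem (by exact hj)]; exact ht j hj
      · exact restrict_of_notMem (by exact hj)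
  set B := Finset.univ.sup r + 1 with hB
  have hlt (j : J) : r j < B := Nat.lt_succ_of_le (Finset.le_sup (Finset.mem_univ j))
  by_cases hdone : Y ⊓ D B ≤ Z
  swap
  · left
    obtain ⟨u, ⟨huY, huD⟩, huZ⟩ := SetLike.not_le_iff_exists.1 hdone
    obtain ⟨c, hc, hcu⟩ := exists_pair_eq_one huZ
    obtain ⟨t, ht, rfl⟩ := (hD _ _).1 huD
    refine ⟨_, huY, c, hc, hcu, t, fun i hi => (restrict_of_mem hi).symm, fun j => ?_⟩
    simpa only [hN, hcyc] using ht j (hlt j)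
  right
  have hex : ∃ m, Y ⊓ D m ≤ Z := ⟨B, hdone⟩
  have h0 : Nat.find hex ≠ 0 := by
    intro h0
    have := Nat.find_spec hex
    rw [h0] at this
    refine hZY.not_ge fun u hu => this ⟨hu, (hD _ _).2 ⟨u, by simp, restrict_eq_self (hY u hu)⟩⟩
  obtain ⟨k, hk⟩ := Nat.exists_eq_succ_of_ne_zero h0
  have hk1 : Y ⊓ D (k + 1) ≤ Z := by
    have := Nat.find_spec hex
    rwa [hk] at this
  have hk0 : ¬ Y ⊓ D k ≤ Z := Nat.find_min hex (by omega)
  set G : Set J := {j | j ∈ J₀ ∧ r j = k} with hG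
  let W : Submodule K (I → K) := LinearMap.ker (restrict {j | r j < k} ∘ₗ vecMul N)
  have hW (t : I → K) : t ∈ W ↔ ∀ j, r j < k → ∑ i, t i * N i j = 0 := by
    constructor
    · intro ht j hj
      have := congrFun (LinearMap.mem_ker.1 ht) j
      rwa [LinearMap.comp_apply, restrict_of_mem (by exact hj)] at this
    · intro ht
      refine LinearMap.mem_ker.2 (funext fun j => ?_)
      rw [LinearMap.comp_apply]
      by_cases hj : r j < k
      · rw [restrict_of_mem (by exact hj)]; exact ht j hj
      · exact restrict_of_notMem (by exact hj)
  have hNJ (t : I → K) (j : J) (hj : j ∉ J₀) : ∑ i, t i * N i j = 0 :=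
    Finset.sum_eq_zero fun i _ => by
      have : F i j = 0 := by
        by_contra h; exact hj (hJ₀ i j h)
      simp [hN, this]
  obtain ⟨Y', Z', hlt', hY', hd'⟩ := exists_lt_and_forall_exists (restrict E ∘ₗ W.subtype)
    (restrict G ∘ₗ vecMul N ∘ₗ W.subtype) hZY.le
    (by
      obtain ⟨u, ⟨huY, huD⟩, huZ⟩ := SetLike.not_le_iff_exists.1 hk0
      obtain ⟨t, ht, rfl⟩ := (hD _ _).1 huD
      exact ⟨⟨t, (hW t).2 ht⟩, huY, huZ⟩)
    (by
      rintro ⟨t, ht⟩ hs hY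
      refine hk1 ⟨hY, (hD _ _).2 ⟨t, fun j hj => ?_, rfl⟩⟩
      rcases Nat.lt_succ_iff_lt_or_eq.1 hj with hj | hj
      · exact (hW t).1 ht j hj
      · by_cases hj0 : j ∈ J₀
        · have := congrFun hs j
          rwa [LinearMap.comp_apply, restrict_of_mem (by exact ⟨hj0, hj⟩)] at this
        · exact hNJ t j hj0)
  refine ⟨k, Y', Z', hlt', ?_, ?_⟩
  · intro s hs j hj
    obtain ⟨w, -, rfl⟩ := hY' s hs
    exact restrict_of_notMem hj
  · intro s hs d hd hds
    obtain ⟨⟨t, ht⟩, huY, rfl⟩ := hY' s hs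
    obtain ⟨c', hc', hcd'⟩ := hd' (pairₗ d) (fun z hz => by rw [pairₗ_apply]; exact hd z hz)
    obtain ⟨c, hc⟩ := exists_pair_eq c'
    have key (w : W) : pair c (restrict E w.1) = pair d (restrict G (vecMul N w.1)) := by
      rw [← hc, ← pairₗ_apply]; exact hcd' w
    refine ⟨_, huY, c, fun z hz => by rw [← hc]; exact hc' z hz,
      (key ⟨t, ht⟩).trans hds, ?_, ?_⟩
    · refine ⟨t, fun j => ∑ i, t i * N i j, fun i hi => (restrict_of_mem hi).symm,
        fun j hj => (restrict_of_mem (t := vecMul N t) hj).symm, fun j => ?_⟩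
      simp only [hcyc]
      split_ifs with h
      · rfl
      · exact (hW t).1 ht j (by omega)
    · obtain ⟨b, hb⟩ := exists_mulVec_eq (fun i j => if r j < k then N i j else 0)
        (fun i => (if i ∈ E then c i else 0) - ∑ j, N i j * (if j ∈ G then d j else 0))
        (by
          intro t ht
          have htW : t ∈ W := (hW t).2 fun j hj => by simpa [hj] using ht j
          have := key ⟨t, htW⟩
          simp only [pair] at this
          simp only [mul_sub, Finset.sum_sub_distrib, sub_eq_zero]
          calc ∑ i, t i * (if i ∈ E then c i else 0) = ∑ i, c i * restrict E t i := by
                refine Finset.sum_congr rfl fun i _ => ?_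
                by_cases hi : i ∈ E
                · rw [if_pos hi, restrict_of_mem hi, mul_comm]
                · rw [if_neg hi, restrict_of_notMem hi, mul_zero, mul_zero]
            _ = ∑ j, d j * restrict G (vecMul N t) j := this
            _ = ∑ j, ∑ i, t i * (N i j * if j ∈ G then d j else 0) := by
                refine Finset.sum_congr rfl fun j _ => ?_
                by_cases hj : j ∈ G
                · rw [restrict_of_mem hj, vecMul_apply, Finset.mul_sum]
                  exact Finset.sum_congr rfl fun i _ => by rw [if_pos hj]; ring
                · rw [restrict_of_notMem hj, mul_zero]
                  simp [hj]
            _ = ∑ i, t i * ∑ j, N i j * (if j ∈ G then d j else 0) := by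
                rw [Finset.sum_comm]
                simp only [Finset.mul_sum])
      set e : J → K := fun j => if r j < k then b j else if j ∈ G then d j else 0 with he
      have hNe (i : I) : ∑ j, N i j * e j = if i ∈ E then c i else 0 := by
        have := hb i
        rw [eq_sub_iff_add_eq, ← Finset.sum_add_distrib] at this
        rw [← this]
        refine Finset.sum_congr rfl fun j _ => ?_
        by_cases hj : r j < k
        · have : j ∉ G := fun h => by have := h.2; omega
          simp [he, hj, this]
        · simp [he, hj]
      refine ⟨e, fun i => if i ∈ E then c i else
          ∑ j, (if Cyc (p i) (r j) k then F i j else 0) * e j, fun j hj => ?_,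
        fun i hi => if_pos hi, fun i => ?_⟩
      · have hj : j ∈ G := hj
        have : ¬ r j < k := by have := hj.2; omega
        simp [he, this, hj]
      · by_cases hi : i ∈ E
        · have hp := hE i hi
          rw [if_pos (show Cyc (p i) 0 k by simp only [Cyc]; omega)]
          refine Eq.trans ?_ (if_pos hi).symm
          have := hNe i
          rw [if_pos hi] at this
          rw [← this]
          refine Finset.sum_congr rfl fun j _ => ?_
          by_cases hj : r j ≤ k
          · simp [hN, hcyc, hj, hp]
          · have h1 : ¬ r j < k := by omega
            have h2 : j ∉ G := fun h => by have := h.2; omega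
            simp [he, h1, h2]
        · by_cases hz : ∀ j, F i j = 0
          · simp [hz, hi]
          push Not at hz
          obtain ⟨j₁, hj₁⟩ := hz
          have hp0 : p i ≠ 0 := fun h => hi (hE' i j₁ hj₁ h)
          by_cases hik : p i ≤ k
          · rw [if_neg (show ¬ Cyc (p i) 0 k by simp only [Cyc]; omega)]
            have := hNe i
            rw [if_neg hi] at this
            refine Eq.trans ?_ this
            refine Finset.sum_congr rfl fun j _ => ?_
            by_cases hj : r j ≤ k
            · have h1 : Cyc (p i) (r j) k ↔ p i ≤ r j := by simp only [Cyc]; omega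
              simp only [hN, h1]
            · have h1 : ¬ r j < k := by omega
              have h2 : j ∉ G := fun h => by have := h.2; omega
              simp [he, h1, h2]
          · rw [if_pos (show Cyc (p i) 0 k by simp only [Cyc]; omega)]
            exact (if_neg hi).symm

end Source

section Sink

variable {F p r}

open scoped Classical in
theorem exists_column {E : Set J} {G : Set I} {k : ℕ} (N : I → J → K)
    (c : J → K) (d : I → K)
    (h : ∀ t : I → K, (∀ i, p i < k → t i = 0) → (∀ j, j ∉ E → vecMul N t j = 0) →
      pair c (restrict E (vecMul N t)) = pair d (restrict G t)) :
    ∃ e : J → K, (∀ j ∈ E, e j = c j) ∧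
      ∀ i, k ≤ p i → ∑ j, N i j * e j = if i ∈ G then d i else 0 := by
  obtain ⟨b, hb⟩ := exists_mulVec_eq (fun i j => if k ≤ p i ∧ j ∉ E then N i j else 0)
    (fun i => if k ≤ p i then
      (if i ∈ G then d i else 0) - ∑ j, N i j * (if j ∈ E then c j else 0) else 0)
    (by
      intro t ht
      set t' : I → K := fun i => if k ≤ p i then t i else 0 with ht'
      have h0 (j : J) (hj : j ∉ E) : vecMul N t' j = 0 := by
        rw [vecMul_apply, ← ht j]
        refine Finset.sum_congr rfl fun i _ => ?_
        by_cases hi : k ≤ p i <;> simp [ht', hi, hj]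
      have := h t' (fun i hi => if_neg (by omega)) h0
      have e1 : pair c (restrict E (vecMul N t')) =
          ∑ i, t' i * ∑ j, N i j * (if j ∈ E then c j else 0) := by
        simp only [Finset.mul_sum]
        rw [Finset.sum_comm, pair]
        refine Finset.sum_congr rfl fun j _ => ?_
        by_cases hj : j ∈ E
        · rw [restrict_of_mem hj, vecMul_apply, Finset.mul_sum]
          exact Finset.sum_congr rfl fun i _ => by rw [if_pos hj]; ring
        · rw [restrict_of_notMem hj]
          simp [hj]
      have e2 : pair d (restrict G t') = ∑ i, t' i * (if i ∈ G then d i else 0) := by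
        refine Finset.sum_congr rfl fun i _ => ?_
        by_cases hi : i ∈ G
        · rw [restrict_of_mem hi, if_pos hi, mul_comm]
        · rw [restrict_of_notMem hi, if_neg hi, mul_zero, mul_zero]
      rw [e1, e2] at this
      refine Eq.trans ?_ (sub_eq_zero.2 this.symm)
      rw [← Finset.sum_sub_distrib]
      refine Finset.sum_congr rfl fun i _ => ?_
      by_cases hi : k ≤ p i
      · simp only [ht', if_pos hi, mul_sub]
      · simp only [ht', if_neg hi, mul_zero, zero_mul, sub_zero])
  refine ⟨fun j => if j ∈ E then c j else b j, fun j hj => if_pos hj, fun i hi => ?_⟩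
  have := hb i
  simp only [if_pos hi, eq_sub_iff_add_eq, ← Finset.sum_add_distrib] at this
  rw [← this]
  refine Finset.sum_congr rfl fun j _ => ?_
  by_cases hj : j ∈ E <;> simp [hj, hi]

/-- The step at a vertex that is entered through a sink. -/
theorem sink_step {E : Set J} {I₀ : Set I} (hE : ∀ j ∈ E, r j = 0)
    (hE' : ∀ i j, F i j ≠ 0 → r j = 0 → j ∈ E) (hp : ∀ i j, F i j ≠ 0 → p i ≠ 0)
    (hI₀ : ∀ i j, F i j ≠ 0 → i ∈ I₀)
    {Y Z : Submodule K (J → K)} (hZY : Z < Y) :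
    (∃ u ∈ Y, ∃ c : J → K, (∀ z ∈ Z, pair c z = 0) ∧ pair c u = 1 ∧ StopB F p r E 0 c) ∨
    ∃ k, ∃ Y' Z' : Submodule K (I → K), Z' < Y' ∧
      (∀ s ∈ Y', ∀ i, ¬ (i ∈ I₀ ∧ p i = k) → s i = 0) ∧
      ∀ s ∈ Y', ∀ d : I → K, (∀ z ∈ Z', pair d z = 0) → pair d s = 1 →
        ∃ u ∈ Y, ∃ c : J → K, (∀ z ∈ Z, pair c z = 0) ∧ pair c u = 1 ∧
          LinkA F p r {i | i ∈ I₀ ∧ p i = k} k E 0 s u ∧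
          LinkB F p r {i | i ∈ I₀ ∧ p i = k} k E 0 d c := by
  classical
  set N : I → J → K := fun i j => if j ∈ E ∨ p i ≤ r j then F i j else 0 with hN
  have hF (t : I → K) (j : J) (a : ℕ) (ha : 1 ≤ a) (ht : ∀ i, p i < a → t i = 0)
      (hj : a ≤ r j ∨ j ∈ E) :
      ∑ i, t i * (if Cyc a (p i) (r j) then F i j else 0) = vecMul N t j := by
    refine Finset.sum_congr rfl fun i _ => ?_
    by_cases hFij : F i j = 0
    · simp [hN, hFij]
    by_cases hi : p i < a
    · simp [ht i hi]
    congr 1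
    have := hp i j hFij
    have h2 := hE j
    simp only [hN, Cyc]
    refine if_congr ?_ rfl rfl
    constructor
    · intro h
      by_contra h'
      push Not at h'
      have := h'.2
      rcases hj with hj | hj
      · omega
      · exact h'.1 hj
    · rintro (h | h)
      · have := h2 h
        omega
      · rcases hj with hj | hj
        · omega
        · have := h2 hj; omega
  have hcol (i : I) (e : J → K) :
      ∑ j, (if Cyc (p i) (r j) 0 then F i j else 0) * e j = ∑ j, N i j * e j := by
    refine Finset.sum_congr rfl fun j _ => ?_
    by_cases hFij : F i j = 0
    · simp [hN, hFij]
    congr 1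
    have h1 := hp i j hFij
    have h2 := hE j
    have h3 := hE' i j hFij
    simp only [hN, Cyc]
    refine if_congr ⟨fun h => ?_, fun h => ?_⟩ rfl rfl
    · by_cases h4 : r j = 0
      · exact .inl (h3 h4)
      · exact .inr (by omega)
    · rcases h with h | h
      · have := h2 h
        omega
      · omega
  let W (k : ℕ) : Submodule K (I → K) :=
    LinearMap.ker (restrict {i | p i < k}) ⊓ LinearMap.ker (restrict Eᶜ ∘ₗ vecMul N)
  have hW (k : ℕ) (t : I → K) : t ∈ W k ↔
      (∀ i, p i < k → t i = 0) ∧ ∀ j, j ∉ E → vecMul N t j = 0 := by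
    constructor
    · rintro ⟨h1, h2⟩
      refine ⟨fun i hi => ?_, fun j hj => ?_⟩
      · have := congrFun (LinearMap.mem_ker.1 h1) i
        rwa [restrict_of_mem (by exact hi)] at this
      · have := congrFun (LinearMap.mem_ker.1 h2) j
        rwa [LinearMap.comp_apply, restrict_of_mem (by exact hj)] at this
    · rintro ⟨h1, h2⟩
      refine ⟨LinearMap.mem_ker.2 (funext fun i => ?_), LinearMap.mem_ker.2 (funext fun j => ?_)⟩
      · by_cases hi : p i < k
        · rw [restrict_of_mem (by exact hi)]; exact h1 i hi
        · exact restrict_of_notMem (by exact hi)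
      · rw [LinearMap.comp_apply]
        by_cases hj : j ∉ E
        · rw [restrict_of_mem (by exact hj)]; exact h2 j hj
        · exact restrict_of_notMem (by exact hj)
  let D (k : ℕ) : Submodule K (J → K) := (W k).map (restrict E ∘ₗ vecMul N)
  by_cases hdone : Y ⊓ D 1 ≤ Z
  · left
    obtain ⟨u, huY, huZ⟩ := SetLike.exists_of_lt hZY
    have hu : u ∉ Z ⊔ D 1 := by
      intro h
      obtain ⟨z, hz, w, hw, rfl⟩ := Submodule.mem_sup.1 h
      have : w ∈ Y := by
        have := Y.sub_mem huY (hZY.le hz)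
        rwa [add_sub_cancel_left] at this
      exact huZ (Z.add_mem hz (hdone ⟨this, hw⟩))
    obtain ⟨c, hc, hcu⟩ := exists_pair_eq_one hu
    refine ⟨u, huY, c, fun z hz => hc z (Submodule.mem_sup_left hz), hcu, ?_⟩
    obtain ⟨e, he, he'⟩ := exists_column (p := p) (E := E) (G := ∅) (k := 1) N c 0 (by
      intro t h1 h2
      refine (hc _ (Submodule.mem_sup_right ⟨t, (hW 1 t).2 ⟨h1, h2⟩, rfl⟩)).trans ?_
      simp [pair])
    refine ⟨e, he, fun i => ?_⟩
    rw [hcol]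
    by_cases hi : 1 ≤ p i
    · rw [he' i hi, if_neg (Set.notMem_empty i)]
    · refine Finset.sum_eq_zero fun j _ => ?_
      have : F i j = 0 := by
        by_contra h
        have := hp i j h
        omega
      simp [hN, this]
  right
  have hex : ∃ m, Y ⊓ D (m + 1) ≤ Z := by
    refine ⟨Finset.univ.sup p, ?_⟩
    rintro _ ⟨-, t, ht, rfl⟩
    have : t = 0 := funext fun i => ((hW _ t).1 ht).1 i
      (Nat.lt_succ_of_le (Finset.le_sup (Finset.mem_univ i)))
    rw [this, map_zero]
    exact Z.zero_mem
  obtain ⟨m, hm⟩ := Nat.exists_eq_succ_of_ne_zero (n := Nat.find hex) fun h0 => hdone (by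
    have := Nat.find_spec hex
    rwa [h0] at this)
  have hk1 : Y ⊓ D (m + 2) ≤ Z := by
    have := Nat.find_spec hex
    rwa [hm] at this
  have hk0 : ¬ Y ⊓ D (m + 1) ≤ Z := Nat.find_min hex (by omega)
  obtain ⟨k, hk⟩ : ∃ k, k = m + 1 := ⟨_, rfl⟩
  rw [← hk] at hk0
  rw [show m + 2 = k + 1 by omega] at hk1
  set G : Set I := {i | i ∈ I₀ ∧ p i = k} with hG
  have hNi (i : I) (hi : i ∉ I₀) (j : J) : N i j = 0 := by
    have : F i j = 0 := by
      by_contra h; exact hi (hI₀ i j h)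
    simp [hN, this]
  obtain ⟨Y', Z', hlt', hY', hd'⟩ := exists_lt_and_forall_exists
    (restrict E ∘ₗ vecMul N ∘ₗ (W k).subtype) (restrict G ∘ₗ (W k).subtype) hZY.le
    (by
      obtain ⟨u, ⟨huY, t, ht, rfl⟩, huZ⟩ := SetLike.not_le_iff_exists.1 hk0
      exact ⟨⟨t, ht⟩, huY, huZ⟩)
    (by
      rintro ⟨t, ht⟩ hs hY
      obtain ⟨h1, h2⟩ := (hW k t).1 ht
      have e : vecMul N (restrict I₀ t) = vecMul N t := by
        ext j
        refine Finset.sum_congr rfl fun i _ => ?_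
        by_cases hi : i ∈ I₀
        · rw [restrict_of_mem hi]
        · rw [hNi i hi, mul_zero, mul_zero]
      refine hk1 ⟨hY, restrict I₀ t, (hW _ _).2 ⟨fun i hi => ?_, fun j hj => ?_⟩, ?_⟩
      · by_cases hi0 : i ∈ I₀
        · rw [restrict_of_mem hi0]
          rcases Nat.lt_succ_iff_lt_or_eq.1 hi with hi | hi
          · exact h1 i hi
          · have := congrFun hs i
            rwa [LinearMap.comp_apply, restrict_of_mem (by exact ⟨hi0, hi⟩)] at this
        · exact restrict_of_notMem hi0
      · rw [e]; exact h2 j hj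
      · rw [LinearMap.comp_apply, e]; rfl)
  refine ⟨k, Y', Z', hlt', ?_, ?_⟩
  · intro s hs i hi
    obtain ⟨w, -, rfl⟩ := hY' s hs
    exact restrict_of_notMem hi
  · intro s hs d hd hds
    obtain ⟨⟨t, ht⟩, huY, rfl⟩ := hY' s hs
    obtain ⟨c', hc', hcd'⟩ := hd' (pairₗ d) (fun z hz => by rw [pairₗ_apply]; exact hd z hz)
    obtain ⟨c, hc⟩ := exists_pair_eq c'
    have key (w : W k) : pair c (restrict E (vecMul N w.1)) = pair d (restrict G w.1) := by
      rw [← hc, ← pairₗ_apply]; exact hcd' w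
    obtain ⟨h1, h2⟩ := (hW k t).1 ht
    refine ⟨_, huY, c, fun z hz => by rw [← hc]; exact hc' z hz,
      (key ⟨t, ht⟩).trans hds, ?_, ?_⟩
    · refine ⟨t, fun j => ∑ i, t i * (if Cyc k (p i) (r j) then F i j else 0),
        fun i hi => (restrict_of_mem (t := t) hi).symm, fun j hj => ?_, fun j => ?_⟩
      · dsimp only
        rw [hF t j k (by omega) h1 (.inr hj)]
        exact (restrict_of_mem (t := vecMul N t) hj).symm
      · split_ifs with h
        · rfl
        · rw [hF t j k (by omega) h1 (.inl (by simp only [Cyc] at h; omega))]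
          refine h2 j fun hj => h ?_
          have := hE j hj
          simp only [Cyc]
          omega
    · obtain ⟨e, he, he'⟩ := exists_column (p := p) (E := E) (G := G) (k := k)
        N c d (fun t h1 h2 => key ⟨t, (hW k t).2 ⟨h1, h2⟩⟩)
      refine ⟨e, fun i => if i ∈ G then d i else ∑ j, N i j * e j, he, fun i hi => if_pos hi,
        fun i => ?_⟩
      rw [hcol]
      by_cases hi : i ∈ G
      · have := hi.2
        rw [he' i this.ge, if_pos hi, if_pos (show Cyc (p i) k 0 by simp only [Cyc]; omega)]
        exact (if_pos hi).symm
      · by_cases hz : ∀ j, F i j = 0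
        · simp [hN, hz, hi]
        push Not at hz
        obtain ⟨j₁, hj₁⟩ := hz
        have := hp i j₁ hj₁
        split_ifs with h3
        · exact (if_neg hi).symm
        · rw [he' i (by simp only [Cyc] at h3; omega), if_neg hi]

end Sink

end LocalStep

end

set_option linter.unusedSectionVars false

noncomputable section

namespace BrauerTree

open LocalStep

variable {V : Type v} {Γ : BrauerTree V} {K : Type u} [Field K] [Finite V]

theorem dpos_le_iff_cyc {w : V} {b x y z : Γ.Edge} (hb : w ∈ b.1) (hx : w ∈ x.1) (hy : w ∈ y.1)
    (hz : w ∈ z.1) :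
    dpos w x y ≤ dpos w x z ↔ Cyc (dpos w b x) (dpos w b y) (dpos w b z) :=
  dpos_le_dpos_iff hb hx hy hz

/-! ### Rows and columns of endomorphisms -/

section Rows

variable {S : Type*} [Fintype S] (z : S → Γ.Edge) (σ : Γ.Edge → Prop)

open scoped Classical in
/-- The row with coefficients `t` that starts at `X` and runs around the vertex `w`. -/
def row (w : V) (X : Γ.Edge) (t : S → K) (s : S) : Γ.Alg K :=
  if w ∈ (z s).1 ∧ (σ (z s) ↔ σ X) then t s • qpath K w X (z s) else 0

open scoped Classical in
/-- The column with coefficients `e` that ends at `X` and runs around the vertex `w`. -/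
def col (w : V) (X : Γ.Edge) (e : S → K) (s : S) : Γ.Alg K :=
  if w ∈ (z s).1 ∧ (σ (z s) ↔ σ X) then e s • qpath K w (z s) X else 0

/-- The part of the differential that runs around the vertex `w`. -/
def locMap (G : V → S → S → K) (w : V) (s r : S) : Γ.Alg K :=
  G w s r • qpath K w (z s) (z r)

/-- The matrix `φ` has the coefficients `G`. -/
structure IsCoeff (G : V → S → S → K) (φ : S → S → Γ.Alg K) : Prop where
  supp : ∀ w s s', G w s s' ≠ 0 → w ∈ (z s).1 ∧ w ∈ (z s').1 ∧ σ (z s) ∧ ¬ σ (z s')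
  eq_smul : ∀ w s s', w ∈ (z s).1 → w ∈ (z s').1 → φ s s' = G w s s' • qpath K w (z s) (z s')
  eq_zero : ∀ s s', (∀ w, w ∈ (z s).1 → w ∉ (z s').1) → φ s s' = 0

variable {z σ} {G : V → S → S → K} {φ : S → S → Γ.Alg K}

theorem row_mem {w : V} {X : Γ.Edge} (hX : w ∈ X.1) (t : S → K) (s : S) :
    row z σ w X t s ∈ peirce K X (z s) := by
  unfold row
  split_ifs with h
  · exact Submodule.smul_mem _ _ (qpath_mem_peirce hX h.1)
  · exact Submodule.zero_mem _

theorem col_mem {w : V} {X : Γ.Edge} (hX : w ∈ X.1) (t : S → K) (s : S) :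
    col z σ w X t s ∈ peirce K (z s) X := by
  unfold col
  split_ifs with h
  · exact Submodule.smul_mem _ _ (qpath_mem_peirce h.1 hX)
  · exact Submodule.zero_mem _

theorem row_of_eq {w : V} {X : Γ.Edge} (hX : w ∈ X.1) (t : S → K) {s : S} (h : z s = X) :
    row z σ w X t s = t s • Γ.idem K X := by
  rw [row, if_pos ⟨h ▸ hX, by rw [h]⟩, h, qpath_self]

theorem col_of_eq {w : V} {X : Γ.Edge} (hX : w ∈ X.1) (t : S → K) {s : S} (h : z s = X) :
    col z σ w X t s = t s • Γ.idem K X := by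
  rw [col, if_pos ⟨h ▸ hX, by rw [h]⟩, h, qpath_self]

theorem row_of_not {w : V} {X : Γ.Edge} (t : S → K) {s : S} (h : ¬ (σ (z s) ↔ σ X)) :
    row z σ w X t s = 0 := if_neg fun hh => h hh.2

theorem col_of_not {w : V} {X : Γ.Edge} (t : S → K) {s : S} (h : ¬ (σ (z s) ↔ σ X)) :
    col z σ w X t s = 0 := if_neg fun hh => h hh.2

theorem sum_row_mul_locMap (hG : IsCoeff z σ G φ) {w : V} {B X : Γ.Edge} (hB : w ∈ B.1)
    (hX : w ∈ X.1) (hσ : σ X) (t : S → K) (s' : S) :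
    ∑ s, row z σ w X t s * locMap z G w s s' =
      (∑ s, t s * if Cyc (dpos w B X) (dpos w B (z s)) (dpos w B (z s')) then G w s s' else 0) •
        qpath K w X (z s') := by
  rw [Finset.sum_smul]
  refine Finset.sum_congr rfl fun s _ => ?_
  by_cases h0 : G w s s' = 0
  · simp [locMap, h0]
  obtain ⟨h1, h2, h3, h4⟩ := hG.supp w s s' h0
  rw [row, if_pos ⟨h1, iff_of_true h3 hσ⟩, locMap, smul_mul_smul_comm,
    qpath_mul_qpath hX h1 h2 fun e => h4 (e ▸ hσ)]
  by_cases h : dpos w X (z s) ≤ dpos w X (z s')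
  · rw [if_pos h, if_pos ((dpos_le_iff_cyc hB hX h1 h2).1 h)]
  · rw [if_neg h, if_neg fun h' => h ((dpos_le_iff_cyc hB hX h1 h2).2 h'), smul_zero, mul_zero,
      zero_smul]

theorem sum_locMap_mul_col (hG : IsCoeff z σ G φ) {w : V} {B X : Γ.Edge} (hB : w ∈ B.1)
    (hX : w ∈ X.1) (hσ : ¬ σ X) (e : S → K) (s : S) :
    ∑ s', locMap z G w s s' * col z σ w X e s' =
      (∑ s', (if Cyc (dpos w B (z s)) (dpos w B (z s')) (dpos w B X) then G w s s' else 0) * e s') •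
        qpath K w (z s) X := by
  rw [Finset.sum_smul]
  refine Finset.sum_congr rfl fun s' _ => ?_
  by_cases h0 : G w s s' = 0
  · simp [locMap, h0]
  obtain ⟨h1, h2, h3, h4⟩ := hG.supp w s s' h0
  rw [col, if_pos ⟨h2, iff_of_false h4 hσ⟩, locMap, smul_mul_smul_comm,
    qpath_mul_qpath h1 h2 hX fun e => hσ (e ▸ h3)]
  by_cases h : dpos w (z s) (z s') ≤ dpos w (z s) X
  · rw [if_pos h, if_pos ((dpos_le_iff_cyc hB h1 h2 hX).1 h)]
  · rw [if_neg h, if_neg fun h' => h ((dpos_le_iff_cyc hB h1 h2 hX).2 h'), smul_zero, zero_mul,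
      zero_smul]

theorem sum_row_mul_locMap_eq_zero (hG : IsCoeff z σ G φ) {w : V} {X : Γ.Edge} (t : S → K) (s' : S)
    (h : ¬ (w ∈ (z s').1 ∧ ¬ σ (z s'))) : ∑ s, row z σ w X t s * locMap z G w s s' = 0 := by
  refine Finset.sum_eq_zero fun s _ => ?_
  have : G w s s' = 0 := by
    by_contra h0
    obtain ⟨-, h2, -, h4⟩ := hG.supp w s s' h0
    exact h ⟨h2, h4⟩
  rw [locMap, this, zero_smul, mul_zero]

theorem sum_locMap_mul_col_eq_zero (hG : IsCoeff z σ G φ) {w : V} {X : Γ.Edge} (e : S → K) (s : S)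
    (h : ¬ (w ∈ (z s).1 ∧ σ (z s))) : ∑ s', locMap z G w s s' * col z σ w X e s' = 0 := by
  refine Finset.sum_eq_zero fun s' _ => ?_
  have : G w s s' = 0 := by
    by_contra h0
    obtain ⟨h1, -, h3, -⟩ := hG.supp w s s' h0
    exact h ⟨h1, h3⟩
  rw [locMap, this, zero_smul, zero_mul]

variable (z σ G) in
/-- The rows at a source `X` and a sink `Z` fit together around `w`. -/
def RowLink (w : V) (X Z : Γ.Edge) (t τ : S → K) : Prop :=
  ∀ s', ∑ s, row z σ w X t s * locMap z G w s s' = qpath K w X Z * row z σ w Z τ s'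

variable (z σ G) in
/-- The columns at a source `X` and a sink `Z` fit together around `w`. -/
def ColLink (w : V) (X Z : Γ.Edge) (η e : S → K) : Prop :=
  ∀ s, ∑ s', locMap z G w s s' * col z σ w Z e s' = col z σ w X η s * qpath K w X Z

variable (z σ G) in
/-- The vectors `u`, `v` and the covectors `c`, `d` at a source `X` and a sink `Z` fit together
around `w`. -/
def LinkAt (w : V) (X : Γ.Edge) (u c : S → K) (Z : Γ.Edge) (v d : S → K) : Prop :=
  ∃ t τ η e : S → K, (∀ s, z s = X → t s = u s) ∧ (∀ s, z s = X → η s = c s) ∧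
    (∀ s, z s = Z → τ s = v s) ∧ (∀ s, z s = Z → e s = d s) ∧
    RowLink z σ G w X Z t τ ∧ ColLink z σ G w X Z η e

variable (z σ G) in
/-- The vector `u` and the covector `c` at the edge `X` need no continuation at `w`. -/
def StopAt (w : V) (X : Γ.Edge) (u c : S → K) : Prop :=
  (σ X ∧ ∃ t : S → K, (∀ s, z s = X → t s = u s) ∧
    ∀ s', ∑ s, row z σ w X t s * locMap z G w s s' = 0) ∨
  (¬ σ X ∧ ∃ e : S → K, (∀ s, z s = X → e s = c s) ∧
    ∀ s, ∑ s', locMap z G w s s' * col z σ w X e s' = 0)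

variable (z σ G) in
/-- The vectors and covectors at two consecutive edges fit together. -/
def Linked (w : V) (X : Γ.Edge) (u c : S → K) (Z : Γ.Edge) (v d : S → K) : Prop :=
  (σ X ∧ ¬ σ Z ∧ LinkAt z σ G w X u c Z v d) ∨ (¬ σ X ∧ σ Z ∧ LinkAt z σ G w Z v d X u c)

theorem rowLink_of_linkA (hG : IsCoeff z σ G φ) {w : V} {B X Z : Γ.Edge} (hB : w ∈ B.1)
    (hX : w ∈ X.1) (hZ : w ∈ Z.1) (hσX : σ X) (hσZ : ¬ σ Z) {t τ : S → K}
    (h : ∀ s', ∑ s, t s * (if Cyc (dpos w B X) (dpos w B (z s)) (dpos w B (z s')) then G w s s'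
      else 0) = if Cyc (dpos w B X) (dpos w B Z) (dpos w B (z s')) then τ s' else 0) :
    RowLink z σ G w X Z t τ := by
  intro s'
  by_cases hs : w ∈ (z s').1 ∧ ¬ σ (z s')
  · rw [sum_row_mul_locMap hG hB hX hσX, h, row,
      if_pos (show w ∈ (z s').1 ∧ (σ (z s') ↔ σ Z) from ⟨hs.1, iff_of_false hs.2 hσZ⟩),
      mul_smul_comm, qpath_mul_qpath hX hZ hs.1 fun e => hs.2 (e ▸ hσX)]
    by_cases h : dpos w X Z ≤ dpos w X (z s')
    · rw [if_pos h, if_pos ((dpos_le_iff_cyc hB hX hZ hs.1).1 h)]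
    · rw [if_neg h, if_neg fun h' => h ((dpos_le_iff_cyc hB hX hZ hs.1).2 h'), smul_zero,
        zero_smul]
  · rw [sum_row_mul_locMap_eq_zero hG t s' hs, row, if_neg fun hh => hs ⟨hh.1, fun h1 =>
      hσZ (hh.2.1 h1)⟩, mul_zero]

theorem colLink_of_linkB (hG : IsCoeff z σ G φ) {w : V} {B X Z : Γ.Edge} (hB : w ∈ B.1)
    (hX : w ∈ X.1) (hZ : w ∈ Z.1) (hσX : σ X) (hσZ : ¬ σ Z) {η e : S → K}
    (h : ∀ s, ∑ s', (if Cyc (dpos w B (z s)) (dpos w B (z s')) (dpos w B Z) then G w s s'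
      else 0) * e s' = if Cyc (dpos w B (z s)) (dpos w B X) (dpos w B Z) then η s else 0) :
    ColLink z σ G w X Z η e := by
  intro s
  by_cases hs : w ∈ (z s).1 ∧ σ (z s)
  · rw [sum_locMap_mul_col hG hB hZ hσZ, h, col,
      if_pos (show w ∈ (z s).1 ∧ (σ (z s) ↔ σ X) from ⟨hs.1, iff_of_true hs.2 hσX⟩),
      smul_mul_assoc, qpath_mul_qpath hs.1 hX hZ fun e => hσZ (e ▸ hs.2)]
    by_cases h : dpos w (z s) X ≤ dpos w (z s) Z
    · rw [if_pos h, if_pos ((dpos_le_iff_cyc hB hs.1 hX hZ).1 h)]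
    · rw [if_neg h, if_neg fun h' => h ((dpos_le_iff_cyc hB hs.1 hX hZ).2 h'), smul_zero,
        zero_smul]
  · rw [sum_locMap_mul_col_eq_zero hG e s hs, col, if_neg fun hh => hs ⟨hh.1, hh.2.2 hσX⟩,
      zero_mul]

/-- The step from an edge `X` across its vertex `w`. -/
theorem exists_step (hG : IsCoeff z σ G φ) {w : V} {X : Γ.Edge} (hX : w ∈ X.1)
    {Y Z : Submodule K (S → K)} (hZY : Z < Y) (hY : ∀ u ∈ Y, ∀ s, z s ≠ X → u s = 0) :
    (∃ u ∈ Y, ∃ c : S → K, (∀ y ∈ Z, pair c y = 0) ∧ pair c u = 1 ∧ StopAt z σ G w X u c) ∨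
    ∃ X' : Γ.Edge, X' ≠ X ∧ w ∈ X'.1 ∧ ∃ Y' Z' : Submodule K (S → K), Z' < Y' ∧
      (∀ u ∈ Y', ∀ s, z s ≠ X' → u s = 0) ∧
      ∀ v ∈ Y', ∀ d : S → K, (∀ y ∈ Z', pair d y = 0) → pair d v = 1 →
        ∃ u ∈ Y, ∃ c : S → K, (∀ y ∈ Z, pair c y = 0) ∧ pair c u = 1 ∧
          Linked z σ G w X u c X' v d := by
  classical
  have hnz {Y' Z' : Submodule K (S → K)} (h : Z' < Y') : ∃ v ∈ Y', ∃ s, v s ≠ 0 := by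
    obtain ⟨v, hv, hv'⟩ := SetLike.exists_of_lt h
    refine ⟨v, hv, ?_⟩
    by_contra hh
    push Not at hh
    exact hv' (by rw [show v = 0 from funext hh]; exact Z'.zero_mem)
  by_cases hσ : σ X
  · rcases source_step (F := G w) (p := fun s => dpos w X (z s)) (r := fun s => dpos w X (z s))
      (E := {s | z s = X}) (J₀ := {s | w ∈ (z s).1 ∧ ¬ σ (z s)})
      (fun s hs => by rw [show z s = X from hs, dpos_self])
      (fun s s' h0 h => (dpos_inj hX hX (hG.supp w s s' h0).1 (by rw [h, dpos_self])).symm)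
      (fun s s' h0 => ⟨(hG.supp w s s' h0).2.1, (hG.supp w s s' h0).2.2.2⟩) hZY hY with
      ⟨u, hu, c, hc, hcu, t, ht, hdone⟩ | ⟨k, Y', Z', hlt, hY', h⟩
    · refine .inl ⟨u, hu, c, hc, hcu, .inl ⟨hσ, t, ht, fun s' => ?_⟩⟩
      rw [sum_row_mul_locMap hG hX hX hσ, dpos_self, hdone, zero_smul]
    · obtain ⟨v₀, hv₀, s₀, hs₀⟩ := hnz hlt
      have hs₀' : (w ∈ (z s₀).1 ∧ ¬ σ (z s₀)) ∧ dpos w X (z s₀) = k := by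
        by_contra hh; exact hs₀ (hY' v₀ hv₀ s₀ hh)
      obtain ⟨⟨hw, hσ'⟩, hk⟩ := hs₀'
      refine .inr ⟨z s₀, fun e => hσ' (e ▸ hσ), hw, Y', Z', hlt, fun v hv s hs => ?_, ?_⟩
      · refine hY' v hv s fun hh => hs ?_
        exact dpos_inj hX hh.1.1 hw (hh.2.trans hk.symm)
      · intro v hv d hd hdv
        obtain ⟨u, hu, c, hc, hcu, ⟨t, τ, h1, h2, h3⟩, e, η, h4, h5, h6⟩ := h v hv d hd hdv
        refine ⟨u, hu, c, hc, hcu, .inl ⟨hσ, hσ', t, τ, η, e, h1, h5, fun s hs => h2 s ?_,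
          fun s hs => h4 s ?_, rowLink_of_linkA hG hX hX hw hσ hσ' ?_,
          colLink_of_linkB hG hX hX hw hσ hσ' ?_⟩⟩
        · exact ⟨by rw [Set.mem_ofPred_eq, hs]; exact ⟨hw, hσ'⟩, by rw [hs]; exact hk⟩
        · exact ⟨by rw [Set.mem_ofPred_eq, hs]; exact ⟨hw, hσ'⟩, by rw [hs]; exact hk⟩
        · rw [dpos_self, hk]; exact h3
        · rw [dpos_self, hk]; exact h6
  · rcases sink_step (F := G w) (p := fun s => dpos w X (z s)) (r := fun s => dpos w X (z s))
      (E := {s | z s = X}) (I₀ := {s | w ∈ (z s).1 ∧ σ (z s)})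
      (fun s hs => by rw [show z s = X from hs, dpos_self])
      (fun s s' h0 h => (dpos_inj hX hX (hG.supp w s s' h0).2.1 (by rw [h, dpos_self])).symm)
      (fun s s' h0 h => hσ (by
        rw [dpos_inj hX hX (hG.supp w s s' h0).1 (by rw [h, dpos_self])]
        exact (hG.supp w s s' h0).2.2.1))
      (fun s s' h0 => ⟨(hG.supp w s s' h0).1, (hG.supp w s s' h0).2.2.1⟩) hZY with
      ⟨u, hu, c, hc, hcu, t, ht, hdone⟩ | ⟨k, Y', Z', hlt, hY', h⟩
    · refine .inl ⟨u, hu, c, hc, hcu, .inr ⟨hσ, t, ht, fun s' => ?_⟩⟩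
      rw [sum_locMap_mul_col hG hX hX hσ, dpos_self, hdone, zero_smul]
    · obtain ⟨v₀, hv₀, s₀, hs₀⟩ := hnz hlt
      have hs₀' : (w ∈ (z s₀).1 ∧ σ (z s₀)) ∧ dpos w X (z s₀) = k := by
        by_contra hh; exact hs₀ (hY' v₀ hv₀ s₀ hh)
      obtain ⟨⟨hw, hσ'⟩, hk⟩ := hs₀'
      refine .inr ⟨z s₀, fun e => hσ (e ▸ hσ'), hw, Y', Z', hlt, fun v hv s hs => ?_, ?_⟩
      · refine hY' v hv s fun hh => hs ?_
        exact dpos_inj hX hh.1.1 hw (hh.2.trans hk.symm)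
      · intro v hv d hd hdv
        obtain ⟨u, hu, c, hc, hcu, ⟨t, τ, h1, h2, h3⟩, e, η, h4, h5, h6⟩ := h v hv d hd hdv
        refine ⟨u, hu, c, hc, hcu, .inr ⟨hσ, hσ', t, τ, η, e, fun s hs => h1 s ?_,
          fun s hs => h5 s ?_, h2, h4, rowLink_of_linkA hG hX hw hX hσ' hσ ?_,
          colLink_of_linkB hG hX hw hX hσ' hσ ?_⟩⟩
        · exact ⟨by rw [Set.mem_ofPred_eq, hs]; exact ⟨hw, hσ'⟩, by rw [hs]; exact hk⟩
        · exact ⟨by rw [Set.mem_ofPred_eq, hs]; exact ⟨hw, hσ'⟩, by rw [hs]; exact hk⟩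
        · rw [dpos_self, hk]; exact h3
        · rw [dpos_self, hk]; exact h6

end Rows

end BrauerTree

end

set_option linter.unusedSectionVars false

noncomputable section

namespace BrauerTree

open LocalStep

variable {V : Type v} {Γ : BrauerTree V} {K : Type u} [Field K] [Finite V]

section FullRows

variable {S : Type*} [Fintype S] (z : S → Γ.Edge) (σ : Γ.Edge → Prop)

open scoped Classical in
/-- The row that starts at `X` and runs around both vertices `a` and `b` of `X`. -/
def fullRow (a b : V) (X : Γ.Edge) (t t' : S → K) (s : S) : Γ.Alg K :=
  if z s = X then t s • Γ.idem K X else row z σ a X t s + row z σ b X t' s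

open scoped Classical in
/-- The column that ends at `X` and runs around both vertices `a` and `b` of `X`. -/
def fullCol (a b : V) (X : Γ.Edge) (e e' : S → K) (s : S) : Γ.Alg K :=
  if z s = X then e s • Γ.idem K X else col z σ a X e s + col z σ b X e' s

variable {z σ} {G : V → S → S → K} {φ : S → S → Γ.Alg K} {a b : V} {X : Γ.Edge} {t t' : S → K}

theorem fullRow_comm (h : ∀ s, z s = X → t' s = t s) (s : S) :
    fullRow z σ b a X t' t s = fullRow z σ a b X t t' s := by
  unfold fullRow
  split_ifs with hs
  · rw [h s hs]
  · rw [add_comm]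

theorem fullCol_comm (h : ∀ s, z s = X → t' s = t s) (s : S) :
    fullCol z σ b a X t' t s = fullCol z σ a b X t t' s := by
  unfold fullCol
  split_ifs with hs
  · rw [h s hs]
  · rw [add_comm]

theorem fullRow_mem (ha : a ∈ X.1) (hb : b ∈ X.1) (s : S) :
    fullRow z σ a b X t t' s ∈ peirce K X (z s) := by
  unfold fullRow
  split_ifs with hs
  · rw [hs]; exact Submodule.smul_mem _ _ (idem_mem_peirce X)
  · exact Submodule.add_mem _ (row_mem ha t s) (row_mem hb t' s)

theorem fullCol_mem (ha : a ∈ X.1) (hb : b ∈ X.1) (s : S) :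
    fullCol z σ a b X t t' s ∈ peirce K (z s) X := by
  unfold fullCol
  split_ifs with hs
  · rw [hs]; exact Submodule.smul_mem _ _ (idem_mem_peirce X)
  · exact Submodule.add_mem _ (col_mem ha t s) (col_mem hb t' s)

theorem fullRow_of_not {s : S} (h : ¬ (σ (z s) ↔ σ X)) : fullRow z σ a b X t t' s = 0 := by
  rw [fullRow, if_neg fun hs => h (by rw [hs]), row_of_not t h, row_of_not t' h, add_zero]

theorem fullCol_of_not {s : S} (h : ¬ (σ (z s) ↔ σ X)) : fullCol z σ a b X t t' s = 0 := by
  rw [fullCol, if_neg fun hs => h (by rw [hs]), col_of_not t h, col_of_not t' h, add_zero]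

theorem qpath_mul_fullRow (hab : a ≠ b) (ha : a ∈ X.1) (hb : b ∈ X.1) {Y : Γ.Edge} (hY : a ∈ Y.1)
    (hYX : Y ≠ X) (s : S) :
    qpath K a Y X * fullRow z σ a b X t t' s = qpath K a Y X * row z σ a X t s := by
  unfold fullRow
  split_ifs with hs
  · rw [row_of_eq ha t hs]
  · rw [mul_add]
    convert add_zero _
    unfold row
    split_ifs with h
    · rw [mul_smul_comm, qpath_mul_qpath_of_ne hY ha hb h.1 hYX (Ne.symm hs) hab, smul_zero]
    · rw [mul_zero]

theorem fullCol_mul_qpath (hab : a ≠ b) (ha : a ∈ X.1) (hb : b ∈ X.1) {Y : Γ.Edge} (hY : a ∈ Y.1)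
    (hYX : Y ≠ X) (s : S) :
    fullCol z σ a b X t t' s * qpath K a X Y = col z σ a X t s * qpath K a X Y := by
  unfold fullCol
  split_ifs with hs
  · rw [col_of_eq ha t hs]
  · rw [add_mul]
    convert add_zero _
    unfold col
    split_ifs with h
    · rw [smul_mul_assoc, qpath_mul_qpath_of_ne h.1 hb ha hY hs hYX.symm hab.symm, smul_zero]
    · rw [zero_mul]

theorem IsCoeff.of_ne_zero (hG : IsCoeff z σ G φ) {s s' : S} (h : φ s s' ≠ 0) :
    ∃ w, w ∈ (z s).1 ∧ w ∈ (z s').1 ∧ σ (z s) ∧ ¬ σ (z s') ∧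
      φ s s' = G w s s' • qpath K w (z s) (z s') := by
  by_contra hh
  refine h (hG.eq_zero s s' fun w hw hw' => hh ⟨w, hw, hw', ?_⟩)
  have h1 := hG.eq_smul w s s' hw hw'
  have h2 : G w s s' ≠ 0 := fun h0 => h (by rw [h1, h0, zero_smul])
  exact ⟨(hG.supp w s s' h2).2.2.1, (hG.supp w s s' h2).2.2.2, h1⟩

theorem locMap_eq (hG : IsCoeff z σ G φ) {s s' : S} (h : a ∈ (z s).1) (h' : a ∈ (z s').1) :
    locMap z G a s s' = φ s s' := (hG.eq_smul a s s' h h').symm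

theorem locMap_of_not (hG : IsCoeff z σ G φ) {s s' : S}
    (h : ¬ (a ∈ (z s).1 ∧ a ∈ (z s').1 ∧ σ (z s) ∧ ¬ σ (z s'))) :
    locMap z G a s s' = 0 := by
  rw [locMap, show G a s s' = 0 by by_contra h0; exact h (hG.supp a s s' h0), zero_smul]

theorem row_mul_eq (hG : IsCoeff z σ G φ) (ha : a ∈ X.1) {s : S} (hs : z s ≠ X) (s' : S) :
    row z σ a X t s * φ s s' = row z σ a X t s * locMap z G a s s' := by
  by_cases h : a ∈ (z s).1 ∧ (σ (z s) ↔ σ X)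
  · by_cases h' : a ∈ (z s').1
    · rw [locMap_eq hG h.1 h']
    · rw [locMap_of_not hG fun hh => h' hh.2.1, mul_zero]
      by_contra hne
      obtain ⟨w, h1, h2, h3, h4, h5⟩ := hG.of_ne_zero (right_ne_zero_of_mul hne)
      refine hne ?_
      rw [h5, row, if_pos h, smul_mul_smul_comm, qpath_mul_qpath_of_ne ha h.1 h1 h2 (Ne.symm hs)
        (fun e => h4 (e ▸ h3)) (fun e => h' (e ▸ h2)), smul_zero]
  · rw [row, if_neg h, zero_mul, zero_mul]

theorem mul_col_eq (hG : IsCoeff z σ G φ) (ha : a ∈ X.1) {s' : S} (hs : z s' ≠ X) (s : S) :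
    φ s s' * col z σ a X t s' = locMap z G a s s' * col z σ a X t s' := by
  by_cases h : a ∈ (z s').1 ∧ (σ (z s') ↔ σ X)
  · by_cases h' : a ∈ (z s).1
    · rw [locMap_eq hG h' h.1]
    · rw [locMap_of_not hG fun hh => h' hh.1, zero_mul]
      by_contra hne
      obtain ⟨w, h1, h2, h3, h4, h5⟩ := hG.of_ne_zero (left_ne_zero_of_mul hne)
      refine hne ?_
      rw [h5, col, if_pos h, smul_mul_smul_comm, qpath_mul_qpath_of_ne h1 h2 h.1 ha
        (fun e => h4 (e ▸ h3)) hs (fun e => h' (e ▸ h1)), smul_zero]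
  · rw [col, if_neg h, mul_zero, mul_zero]

theorem eq_or_eq_of_mem (hab : a ≠ b) (ha : a ∈ X.1) (hb : b ∈ X.1) {w : V} (hw : w ∈ X.1) :
    w = a ∨ w = b := by
  have : X.1 = s(a, b) := (Sym2.mem_and_mem_iff hab).1 ⟨ha, hb⟩
  rwa [this, Sym2.mem_iff] at hw

theorem eq_locMap_add_locMap_left (hG : IsCoeff z σ G φ) (hab : a ≠ b) (ha : a ∈ X.1)
    (hb : b ∈ X.1) {s : S} (hs : z s = X) (s' : S) :
    φ s s' = locMap z G a s s' + locMap z G b s s' := by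
  subst hs
  by_cases h : a ∈ (z s').1
  · rw [locMap_eq hG ha h, locMap_of_not hG (a := b), add_zero]
    rintro ⟨-, h1, h2, h3⟩
    exact h3 (eq_of_mem_of_mem hab ha hb h h1 ▸ h2)
  · rw [locMap_of_not hG (a := a) fun hh => h hh.2.1, zero_add]
    by_cases h' : b ∈ (z s').1
    · rw [locMap_eq hG hb h']
    · rw [locMap_of_not hG (a := b) fun hh => h' hh.2.1]
      refine hG.eq_zero s s' fun w hw => ?_
      rcases eq_or_eq_of_mem hab ha hb hw with rfl | rfl
      exacts [h, h']

theorem eq_locMap_add_locMap_right (hG : IsCoeff z σ G φ) (hab : a ≠ b) (ha : a ∈ X.1)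
    (hb : b ∈ X.1) {s' : S} (hs : z s' = X) (s : S) :
    φ s s' = locMap z G a s s' + locMap z G b s s' := by
  subst hs
  by_cases h : a ∈ (z s).1
  · rw [locMap_eq hG h ha, locMap_of_not hG (a := b), add_zero]
    rintro ⟨h1, -, h2, h3⟩
    exact h3 (eq_of_mem_of_mem hab ha hb h h1 ▸ h2)
  · rw [locMap_of_not hG (a := a) fun hh => h hh.1, zero_add]
    by_cases h' : b ∈ (z s).1
    · rw [locMap_eq hG h' hb]
    · rw [locMap_of_not hG (a := b) fun hh => h' hh.1]
      refine hG.eq_zero s s' fun w hw hw' => ?_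
      rcases eq_or_eq_of_mem hab ha hb hw' with rfl | rfl
      exacts [h hw, h' hw]

theorem sum_fullRow_mul (hG : IsCoeff z σ G φ) (hab : a ≠ b) (ha : a ∈ X.1) (hb : b ∈ X.1)
    (ht : ∀ s, z s = X → t' s = t s) (s' : S) :
    ∑ s, fullRow z σ a b X t t' s * φ s s' =
      ∑ s, row z σ a X t s * locMap z G a s s' + ∑ s, row z σ b X t' s * locMap z G b s s' := by
  rw [← Finset.sum_add_distrib]
  refine Finset.sum_congr rfl fun s _ => ?_
  by_cases hs : z s = X
  · rw [fullRow, if_pos hs, row_of_eq ha t hs, row_of_eq hb t' hs, ht s hs, ← mul_add,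
      eq_locMap_add_locMap_left hG hab ha hb hs]
  · rw [fullRow, if_neg hs, add_mul, row_mul_eq hG ha hs, row_mul_eq hG hb hs]

theorem sum_mul_fullCol (hG : IsCoeff z σ G φ) (hab : a ≠ b) (ha : a ∈ X.1) (hb : b ∈ X.1)
    (ht : ∀ s, z s = X → t' s = t s) (s : S) :
    ∑ s', φ s s' * fullCol z σ a b X t t' s' =
      ∑ s', locMap z G a s s' * col z σ a X t s' + ∑ s', locMap z G b s s' * col z σ b X t' s' := by
  rw [← Finset.sum_add_distrib]
  refine Finset.sum_congr rfl fun s' _ => ?_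
  by_cases hs : z s' = X
  · rw [fullCol, if_pos hs, col_of_eq ha t hs, col_of_eq hb t' hs, ht s' hs, ← add_mul,
      eq_locMap_add_locMap_right hG hab ha hb hs]
  · rw [fullCol, if_neg hs, mul_add, mul_col_eq hG ha hs, mul_col_eq hG hb hs]

theorem sum_fullRow_mul_of_not (hG : IsCoeff z σ G φ) (hσ : ¬ σ X) (s' : S) :
    ∑ s, fullRow z σ a b X t t' s * φ s s' = 0 := by
  refine Finset.sum_eq_zero fun s _ => ?_
  by_contra hne
  obtain ⟨w, -, -, h3, -⟩ := hG.of_ne_zero (right_ne_zero_of_mul hne)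
  exact left_ne_zero_of_mul hne (fullRow_of_not fun h => hσ (h.1 h3))

theorem sum_mul_fullCol_of (hG : IsCoeff z σ G φ) (hσ : σ X) (s : S) :
    ∑ s', φ s s' * fullCol z σ a b X t t' s' = 0 := by
  refine Finset.sum_eq_zero fun s' _ => ?_
  by_contra hne
  obtain ⟨w, -, -, -, h3, -⟩ := hG.of_ne_zero (left_ne_zero_of_mul hne)
  exact right_ne_zero_of_mul hne (fullCol_of_not fun h => h3 (h.2 hσ))

end FullRows

/-! ### Strings -/

section Strings

variable {S : Type*} [Fintype S] (z : S → Γ.Edge) (σ : Γ.Edge → Prop) (G : V → S → S → K)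

variable (Γ K S) in
/-- A half-edge together with a vector and a covector on the multiplicity space of its edge. -/
structure Node where
  dart : Γ.Arrow
  vec : S → K
  covec : S → K

/-- The node is supported on the multiplicity space of its edge, points away from the root `o`,
and its covector does not vanish on its vector. -/
structure Node.IsGood (o : V) (n : Node Γ K S) : Prop where
  vec_eq_zero : ∀ s, z s ≠ Γ.src n.dart → n.vec s = 0
  pair_eq_one : pair n.covec n.vec = 1
  dist_eq : Γ.graph.dist o n.dart.snd = Γ.graph.dist o n.dart.fst + 1

/-- A walk of nodes away from the root `o`, in which consecutive nodes are linked. -/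
inductive IsString (o : V) : Node Γ K S → List (Node Γ K S) → Prop
  | single (n : Node Γ K S) (hn : n.IsGood z o)
      (hs : StopAt z σ G n.dart.snd (Γ.src n.dart) n.vec n.covec) : IsString o n []
  | cons (m n : Node Γ K S) (L : List (Node Γ K S)) (hm : m.IsGood z o)
      (h : n.dart.fst = m.dart.snd)
      (hl : Linked z σ G m.dart.snd (Γ.src m.dart) m.vec m.covec (Γ.src n.dart) n.vec n.covec)
      (hn : IsString o n L) : IsString o m (n :: L)

variable {z σ G} {φ : S → S → Γ.Alg K} {o : V}

theorem IsString.isGood {n : Node Γ K S} {L : List (Node Γ K S)} (h : IsString z σ G o n L) :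
    n.IsGood z o := by
  cases h <;> assumption

theorem eq_of_adj_of_dist {a b c : V} (ha : Γ.graph.Adj a b) (hc : Γ.graph.Adj c b)
    (h : Γ.graph.dist o b = Γ.graph.dist o a + 1) (h' : Γ.graph.dist o b = Γ.graph.dist o c + 1) :
    a = c := by
  obtain ⟨p, hp⟩ := Γ.isTree.connected.exists_walk_length_eq_dist o a
  obtain ⟨q, hq⟩ := Γ.isTree.connected.exists_walk_length_eq_dist o c
  have h1 : (p.concat ha).IsPath := SimpleGraph.Walk.isPath_of_length_eq_dist _ (by
    rw [SimpleGraph.Walk.length_concat, hp, h])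
  have h2 : (q.concat hc).IsPath := SimpleGraph.Walk.isPath_of_length_eq_dist _ (by
    rw [SimpleGraph.Walk.length_concat, hq, h'])
  have e := (Γ.isTree.existsUnique_path o b).unique h1 h2
  have := congrArg SimpleGraph.Walk.penultimate e
  simpa using this

/-- The edges at `d.snd` other than that of `d` point away from the root if `d` does. -/
theorem dist_half {d : Γ.Arrow} (hd : Γ.graph.dist o d.snd = Γ.graph.dist o d.fst + 1)
    {X : Γ.Edge} (hX : d.snd ∈ X.1) (hne : X ≠ Γ.src d) :
    Γ.graph.dist o (half d.snd X).snd = Γ.graph.dist o (half d.snd X).fst + 1 := by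
  rcases Γ.isTree.dist_eq_dist_add_one_of_adj o (half d.snd X).adj with h | h
  · exfalso
    have h1 := half_fst hX
    have e : d.fst = (half d.snd X).snd := eq_of_adj_of_dist (o := o) (b := d.snd) d.adj
      (by have := (half d.snd X).adj.symm; rwa [h1] at this) hd (by rw [h1] at h; exact h)
    refine hne (eq_of_mem_of_mem d.adj.ne ?_ hX (fst_mem_src d) (snd_mem_src d))
    have := snd_mem_src (half d.snd X)
    rwa [src_half, ← e] at this
  · exact h

/-- Every pair of subspaces at an edge is separated by a string that starts there. -/
theorem exists_isString (hG : IsCoeff z σ G φ) {d : Γ.Arrow}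
    (hd : Γ.graph.dist o d.snd = Γ.graph.dist o d.fst + 1) {Y Z : Submodule K (S → K)}
    (hZY : Z < Y) (hY : ∀ u ∈ Y, ∀ s, z s ≠ Γ.src d → u s = 0) :
    ∃ n L, IsString z σ G o n L ∧ n.dart = d ∧ n.vec ∈ Y ∧ ∀ y ∈ Z, pair n.covec y = 0 := by
  obtain ⟨B, hB⟩ : ∃ B, ∀ v, Γ.graph.dist o v ≤ B := by
    have := Fintype.ofFinite V
    exact ⟨Finset.univ.sup (Γ.graph.dist o), fun v => Finset.le_sup (Finset.mem_univ v)⟩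
  obtain ⟨k, hk⟩ : ∃ k, B ≤ Γ.graph.dist o d.snd + k := ⟨B, by omega⟩
  induction k generalizing d Y Z with
  | zero =>
    rcases exists_step hG (snd_mem_src d) hZY hY with ⟨u, hu, c, hc, hcu, hdone⟩ |
      ⟨X', hne, hX', -⟩
    · exact ⟨⟨d, u, c⟩, [], .single _ ⟨hY u hu, hcu, hd⟩ hdone, rfl, hu, hc⟩
    · have := dist_half hd hX' hne
      have h1 := hB (half d.snd X').snd
      rw [half_fst hX'] at this
      omega
  | succ k ih =>
    rcases exists_step hG (snd_mem_src d) hZY hY with ⟨u, hu, c, hc, hcu, hdone⟩ |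
      ⟨X', hne, hX', Y', Z', hlt, hY', h⟩
    · exact ⟨⟨d, u, c⟩, [], .single _ ⟨hY u hu, hcu, hd⟩ hdone, rfl, hu, hc⟩
    · have h1 := dist_half hd hX' hne
      obtain ⟨n, L, hn, hnd, hv, hc⟩ := ih h1 hlt (by rw [src_half]; exact hY')
        (by rw [h1, half_fst hX']; omega)
      obtain ⟨u, hu, c, hc', hcu, hl⟩ := h n.vec hv n.covec hc hn.isGood.pair_eq_one
      refine ⟨⟨d, u, c⟩, n :: L, .cons _ n L ⟨hY u hu, hcu, hd⟩ (by rw [hnd, half_fst hX']) ?_ hn,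
        rfl, hu, hc'⟩
      rw [hnd, src_half]
      exact hl

open scoped Classical in
/-- The endomorphism given by a string: it commutes with the differential up to terms at the
starting vertex. -/
theorem IsString.exists_endo (hG : IsCoeff z σ G φ) {n : Node Γ K S} {L : List (Node Γ K S)}
    (h : IsString z σ G o n L) (t e : S → K) (ht : ∀ s, z s = Γ.src n.dart → t s = n.vec s)
    (he : ∀ s, z s = Γ.src n.dart → e s = n.covec s) :
    ∃ (t' e' : S → K) (ε : S → S → Γ.Alg K),
      (∀ s s', ε s s' ∈ peirce K (z s) (z s')) ∧
      (∀ s s', z s = z s' → chr K (z s) (ε s s') = ((n :: L).map fun m =>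
        if z s = Γ.src m.dart then m.covec s * m.vec s' else 0).sum) ∧
      (∀ s s', (∀ m ∈ n :: L, ¬ (σ (z s') ↔ σ (Γ.src m.dart))) → ε s s' = 0) ∧
      (σ (Γ.src n.dart) → ∀ s s', ∑ r, ε s r * φ r s' - ∑ r, φ s r * ε r s' =
        fullCol z σ n.dart.fst n.dart.snd (Γ.src n.dart) e e' s *
          ∑ r, row z σ n.dart.fst (Γ.src n.dart) t r * locMap z G n.dart.fst r s') ∧
      (¬ σ (Γ.src n.dart) → ∀ s s', ∑ r, ε s r * φ r s' - ∑ r, φ s r * ε r s' =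
        - ((∑ r, locMap z G n.dart.fst s r * col z σ n.dart.fst (Γ.src n.dart) e r) *
          fullRow z σ n.dart.fst n.dart.snd (Γ.src n.dart) t t' s')) := by
  have key (n : Node Γ K S) (t e t' e' : S → K)
      (ht : ∀ s, z s = Γ.src n.dart → t s = n.vec s)
      (he : ∀ s, z s = Γ.src n.dart → e s = n.covec s)
      (ht' : ∀ s, z s = Γ.src n.dart → t' s = n.vec s)
      (he' : ∀ s, z s = Γ.src n.dart → e' s = n.covec s) :
      ∃ ε : S → S → Γ.Alg K, (∀ s s', ε s s' ∈ peirce K (z s) (z s')) ∧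
        (∀ s s', z s = z s' → chr K (z s) (ε s s') =
          if z s = Γ.src n.dart then n.covec s * n.vec s' else 0) ∧
        (∀ s s', ¬ (σ (z s') ↔ σ (Γ.src n.dart)) → ε s s' = 0) ∧
        (σ (Γ.src n.dart) → ∀ s s', ∑ r, ε s r * φ r s' - ∑ r, φ s r * ε r s' =
          fullCol z σ n.dart.fst n.dart.snd (Γ.src n.dart) e e' s *
          (∑ r, row z σ n.dart.fst (Γ.src n.dart) t r * locMap z G n.dart.fst r s' +
            ∑ r, row z σ n.dart.snd (Γ.src n.dart) t' r * locMap z G n.dart.snd r s')) ∧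
        (¬ σ (Γ.src n.dart) → ∀ s s', ∑ r, ε s r * φ r s' - ∑ r, φ s r * ε r s' =
          - ((∑ r, locMap z G n.dart.fst s r * col z σ n.dart.fst (Γ.src n.dart) e r +
            ∑ r, locMap z G n.dart.snd s r * col z σ n.dart.snd (Γ.src n.dart) e' r) *
          fullRow z σ n.dart.fst n.dart.snd (Γ.src n.dart) t t' s')) := by
    have hf := fst_mem_src n.dart
    have hs := snd_mem_src n.dart
    refine ⟨fun s s' => fullCol z σ n.dart.fst n.dart.snd (Γ.src n.dart) e e' s *
      fullRow z σ n.dart.fst n.dart.snd (Γ.src n.dart) t t' s',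
      fun s s' => mul_mem_peirce (fullCol_mem hf hs s) (fullRow_mem hf hs s'), ?_, ?_, ?_, ?_⟩
    · intro s s' hss
      dsimp only
      split_ifs with hX
      · rw [map_mul, fullCol, if_pos hX, fullRow, if_pos (hss ▸ hX), he s hX, ht s' (hss ▸ hX),
          map_smul, map_smul, hX, chr_idem_self, smul_eq_mul, smul_eq_mul, mul_one, mul_one]
      · rw [map_mul, chr_eq_zero_of_peirce_right (fullCol_mem hf hs s) hX, zero_mul]
    · intro s s' hh
      dsimp only
      rw [fullRow_of_not hh, mul_zero]
    · intro hσ s s'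
      simp only [mul_assoc]
      simp only [← mul_assoc (φ s _)]
      rw [← Finset.mul_sum, ← Finset.sum_mul, sum_mul_fullCol_of hG hσ, zero_mul, sub_zero,
        sum_fullRow_mul hG n.dart.adj.ne hf hs fun s h => (ht' s h).trans (ht s h).symm]
    · intro hσ s s'
      simp only [mul_assoc]
      simp only [← mul_assoc (φ s _)]
      rw [← Finset.mul_sum, ← Finset.sum_mul, sum_fullRow_mul_of_not hG hσ, mul_zero, zero_sub,
        sum_mul_fullCol hG n.dart.adj.ne hf hs fun s h => (he' s h).trans (he s h).symm]
  induction h generalizing t e with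
  | single n hn hs =>
    rcases hs with ⟨hσ, t', ht', hs⟩ | ⟨hσ, e', he', hs⟩
    · obtain ⟨ε, h1, h2, h3, h4, -⟩ := key n t e t' e ht he ht' he
      refine ⟨t', e, ε, h1, fun s s' h => by simpa using h2 s s' h,
        fun s s' h => h3 s s' (h n (by simp)), fun h s s' => ?_, fun h => absurd hσ h⟩
      rw [h4 h, hs, add_zero]
    · obtain ⟨ε, h1, h2, h3, -, h4⟩ := key n t e t e' ht he ht he'
      refine ⟨t, e', ε, h1, fun s s' h => by simpa using h2 s s' h,
        fun s s' h => h3 s s' (h n (by simp)), fun h => absurd h hσ, fun h s s' => ?_⟩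
      rw [h4 h, hs, add_zero]
  | cons m n L hm hmn hl hn ih =>
    have hf := fst_mem_src n.dart
    have hs := snd_mem_src n.dart
    have hf' := fst_mem_src m.dart
    have hs' := snd_mem_src m.dart
    have hnX : m.dart.snd ∈ (Γ.src n.dart).1 := hmn ▸ hf
    rcases hl with ⟨hσ, hσ', t', τ, η, e', l1, l2, l3, l4, hr, hc⟩ |
      ⟨hσ, hσ', τ, t', e', η, l3, l4, l1, l2, hr, hc⟩
    · obtain ⟨ε, h1, h2, h3, h4, -⟩ := key m t e t' η ht he l1 l2
      obtain ⟨t₂, e₂, ε₂, k1, k2, k3, -, k4⟩ := ih τ e' l3 l4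
      have hne : Γ.src n.dart ≠ Γ.src m.dart := fun h => hσ' (h ▸ hσ)
      refine ⟨t', η, ε + ε₂, fun s s' => Submodule.add_mem _ (h1 s s') (k1 s s'), fun s s' h => ?_,
        fun s s' h => ?_, fun _ s s' => ?_, fun h => absurd hσ h⟩
      · rw [Pi.add_apply, Pi.add_apply, map_add, h2 s s' h, k2 s s' h]
        simp only [List.map_cons, List.sum_cons]
      · rw [Pi.add_apply, Pi.add_apply, h3 s s' (h m (by simp)),
          k3 s s' fun m' hm' => h m' (List.mem_cons_of_mem _ hm'), add_zero]
      · have e1 := h4 hσ s s'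
        have e2 := k4 hσ' s s'
        rw [hmn, hc s, mul_assoc, ← hmn, qpath_mul_fullRow n.dart.adj.ne hf hs
          (hmn ▸ hs') hne.symm, hmn, ← mul_assoc, ← fullCol_mul_qpath (t' := e) m.dart.adj.ne.symm
          hs' hf' hnX hne, mul_assoc, ← hr s', fullCol_comm fun s h => (l2 s h).trans (he s h).symm]
          at e2
        simp only [Pi.add_apply, add_mul, mul_add, Finset.sum_add_distrib] at e1 ⊢
        rw [add_sub_add_comm, e1, e2]
        abel
    · obtain ⟨ε, h1, h2, h3, -, h4⟩ := key m t e t' η ht he l1 l2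
      obtain ⟨t₂, e₂, ε₂, k1, k2, k3, k4, -⟩ := ih τ e' l3 l4
      have hne : Γ.src n.dart ≠ Γ.src m.dart := fun h => hσ (h ▸ hσ')
      refine ⟨t', η, ε + ε₂, fun s s' => Submodule.add_mem _ (h1 s s') (k1 s s'), fun s s' h => ?_,
        fun s s' h => ?_, fun h => absurd h hσ, fun _ s s' => ?_⟩
      · rw [Pi.add_apply, Pi.add_apply, map_add, h2 s s' h, k2 s s' h]
        simp only [List.map_cons, List.sum_cons]
      · rw [Pi.add_apply, Pi.add_apply, h3 s s' (h m (by simp)),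
          k3 s s' fun m' hm' => h m' (List.mem_cons_of_mem _ hm'), add_zero]
      · have e1 := h4 hσ s s'
        have e2 := k4 hσ' s s'
        rw [hmn, hr s', ← mul_assoc, ← hmn, fullCol_mul_qpath n.dart.adj.ne hf hs
          (hmn ▸ hs') hne.symm, hmn, mul_assoc, ← qpath_mul_fullRow (t' := t) m.dart.adj.ne.symm
          hs' hf' hnX hne, ← mul_assoc, ← hc s, fullRow_comm fun s h => (l1 s h).trans (ht s h).symm]
          at e2
        simp only [Pi.add_apply, add_mul, mul_add, Finset.sum_add_distrib] at e1 ⊢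
        rw [add_sub_add_comm, e1, e2]
        abel

end Strings

end BrauerTree

end

set_option linter.unusedSectionVars false

noncomputable section

namespace BrauerTree

open LocalStep

variable {V : Type v} {Γ : BrauerTree V} {K : Type u} [Field K] [Finite V]

section Sequences

variable {S : Type*} [Fintype S] {z : S → Γ.Edge} {σ : Γ.Edge → Prop} {G : V → S → S → K}
  {o : V}

theorem IsString.exists_seq {n : Node Γ K S} {L : List (Node Γ K S)} (h : IsString z σ G o n L) :
    ∃ N : ℕ → Node Γ K S, N 0 = n ∧ (∀ m ∈ n :: L, ∃ k ≤ L.length, N k = m) ∧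
      (∀ k ≤ L.length, N k ∈ n :: L ∧ (N k).IsGood z o) ∧
      (∀ f : Node Γ K S → K, ((n :: L).map f).sum = ∑ k ∈ Finset.range (L.length + 1), f (N k)) ∧
      ∀ k < L.length, (N (k + 1)).dart.fst = (N k).dart.snd ∧
        Linked z σ G (N k).dart.snd (Γ.src (N k).dart) (N k).vec (N k).covec
          (Γ.src (N (k + 1)).dart) (N (k + 1)).vec (N (k + 1)).covec := by
  induction h with
  | single n hn hs =>
    exact ⟨fun _ => n, rfl, fun m hm => ⟨0, le_rfl, (by simpa using hm : m = n).symm⟩,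
      fun k _ => ⟨by simp, hn⟩, fun f => by simp, fun k hk => absurd hk (by simp)⟩
  | cons m n L hm hmn hl hn ih =>
    obtain ⟨N, h0, h1, h2, h3, h4⟩ := ih
    refine ⟨fun k => k.casesOn m N, rfl, fun m' hm' => ?_, fun k hk => ?_, fun f => ?_,
      fun k hk => ?_⟩
    · rcases List.mem_cons.1 hm' with rfl | hm'
      · exact ⟨0, by simp, rfl⟩
      · obtain ⟨k, hk, e⟩ := h1 m' hm'
        exact ⟨k + 1, by simpa using hk, e⟩
    · cases k with
      | zero => exact ⟨by simp, hm⟩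
      | succ k =>
        have := h2 k (by simpa using hk)
        exact ⟨List.mem_cons_of_mem _ this.1, this.2⟩
    · rw [List.map_cons, List.sum_cons, h3, List.length_cons, add_comm]
      exact (Finset.sum_range_succ' (fun k => f (k.casesOn m N)) (L.length + 1)).symm
    · cases k with
      | zero =>
        change (N 0).dart.fst = m.dart.snd ∧ Linked z σ G m.dart.snd (Γ.src m.dart) m.vec m.covec
          (Γ.src (N 0).dart) (N 0).vec (N 0).covec
        rw [h0]
        exact ⟨hmn, hl⟩
      | succ k => exact h4 k (by simpa using hk)

end Sequences

/-- Some vertex belongs to exactly one of the edges `z s`. -/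
theorem exists_leaf {S : Type*} [Finite S] [Nonempty S] (z : S → Γ.Edge) :
    ∃ (o : V) (s : S), o ∈ (z s).1 ∧ ∀ s', o ∈ (z s').1 → z s' = z s := by
  obtain ⟨c⟩ := Γ.isTree.connected.nonempty
  let P := {q : V × S // q.1 ∈ (z q.2).1}
  have : Nonempty P := by
    obtain ⟨s⟩ := ‹Nonempty S›
    obtain ⟨d, hd⟩ := exists_dart (z s)
    exact ⟨⟨(d.fst, s), hd ▸ fst_mem_src d⟩⟩
  obtain ⟨⟨⟨o, s⟩, hos⟩, hmax⟩ := Finite.exists_max fun q : P => Γ.graph.dist c q.1.1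
  refine ⟨o, s, hos, fun s' hs' => ?_⟩
  have parent (s' : S) (hs' : o ∈ (z s').1) :
      Γ.graph.dist c o = Γ.graph.dist c (half o (z s')).snd + 1 := by
    have hadj := (half o (z s')).adj
    rw [half_fst hs'] at hadj
    rcases Γ.isTree.dist_eq_dist_add_one_of_adj c hadj with h | h
    · exact h
    · have hm := snd_mem_src (half o (z s'))
      rw [src_half] at hm
      have := hmax ⟨((half o (z s')).snd, s'), hm⟩
      dsimp only at this
      omega
  have adj (s' : S) (hs' : o ∈ (z s').1) : Γ.graph.Adj (half o (z s')).snd o := by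
    have hadj := (half o (z s')).adj.symm
    rwa [half_fst hs'] at hadj
  have e := eq_of_adj_of_dist (adj s' hs') (adj s hos) (parent s' hs') (parent s hos)
  refine eq_of_mem_of_mem (adj s hos).ne ?_ hs' ?_ hos
  · have := snd_mem_src (half o (z s'))
    rwa [src_half, e] at this
  · have := snd_mem_src (half o (z s))
    rwa [src_half] at this

namespace MinPresentation

variable {M : ModuleCat.{max u v} (Γ.Alg K)} (T : Γ.MinPresentation K M)

/-- The indices of the indecomposable summands of both terms. -/
abbrev Idx : Type := Fin T.rank₀ ⊕ Fin T.rank₁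

/-- The marked edges. -/
def mark : T.Idx → Γ.Edge := Sum.elim T.index₀ T.index₁

/-- The edge is a source. -/
def IsSource (x : Γ.Edge) : Prop := x ∈ Set.range T.index₀

/-- The differential as a square matrix. -/
def diff : T.Idx → T.Idx → Γ.Alg K
  | .inl i, .inr j => entry T.map i j
  | _, _ => 0

variable {T}

theorem isSource_inl (i : Fin T.rank₀) : T.IsSource (T.mark (.inl i)) := ⟨i, rfl⟩

theorem not_isSource_inr (hT : T.NoExt T) (j : Fin T.rank₁) : ¬ T.IsSource (T.mark (.inr j)) :=
  fun ⟨i, hi⟩ => T.index₀_ne_index₁ hT i j hi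

theorem exists_isCoeff (hT : T.NoExt T) : ∃ G, IsCoeff T.mark T.IsSource G T.diff := by
  have key (w : V) (s s' : T.Idx) : ∃ c : K,
      (c ≠ 0 → w ∈ (T.mark s).1 ∧ w ∈ (T.mark s').1 ∧ T.IsSource (T.mark s) ∧
        ¬ T.IsSource (T.mark s')) ∧
      (w ∈ (T.mark s).1 → w ∈ (T.mark s').1 →
        T.diff s s' = c • qpath K w (T.mark s) (T.mark s')) := by
    by_cases hw : w ∈ (T.mark s).1 ∧ w ∈ (T.mark s').1
    swap
    · exact ⟨0, fun h => absurd rfl h, fun h h' => absurd ⟨h, h'⟩ hw⟩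
    obtain ⟨h, h'⟩ := hw
    match s, s' with
    | .inl i, .inr j =>
      have : entry T.map i j ∈ peirce K (T.mark (.inl i)) (T.mark (.inr j)) := entry_mem T.map i j
      rw [peirce_eq_span_qpath h h' (T.index₀_ne_index₁ hT i j), Submodule.mem_span_singleton]
        at this
      obtain ⟨c, hc⟩ := this
      exact ⟨c, fun _ => ⟨h, h', isSource_inl i, not_isSource_inr hT j⟩, fun _ _ => hc.symm⟩
    | .inl i, .inl i' => exact ⟨0, fun h => absurd rfl h, fun _ _ => by rw [zero_smul]; rfl⟩
    | .inr i, .inl i' => exact ⟨0, fun h => absurd rfl h, fun _ _ => by rw [zero_smul]; rfl⟩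
    | .inr i, .inr i' => exact ⟨0, fun h => absurd rfl h, fun _ _ => by rw [zero_smul]; rfl⟩
  choose G hG hG' using key
  refine ⟨G, hG, hG', fun s s' h => ?_⟩
  match s, s' with
  | .inl i, .inr j =>
    have : entry T.map i j ∈ peirce K (T.mark (.inl i)) (T.mark (.inr j)) := entry_mem T.map i j
    rwa [peirce_eq_bot h, Submodule.mem_bot] at this
  | .inl i, .inl i' => rfl
  | .inr i, .inl i' => rfl
  | .inr i, .inr i' => rfl

end MinPresentation

/-- The action of an endomorphism of a sum of projective modules on the top. -/
theorem chr_ofEntry {I : Type*} [Fintype I] [DecidableEq I] {x : I → Γ.Edge}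
    (ε : I → I → Γ.Alg K) (hε : ∀ i j, ε i j ∈ peirce K (x i) (x j)) (p : ProjSum K x) (j : I) :
    chr K (x j) (ofEntry ε hε p j) = ∑ i, chr K (x j) (p i) * chr K (x j) (ε i j) := by
  rw [ofEntry_apply, map_sum]
  exact Finset.sum_congr rfl fun i _ => map_mul _ _ _

/-- An endomorphism whose top is a projector onto a line has a fixed vector in the top. -/
theorem chr_ofEntry_pow {I : Type*} [Fintype I] [DecidableEq I] {x : I → Γ.Edge}
    (ε : I → I → Γ.Alg K) (hε : ∀ i j, ε i j ∈ peirce K (x i) (x j)) {X : Γ.Edge} {c u : I → K}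
    (hcu : ∀ i j, x i = X → x j = X → chr K X (ε i j) = c i * u j) (hu : ∀ i, x i ≠ X → u i = 0)
    (h1 : ∑ i, c i * u i = 1) :
    ∃ p : ProjSum K x, ∃ j, x j = X ∧ ∀ n, chr K (x j) (((ofEntry ε hε) ^ n) p j) ≠ 0 := by
  let p : ProjSum K x := fun i => ⟨u i • Γ.idem K (x i), mem_proj.2 (by
    rw [smul_mul_assoc, idem_mul_self])⟩
  obtain ⟨j, hj⟩ : ∃ j, u j ≠ 0 := by
    by_contra hh
    push Not at hh
    simp [hh] at h1
  have hjX : x j = X := by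
    by_contra hne
    exact hj (hu j hne)
  have key (n : ℕ) : ∀ i, x i = X → chr K (x i) (((ofEntry ε hε) ^ n) p i) = u i := by
    induction n with
    | zero =>
      intro i _
      change chr K (x i) (u i • Γ.idem K (x i)) = u i
      rw [map_smul, chr_idem_self, smul_eq_mul, mul_one]
    | succ n ih =>
      intro i hi
      rw [pow_succ', Module.End.mul_apply, chr_ofEntry]
      calc _ = ∑ k, (c k * u k) * u i := by
            refine Finset.sum_congr rfl fun k _ => ?_
            by_cases hk : x k = X
            · have aux (a : Γ.Alg K) : chr K X a = chr K (x k) a := by rw [hk]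
              rw [hi, hcu k i hk hi, aux, ih k hk]
              ring
            · rw [hu k hk, chr_eq_zero_of_peirce_left (hε k i) (by rw [hi]; exact Ne.symm hk)]
              ring
        _ = u i := by rw [← Finset.sum_mul, h1, one_mul]
  exact ⟨p, j, hjX, fun n => by rw [key n j hjX]; exact hj⟩

end BrauerTree

end

set_option linter.unusedSectionVars false

noncomputable section

namespace BrauerTree

open LocalStep

variable {V : Type v} {Γ : BrauerTree V} {K : Type u} [Field K] [Finite V]

section Distinct

variable {S : Type*} [Fintype S] {z : S → Γ.Edge} {o : V} {N : ℕ → Node Γ K S} {r : ℕ}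

theorem dist_fst_of_seq (hgood : ∀ k < r, (N k).IsGood z o)
    (hnext : ∀ k, k + 1 < r → (N (k + 1)).dart.fst = (N k).dart.snd) {k : ℕ} (hk : k < r) :
    Γ.graph.dist o (N k).dart.fst = Γ.graph.dist o (N 0).dart.fst + k := by
  induction k with
  | zero => rfl
  | succ k ih => rw [hnext k hk, (hgood k (by omega)).dist_eq, ih (by omega), add_assoc]

theorem eq_of_src_eq (hgood : ∀ k < r, (N k).IsGood z o)
    (hnext : ∀ k, k + 1 < r → (N (k + 1)).dart.fst = (N k).dart.snd) {k l : ℕ} (hk : k < r)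
    (hl : l < r) (h : Γ.src (N k).dart = Γ.src (N l).dart) : k = l := by
  have h1 := dist_fst_of_seq hgood hnext hk
  have h2 := dist_fst_of_seq hgood hnext hl
  have h3 := (hgood k hk).dist_eq
  have h4 := (hgood l hl).dist_eq
  rcases src_eq_iff.1 h with e | e
  · rw [e] at h1; omega
  · rw [e] at h1 h3
    change Γ.graph.dist o (N l).dart.snd = _ at h1
    change Γ.graph.dist o (N l).dart.fst = Γ.graph.dist o (N l).dart.snd + 1 at h3
    omega

end Distinct

namespace MinPresentation

variable {M : ModuleCat.{max u v} (Γ.Alg K)} {T : Γ.MinPresentation K M}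

open scoped Classical in
/-- An endomorphism of the complex given by matrices. -/
theorem exists_top_section (hT : T.NoExt T) (hM : Indecomposable M)
    (ε : T.Idx → T.Idx → Γ.Alg K) (hε : ∀ s s', ε s s' ∈ peirce K (T.mark s) (T.mark s'))
    (hcomm : ∀ s s', ∑ r, ε s r * T.diff r s' = ∑ r, T.diff s r * ε r s')
    {X : Γ.Edge} {c u : T.Idx → K}
    (hcu : ∀ s s', T.mark s = X → T.mark s' = X → chr K X (ε s s') = c s * u s')
    (hu : ∀ s, T.mark s ≠ X → u s = 0) (h1 : ∑ s, c s * u s = 1)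
    (hX : T.IsSource X → ∀ s s', ¬ T.IsSource (T.mark s') → ε s s' = 0) (s₀ : T.Idx) :
    ∃ q : T.Idx → K, ∀ s', T.mark s' = T.mark s₀ →
      ∑ s, q s * chr K (T.mark s₀) (ε s s') = if s' = s₀ then 1 else 0 := by
  have hε₀ (i i' : Fin T.rank₀) : ε (.inl i) (.inl i') ∈ peirce K (T.index₀ i) (T.index₀ i') :=
    hε (.inl i) (.inl i')
  have hε₁ (i i' : Fin T.rank₁) : ε (.inr i) (.inr i') ∈ peirce K (T.index₁ i) (T.index₁ i') :=
    hε (.inr i) (.inr i')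
  set a : ProjSum K T.index₀ →ₗ[Γ.Alg K] ProjSum K T.index₀ :=
    ofEntry (fun i i' => ε (.inl i) (.inl i')) hε₀ with ha
  set b : ProjSum K T.index₁ →ₗ[Γ.Alg K] ProjSum K T.index₁ :=
    ofEntry (fun i i' => ε (.inr i) (.inr i')) hε₁ with hb
  have hab : T.map ∘ₗ a = b ∘ₗ T.map := by
    refine ext_entry fun i j => ?_
    rw [entry_comp, entry_comp]
    have := hcomm (.inl i) (.inr j)
    simp only [Fintype.sum_sum_type, diff, mul_zero, zero_mul, Finset.sum_const_zero, add_zero,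
      zero_add] at this
    simpa only [ha, hb, entry_ofEntry] using this
  have hsurj : Function.Surjective a ∧ Function.Surjective b := by
    refine T.surjective_of_indecomposable hM a b hab ?_
    rw [Fintype.sum_sum_type] at h1
    by_cases hXs : T.IsSource X
    · right
      have hb0 : b = 0 := by
        refine ext_entry fun i j => ?_
        rw [hb, entry_ofEntry, hX hXs _ _ (not_isSource_inr hT j)]
        rfl
      obtain ⟨p, i, -, hp⟩ := chr_ofEntry_pow (x := T.index₀) (fun i i' => ε (.inl i) (.inl i'))
        hε₀ (X := X) (c := fun i => c (.inl i))
        (u := fun i => u (.inl i)) (fun i j hi hj => hcu _ _ hi hj) (fun i hi => hu (.inl i) hi) (by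
          rw [← h1]
          refine (add_eq_left.2 (Finset.sum_eq_zero fun j _ => ?_)).symm
          rw [hu (.inr j) fun h => not_isSource_inr hT j (h ▸ hXs), mul_zero])
      exact ⟨hb0, p, i, by simpa using hp 1⟩
    · left
      obtain ⟨p, j, -, hp⟩ := chr_ofEntry_pow (x := T.index₁) (fun i i' => ε (.inr i) (.inr i'))
        hε₁ (X := X) (c := fun i => c (.inr i))
        (u := fun i => u (.inr i)) (fun i j hi hj => hcu _ _ hi hj) (fun i hi => hu (.inr i) hi) (by
          rw [← h1]
          refine (add_eq_right.2 (Finset.sum_eq_zero fun i _ => ?_)).symm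
          rw [hu (.inl i) fun h => hXs (h ▸ isSource_inl i), mul_zero])
      exact ⟨p, j, hp⟩
  match s₀ with
  | .inl i =>
    obtain ⟨p, hp⟩ := hsurj.1 (gen T.index₀ i)
    refine ⟨Sum.elim (fun i' => chr K (T.index₀ i) (p i')) 0, fun s' hs' => ?_⟩
    match s' with
    | .inr j => exact absurd hs'.symm (T.index₀_ne_index₁ hT i j)
    | .inl i' =>
      have e := chr_ofEntry (x := T.index₀) (fun i i' => ε (.inl i) (.inl i'))
        hε₀ p i'
      rw [← ha, hp] at e
      have hs' : T.index₀ i' = T.index₀ i := hs'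
      rw [Fintype.sum_sum_type]
      simp only [Sum.elim_inl, Sum.elim_inr, Pi.zero_apply, zero_mul, Finset.sum_const_zero,
        add_zero, mark, Sum.inl.injEq]
      simp only [hs'] at e
      rw [← e]
      by_cases h : i' = i
      · subst h
        rw [gen_self, chr_idem_self, if_pos rfl]
      · rw [gen_of_ne _ h, map_zero, if_neg h]
  | .inr i =>
    obtain ⟨p, hp⟩ := hsurj.2 (gen T.index₁ i)
    refine ⟨Sum.elim 0 (fun i' => chr K (T.index₁ i) (p i')), fun s' hs' => ?_⟩
    match s' with
    | .inl j => exact absurd hs' (T.index₀_ne_index₁ hT j i)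
    | .inr i' =>
      have e := chr_ofEntry (x := T.index₁) (fun i i' => ε (.inr i) (.inr i'))
        hε₁ p i'
      rw [← hb, hp] at e
      have hs' : T.index₁ i' = T.index₁ i := hs'
      rw [Fintype.sum_sum_type]
      simp only [Sum.elim_inl, Sum.elim_inr, Pi.zero_apply, zero_mul, Finset.sum_const_zero,
        zero_add, mark, Sum.inr.injEq]
      simp only [hs'] at e
      rw [← e]
      by_cases h : i' = i
      · subst h
        rw [gen_self, chr_idem_self, if_pos rfl]
      · rw [gen_of_ne _ h, map_zero, if_neg h]

theorem rank₁_pos (hM : Indecomposable M) : 0 < T.rank₁ := by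
  rw [Nat.pos_iff_ne_zero]
  intro h
  refine hM.1 ?_
  have : IsEmpty (Fin T.rank₁) := by rw [h]; infer_instance
  have : Subsingleton M := T.cover_surjective.subsingleton
  exact ModuleCat.isZero_of_subsingleton M

theorem rank₀_pos (hP : ¬ Module.Projective (Γ.Alg K) M) : 0 < T.rank₀ := by
  rw [Nat.pos_iff_ne_zero]
  intro h
  refine hP ?_
  have : IsEmpty (Fin T.rank₀) := by rw [h]; infer_instance
  have hinj : Function.Injective T.cover := by
    rw [← LinearMap.ker_eq_bot, eq_bot_iff]
    intro p hp
    obtain ⟨q, rfl⟩ := (T.exact p).1 hp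
    rw [Subsingleton.elim q 0, map_zero]
    exact Submodule.zero_mem _
  exact Module.Projective.of_equiv
    (LinearEquiv.ofBijective T.cover ⟨hinj, T.cover_surjective⟩)

/-- The complex is given by a zigzag along a geodesic of the tree: the marked edges are the edges
`e k` of the geodesic `v 0, …, v r`, each of them once, and they are alternately sources and
sinks. -/
structure IsZigzag (T : Γ.MinPresentation K M) (r : ℕ) (v : ℕ → V) (e : ℕ → Γ.Edge) : Prop where
  two_le : 2 ≤ r
  dist_eq : ∀ j k, j ≤ k → k ≤ r → Γ.graph.dist (v j) (v k) = k - j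
  mem_left : ∀ k < r, v k ∈ (e k).1
  mem_right : ∀ k < r, v (k + 1) ∈ (e k).1
  injective : Function.Injective T.mark
  exists_mark : ∀ k < r, ∃ s, T.mark s = e k
  exists_eq : ∀ s, ∃ k < r, T.mark s = e k
  alternating : ∀ k, k + 1 < r → (T.IsSource (e k) ↔ ¬ T.IsSource (e (k + 1)))
  diff_ne_zero : ∀ k, k + 1 < r → ∀ s s', T.mark s = e k → T.mark s' = e (k + 1) →
    T.diff s s' ≠ 0 ∨ T.diff s' s ≠ 0

theorem exists_isZigzag (hT : T.NoExt T) (hM : Indecomposable M)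
    (hP : ¬ Module.Projective (Γ.Alg K) M) : ∃ r v e, T.IsZigzag r v e := by
  classical
  obtain ⟨G, hG⟩ := exists_isCoeff hT
  have i₀ : Fin T.rank₀ := ⟨0, rank₀_pos hP⟩
  have j₀ : Fin T.rank₁ := ⟨0, rank₁_pos hM⟩
  have : Nonempty T.Idx := ⟨.inr j₀⟩
  obtain ⟨o, s₀, ho, huniq⟩ := exists_leaf T.mark
  set d := half o (T.mark s₀) with hd
  have hdo : d.fst = o := half_fst ho
  have hdist : Γ.graph.dist o d.snd = Γ.graph.dist o d.fst + 1 := by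
    rw [hdo, SimpleGraph.dist_self, zero_add, SimpleGraph.dist_eq_one_iff_adj]
    have := d.adj
    rwa [hdo] at this
  let Y : Submodule K (T.Idx → K) :=
    { carrier := {u | ∀ s, T.mark s ≠ Γ.src d → u s = 0}
      add_mem' := fun {u u'} hu hu' s hs => by rw [Pi.add_apply, hu s hs, hu' s hs, add_zero]
      zero_mem' := fun s _ => rfl
      smul_mem' := fun c u hu s hs => by rw [Pi.smul_apply, hu s hs, smul_zero] }
  have hY : (⊥ : Submodule K (T.Idx → K)) < Y := by
    rw [bot_lt_iff_ne_bot, Ne, Submodule.eq_bot_iff]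
    intro h
    have := congrFun (h (Pi.single s₀ 1) (by
      intro s hs
      refine Pi.single_eq_of_ne (fun e => hs ?_) _
      rw [e, hd, src_half])) s₀
    simp at this
  obtain ⟨n, L, hn, hnd, -, -⟩ := exists_isString (o := o) hG hdist hY (fun u hu => hu)
  obtain ⟨t', e', ε, h1, h2, h3, h4, h5⟩ := hn.exists_endo hG n.vec n.covec (fun _ _ => rfl)
    (fun _ _ => rfl)
  obtain ⟨N, hN0, hNmem, hN, hNsum, hNlink⟩ := hn.exists_seq
  set r := L.length + 1 with hr
  have hgood (k : ℕ) (hk : k < r) : (N k).IsGood T.mark o := (hN k (by omega)).2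
  have hnext (k : ℕ) (hk : k + 1 < r) : (N (k + 1)).dart.fst = (N k).dart.snd :=
    (hNlink k (by omega)).1
  have hfst : n.dart.fst = o := by rw [hnd, hdo]
  have hloc (s s' : T.Idx) : locMap T.mark G n.dart.fst s s' = 0 := by
    refine locMap_of_not hG ?_
    rintro ⟨k1, k2, k3, k4⟩
    rw [hfst] at k1 k2
    rw [huniq s k1] at k3
    rw [huniq s' k2] at k4
    exact k4 k3
  have hcomm (s s' : T.Idx) : ∑ q, ε s q * T.diff q s' = ∑ q, T.diff s q * ε q s' := by
    rw [← sub_eq_zero]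
    by_cases hσ : T.IsSource (Γ.src n.dart)
    · rw [h4 hσ, Finset.sum_eq_zero fun q _ => by rw [hloc, mul_zero], mul_zero]
    · rw [h5 hσ, Finset.sum_eq_zero fun q _ => by rw [hloc, zero_mul], zero_mul, neg_zero]
  have hchr (k : ℕ) (hk : k < r) (s s' : T.Idx) (hs : T.mark s = Γ.src (N k).dart)
      (hs' : T.mark s' = Γ.src (N k).dart) :
      chr K (Γ.src (N k).dart) (ε s s') = (N k).covec s * (N k).vec s' := by
    have := h2 s s' (hs.trans hs'.symm)
    rw [hNsum, Finset.sum_eq_single k] at this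
    · rwa [if_pos hs, hs] at this
    · intro l hl hlk
      exact if_neg fun h => hlk (eq_of_src_eq hgood hnext (Finset.mem_range.1 hl) hk
        (h.symm.trans hs))
    · exact fun h => absurd (Finset.mem_range.2 hk) h
  have hchr0 (s s' : T.Idx) (hs : T.mark s = T.mark s')
      (hne : ∀ k < r, T.mark s ≠ Γ.src (N k).dart) : chr K (T.mark s) (ε s s') = 0 := by
    rw [h2 s s' hs, hNsum]
    exact Finset.sum_eq_zero fun k hk => if_neg (hne k (Finset.mem_range.1 hk))
  have hsec : ∀ s₀ : T.Idx, ∃ q : T.Idx → K, ∀ s', T.mark s' = T.mark s₀ →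
      ∑ s, q s * chr K (T.mark s₀) (ε s s') = if s' = s₀ then 1 else 0 := by
    by_cases hall : ∀ k < r, T.IsSource (Γ.src (N k).dart)
    · exact exists_top_section hT hM ε h1 hcomm (hchr 0 (by omega))
        (hgood 0 (by omega)).vec_eq_zero (hgood 0 (by omega)).pair_eq_one
        (fun _ s s' hs' => h3 s s' fun m hm hiff => by
          obtain ⟨k, hk, rfl⟩ := hNmem m hm
          exact hs' (hiff.2 (hall k (by omega))))
    · push Not at hall
      obtain ⟨k, hk, hσ⟩ := hall
      exact exists_top_section hT hM ε h1 hcomm (hchr k hk) (hgood k hk).vec_eq_zero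
        (hgood k hk).pair_eq_one (fun h => absurd h hσ)
  have hzero (s s' : T.Idx) (h : T.mark s' ≠ T.mark s) : chr K (T.mark s') (ε s s') = 0 :=
    chr_eq_zero_of_peirce_left (h1 s s') h
  have hexists (s : T.Idx) : ∃ k < r, T.mark s = Γ.src (N k).dart := by
    by_contra hne
    push Not at hne
    obtain ⟨q, hq⟩ := hsec s
    have := hq s rfl
    rw [if_pos rfl, Finset.sum_eq_zero] at this
    · exact zero_ne_one this
    · intro s' _
      by_cases h : T.mark s' = T.mark s
      · rw [← h, hchr0 s' s h (by rw [h]; exact hne), mul_zero]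
      · rw [hzero s' s (Ne.symm h), mul_zero]
  have hline (s : T.Idx) (k : ℕ) (hk : k < r) (hs : T.mark s = Γ.src (N k).dart) :
      ∃ c : K, ∀ s', T.mark s' = T.mark s → c * (N k).vec s' = if s' = s then 1 else 0 := by
    obtain ⟨q, hq⟩ := hsec s
    refine ⟨∑ s'', q s'' * if T.mark s'' = T.mark s then (N k).covec s'' else 0, fun s' hs' => ?_⟩
    rw [← hq s' hs', Finset.sum_mul]
    refine Finset.sum_congr rfl fun s'' _ => ?_
    by_cases h : T.mark s'' = T.mark s
    · rw [if_pos h, hs, hchr k hk s'' s' (h.trans hs) (hs'.trans hs), mul_assoc]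
    · rw [if_neg h, mul_zero, zero_mul, ← hs', hzero s'' s' fun h' => h (h'.symm.trans hs'),
        mul_zero]
  have hinj : Function.Injective T.mark := by
    intro s s' hss
    by_contra hne
    obtain ⟨k, hk, hs⟩ := hexists s
    obtain ⟨c, hc⟩ := hline s k hk hs
    obtain ⟨c', hc'⟩ := hline s' k hk (hss ▸ hs)
    have e1 := hc s rfl
    have e2 := hc s' hss.symm
    have e3 := hc' s' rfl
    rw [if_pos rfl] at e1 e3
    rw [if_neg (Ne.symm hne)] at e2
    rcases mul_eq_zero.1 e2 with h | h
    · rw [h, zero_mul] at e1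
      exact zero_ne_one e1
    · rw [h, mul_zero] at e3
      exact zero_ne_one e3
  have hvec (k : ℕ) (hk : k < r) : ∃ s, T.mark s = Γ.src (N k).dart ∧ (N k).vec s ≠ 0 := by
    by_contra hne
    push Not at hne
    have := (hgood k hk).pair_eq_one
    rw [LocalStep.pair, Finset.sum_eq_zero] at this
    · exact zero_ne_one this
    · intro s _
      by_cases h : T.mark s = Γ.src (N k).dart
      · rw [hne s h, mul_zero]
      · rw [(hgood k hk).vec_eq_zero s h, mul_zero]
  have hvec' (k : ℕ) (hk : k < r) (s : T.Idx) (hs : T.mark s = Γ.src (N k).dart) :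
      (N k).vec s ≠ 0 := by
    obtain ⟨s', hs', h⟩ := hvec k hk
    rwa [hinj (hs.trans hs'.symm)]
  have htwo : 2 ≤ r := by
    by_contra hlt
    obtain ⟨k, hk, e⟩ := hexists (.inl i₀)
    obtain ⟨l, hl, e'⟩ := hexists (.inr j₀)
    obtain rfl : k = l := by omega
    exact T.index₀_ne_index₁ hT i₀ j₀ (e.trans e'.symm)
  let v : ℕ → V := fun k => k.casesOn o fun k => (N k).dart.snd
  have hv (k : ℕ) (hk : k < r) : v k = (N k).dart.fst := by
    cases k with
    | zero =>
      change o = (N 0).dart.fst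
      rw [hN0, hfst]
    | succ k => exact (hnext k hk).symm
  have hvo (k : ℕ) (hk : k ≤ r) : Γ.graph.dist o (v k) = k := by
    have h0 : Γ.graph.dist o (N 0).dart.fst = 0 := by rw [hN0, hfst, SimpleGraph.dist_self]
    cases k with
    | zero => exact SimpleGraph.dist_self
    | succ k =>
      change Γ.graph.dist o (N k).dart.snd = k + 1
      rw [(hgood k (by omega)).dist_eq, dist_fst_of_seq hgood hnext (by omega), h0, zero_add]
  have hle (j m : ℕ) (hm : j + m ≤ r) : Γ.graph.dist (v j) (v (j + m)) ≤ m := by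
    induction m with
    | zero => exact (SimpleGraph.dist_self).le
    | succ m ih =>
      have h1 := Γ.isTree.connected.dist_triangle (u := v j) (v := v (j + m)) (w := v (j + m + 1))
      have h2 : Γ.graph.dist (v (j + m)) (v (j + m + 1)) = 1 := by
        rw [SimpleGraph.dist_eq_one_iff_adj, hv (j + m) (by omega)]
        exact (N (j + m)).dart.adj
      have h3 := ih (by omega)
      rw [← add_assoc]
      omega
  have hmem (k : ℕ) (hk : k + 1 < r) (s : T.Idx) (hs : (N k).dart.snd ∈ (T.mark s).1) :
      T.mark s = Γ.src (N k).dart ∨ T.mark s = Γ.src (N (k + 1)).dart := by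
    obtain ⟨l, hl, e⟩ := hexists s
    rw [e, mem_src_iff] at hs
    have h1 := hvo (k + 1) hk.le
    change Γ.graph.dist o (N k).dart.snd = k + 1 at h1
    rcases hs with hs | hs
    · rw [hs, ← hv l hl, hvo l hl.le] at h1
      rw [e, h1]
      exact .inr rfl
    · have h2 := hvo (l + 1) hl
      change Γ.graph.dist o (N l).dart.snd = l + 1 at h2
      rw [hs, h2] at h1
      rw [e, show l = k by omega]
      exact .inl rfl
  have hlink (w : V) (X Z : Γ.Edge) (u c u' c' : T.Idx → K) (hX : w ∈ X.1) (hZ : w ∈ Z.1)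
      (hσ : ¬ T.IsSource Z) (hw : ∀ s, w ∈ (T.mark s).1 → T.mark s = X ∨ T.mark s = Z)
      (hl : LinkAt T.mark T.IsSource G w X u c Z u' c') (s s' : T.Idx) (hs : T.mark s = X)
      (hs' : T.mark s' = Z) (hu : u' s' ≠ 0) : T.diff s s' ≠ 0 := by
    obtain ⟨t, τ, η, e, -, -, hτ, -, hrow, -⟩ := hl
    have h1 := hrow s'
    rw [row_of_eq hZ τ hs', mul_smul_comm, qpath_mul_idem hX hZ, hτ s' hs'] at h1
    have h2 : u' s' • qpath K w X Z ≠ 0 := smul_ne_zero hu (qpath_ne_zero K hX hZ)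
    rw [← h1] at h2
    obtain ⟨s'', -, h3⟩ := Finset.exists_ne_zero_of_sum_ne_zero h2
    have h4 := right_ne_zero_of_mul h3
    have h5 : w ∈ (T.mark s'').1 ∧ w ∈ (T.mark s').1 ∧ T.IsSource (T.mark s'') ∧
        ¬ T.IsSource (T.mark s') := by
      by_contra h; exact h4 (locMap_of_not hG h)
    rw [locMap_eq hG h5.1 h5.2.1] at h4
    rcases hw s'' h5.1 with h | h
    · rwa [hinj (h.trans hs.symm)] at h4
    · exact absurd (h ▸ h5.2.2.1) hσ
  refine ⟨r, v, fun k => Γ.src (N k).dart, htwo, fun j k hjk hk => ?_, fun k hk => ?_,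
    fun k hk => snd_mem_src _, hinj, fun k hk => ?_, hexists, fun k hk => ?_,
    fun k hk s s' hs hs' => ?_⟩
  · have h1 := hle j (k - j) (by omega)
    rw [show j + (k - j) = k by omega] at h1
    have h2 := Γ.isTree.connected.dist_triangle (u := o) (v := v j) (w := v k)
    rw [hvo j (by omega), hvo k hk] at h2
    omega
  · rw [hv k hk]
    exact fst_mem_src _
  · obtain ⟨s, hs, -⟩ := hvec k hk
    exact ⟨s, hs⟩
  · rcases (hNlink k (by omega)).2 with ⟨h, h', -⟩ | ⟨h, h', -⟩
    · exact iff_of_true h h'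
    · exact iff_of_false h (not_not.2 h')
  · have hm : (N k).dart.snd ∈ (Γ.src (N (k + 1)).dart).1 := hnext k hk ▸ fst_mem_src _
    rcases (hNlink k (by omega)).2 with ⟨h, h', hl⟩ | ⟨h, h', hl⟩
    · exact .inl (hlink _ _ _ _ _ _ _ (snd_mem_src _) hm h' (hmem k hk) hl s s' hs hs'
        (hvec' _ hk s' hs'))
    · exact .inr (hlink _ _ _ _ _ _ _ hm (snd_mem_src _) h (fun s hs => (hmem k hk s hs).symm) hl
        s' s hs' hs (hvec' _ (by omega) s hs))

end MinPresentation

end BrauerTree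

end

set_option linter.unusedSectionVars false

noncomputable section

namespace BrauerTree

variable {V : Type v} {Γ : BrauerTree V} {K : Type u} [Field K] [Finite V]

/-! ### The cycles of the algebra -/

/-- The sequence of `m` arrows around a vertex that starts with `d`. -/
def run (d : Γ.Arrow) (m : ℕ) : List Γ.Arrow := (List.range m).map fun k => Γ.next^[k] d

@[simp] theorem length_run (d : Γ.Arrow) (m : ℕ) : (run d m).length = m := by simp [run]

theorem mem_run {d a : Γ.Arrow} {m : ℕ} : a ∈ run d m ↔ ∃ k < m, Γ.next^[k] d = a := by
  simp [run, eq_comm]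

theorem getElem_run (d : Γ.Arrow) {m k : ℕ} (h : k < (run d m).length) :
    (run d m)[k] = Γ.next^[k] d := by simp [run]

theorem nodup_run {d : Γ.Arrow} {m : ℕ} (h : m ≤ Γ.period d) : (run d m).Nodup := by
  refine List.Nodup.map_on (fun k hk l hl e => ?_) List.nodup_range
  rw [List.mem_range] at hk hl
  exact Function.iterate_injOn_Iio_minimalPeriod (hk.trans_le h) (hl.trans_le h) e

theorem isArrowSequence_run {d : Γ.Arrow} {m : ℕ} (h0 : 0 < m) (h : m ≤ Γ.period d) :
    Γ.IsArrowSequence K (run d m) := by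
  refine ⟨fun e => ?_, nodup_run h, ?_⟩
  · have := congrArg List.length e
    simp at this
    omega
  · rw [List.isChain_iff_getElem]
    intro k hk
    rw [length_run] at hk
    rw [getElem_run, getElem_run, Function.iterate_succ_apply']
    have h2 : 2 ≤ Γ.period (Γ.next^[k] d) := by rw [period_iterate]; omega
    have := pth_ne_zero K h2
    rwa [pth_succ, pth_one] at this

theorem exists_run_of_isArrowSequence {C : List Γ.Arrow} (hC : Γ.IsArrowSequence K C) :
    ∃ d m, 0 < m ∧ m ≤ Γ.period d ∧ C = run d m := by
  obtain ⟨h1, h2, h3⟩ := hC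
  have hpos : 0 < C.length := List.length_pos_iff.2 h1
  rw [List.isChain_iff_getElem] at h3
  have key (k : ℕ) (hk : k < C.length) : C[k] = Γ.next^[k] C[0] := by
    induction k with
    | zero => rfl
    | succ k ih =>
      rw [Function.iterate_succ_apply', ← ih (by omega)]
      by_contra hne
      exact h3 k hk (Γ.arrow_mul_arrow_of_ne K hne)
  refine ⟨C[0], C.length, hpos, ?_, List.ext_getElem (by simp) fun k hk _ => ?_⟩
  · by_contra hlt
    push Not at hlt
    have := key _ hlt
    rw [iterate_period] at this
    have h4 := (List.Nodup.getElem_inj_iff h2).1 this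
    exact (period_pos C[0]).ne' h4
  · rw [key k hk, getElem_run]

theorem isACycle_run (d : Γ.Arrow) : Γ.IsACycle K (run d (Γ.period d)) := by
  refine ⟨isArrowSequence_run (period_pos d) le_rfl, fun C' hC' h => ?_⟩
  obtain ⟨d', m, -, hm, rfl⟩ := exists_run_of_isArrowSequence hC'
  refine (h.eq_of_length ?_).symm
  have h1 := h.length_le
  have h2 : d ∈ run d' m := h.subset (mem_run.2 ⟨0, period_pos d, rfl⟩)
  obtain ⟨k, -, rfl⟩ := mem_run.1 h2
  simp only [length_run, period_iterate] at h1 ⊢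
  omega

theorem vertices_run (d : Γ.Arrow) : Γ.vertices (run d (Γ.period d)) = {x | d.fst ∈ x.1} := by
  ext x
  constructor
  · rintro ⟨a, ha, h⟩
    obtain ⟨k, -, rfl⟩ := mem_run.1 ha
    have h1 : (Γ.next^[k] d).fst = d.fst := iterate_next_fst _ _
    rcases h with rfl | rfl
    · have := fst_mem_src (Γ.next^[k] d)
      rwa [h1] at this
    · have := fst_mem_src (Γ.next (Γ.next^[k] d))
      rwa [Γ.next_fst, h1] at this
  · intro hx
    obtain ⟨k, hk, e⟩ := exists_iterate_eq (d := d) (d' := half d.fst x) (half_fst hx).symm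
    exact ⟨half d.fst x, mem_run.2 ⟨k, hk, e⟩, .inl (src_half _ _).symm⟩

theorem exists_vertices_eq_of_isACycle {C : List Γ.Arrow} (hC : Γ.IsACycle K C) :
    ∃ w : V, Γ.vertices C = {x | w ∈ x.1} := by
  obtain ⟨d, m, h0, hm, rfl⟩ := exists_run_of_isArrowSequence hC.1
  have : run d (Γ.period d) = run d m := by
    refine hC.2 _ (isArrowSequence_run (period_pos d) le_rfl) (List.IsPrefix.isInfix ?_)
    rw [List.prefix_iff_eq_take]
    refine List.ext_getElem (by simpa using hm) fun k hk hk' => ?_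
    rw [getElem_run, List.getElem_take, getElem_run]
  exact ⟨d.fst, by rw [← this, vertices_run]⟩

theorem exists_isACycle {w : V} {x : Γ.Edge} (h : w ∈ x.1) :
    ∃ C, Γ.IsACycle K C ∧ Γ.vertices C = {x | w ∈ x.1} :=
  ⟨_, isACycle_run (half w x), by rw [vertices_run, half_fst h]⟩

end BrauerTree

end

set_option linter.unusedSectionVars false

noncomputable section

namespace BrauerTree

variable {V : Type v} {Γ : BrauerTree V} {K : Type u} [Field K] [Finite V]

namespace MinPresentation

variable {M : ModuleCat.{max u v} (Γ.Alg K)} {T : Γ.MinPresentation K M}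

theorem coe_component (i : Fin T.rank₀) (j : Fin T.rank₁) (p : Γ.proj K (T.index₀ i)) :
    (T.component i j p : Γ.Alg K) = p * entry T.map i j := by
  change (T.map (Pi.single i p) j : Γ.Alg K) = _
  rw [apply_eq_sum_entry, Finset.sum_eq_single i]
  · rw [Pi.single_eq_same]
  · intro i' _ hne
    rw [Pi.single_eq_of_ne hne, Submodule.coe_zero, zero_mul]
  · simp

theorem component_ne_zero_iff (i : Fin T.rank₀) (j : Fin T.rank₁) :
    T.component i j ≠ 0 ↔ entry T.map i j ≠ 0 := by
  rw [not_iff_not]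
  constructor
  · intro h
    have := coe_component i j ⟨Γ.idem K (T.index₀ i), mem_proj.2 (idem_mul_self _ _ _)⟩
    rw [h, (entry_mem T.map i j).1] at this
    exact this.symm
  · intro h
    refine LinearMap.ext fun p => Subtype.ext ?_
    rw [coe_component, h, mul_zero]
    rfl

namespace IsZigzag

variable {r : ℕ} {v : ℕ → V} {e : ℕ → Γ.Edge}

theorem v_inj (hz : T.IsZigzag r v e) {j k : ℕ} (hj : j ≤ r) (hk : k ≤ r)
    (h : v j = v k) : j = k := by
  rcases le_total j k with hjk | hjk
  · have := hz.dist_eq j k hjk hk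
    rw [h, SimpleGraph.dist_self] at this
    omega
  · have := hz.dist_eq k j hjk hj
    rw [h, SimpleGraph.dist_self] at this
    omega

theorem v_ne (hz : T.IsZigzag r v e) {k : ℕ} (hk : k < r) : v k ≠ v (k + 1) := fun h => by
  have := hz.v_inj hk.le hk h
  omega

theorem mem_iff (hz : T.IsZigzag r v e) {k : ℕ} (hk : k < r) {w : V} :
    w ∈ (e k).1 ↔ w = v k ∨ w = v (k + 1) := by
  rw [(Sym2.mem_and_mem_iff (hz.v_ne hk)).1 ⟨hz.mem_left k hk, hz.mem_right k hk⟩, Sym2.mem_iff]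

theorem v_mem_iff (hz : T.IsZigzag r v e) {j k : ℕ} (hj : j ≤ r) (hk : k < r) :
    v j ∈ (e k).1 ↔ j = k ∨ j = k + 1 := by
  rw [hz.mem_iff hk]
  constructor
  · rintro (h | h)
    · exact .inl (hz.v_inj hj hk.le h)
    · exact .inr (hz.v_inj hj hk h)
  · rintro (rfl | rfl)
    exacts [.inl rfl, .inr rfl]

theorem e_inj (hz : T.IsZigzag r v e) {j k : ℕ} (hj : j < r) (hk : k < r)
    (h : e j = e k) : j = k := by
  have h1 := (hz.v_mem_iff hj.le hk).1 (h ▸ hz.mem_left j hj)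
  have h2 := (hz.v_mem_iff hj hk).1 (h ▸ hz.mem_right j hj)
  omega

theorem exists_of_common (hz : T.IsZigzag r v e) {s s' : T.Idx} (hne : T.mark s ≠ T.mark s')
    {w : V} (hw : w ∈ (T.mark s).1) (hw' : w ∈ (T.mark s').1) :
    ∃ k, k + 1 < r ∧ w = v (k + 1) ∧ ((T.mark s = e k ∧ T.mark s' = e (k + 1)) ∨
      (T.mark s = e (k + 1) ∧ T.mark s' = e k)) := by
  obtain ⟨k, hk, h⟩ := hz.exists_eq s
  obtain ⟨l, hl, h'⟩ := hz.exists_eq s'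
  rw [h] at hw
  rw [h'] at hw'
  have hkl : k ≠ l := by
    rintro rfl
    exact hne (h.trans h'.symm)
  rcases (hz.mem_iff hk).1 hw with rfl | rfl
  · rcases (hz.v_mem_iff hk.le hl).1 hw' with rfl | rfl
    · exact absurd rfl hkl
    · exact ⟨l, hk, rfl, .inr ⟨h, h'⟩⟩
  · rcases (hz.v_mem_iff hk hl).1 hw' with rfl | h1
    · exact ⟨k, hl, rfl, .inl ⟨h, h'⟩⟩
    · omega

theorem reverse (hz : T.IsZigzag r v e) :
    T.IsZigzag r (fun k => v (r - k)) (fun k => e (r - 1 - k)) where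
  two_le := hz.two_le
  dist_eq j k hjk hk := by
    rw [SimpleGraph.dist_comm, hz.dist_eq _ _ (by omega) (by omega)]
    omega
  mem_left k hk := by
    have := hz.mem_right (r - 1 - k) (by omega)
    rwa [show r - 1 - k + 1 = r - k by omega] at this
  mem_right k hk := by
    have := hz.mem_left (r - 1 - k) (by omega)
    rwa [show r - 1 - k = r - (k + 1) by omega] at this ⊢
  injective := hz.injective
  exists_mark k hk := hz.exists_mark _ (by omega)
  exists_eq s := by
    obtain ⟨k, hk, h⟩ := hz.exists_eq s
    exact ⟨r - 1 - k, by omega, by rw [show r - 1 - (r - 1 - k) = k by omega, h]⟩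
  alternating k hk := by
    have := hz.alternating (r - 1 - (k + 1)) (by omega)
    rw [show r - 1 - (k + 1) + 1 = r - 1 - k by omega] at this
    exact ⟨fun h h' => this.1 h' h, fun h => by
      by_contra h'
      exact h (this.2 h')⟩
  diff_ne_zero k hk s s' hs hs' := by
    have := hz.diff_ne_zero (r - 1 - (k + 1)) (by omega) s' s hs'
    rw [show r - 1 - (k + 1) + 1 = r - 1 - k by omega] at this
    exact (this hs).symm

/-! ### The diagram -/

theorem exists_of_mem_diagramArrows (hz : T.IsZigzag r v e) (hT : T.NoExt T) {a : Γ.Arrow}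
    (ha : a ∈ T.diagramArrows) :
    ∃ k, k + 1 < r ∧ ∃ (x y : Γ.Edge) (d : Γ.Arrow) (m l : ℕ),
      ((x = e k ∧ y = e (k + 1)) ∨ (x = e (k + 1) ∧ y = e k)) ∧ T.IsSource x ∧ ¬ T.IsSource y ∧
      d.fst = v (k + 1) ∧ Γ.src d = x ∧ Γ.src (Γ.next^[m] d) = y ∧
      (∀ l, 0 < l → l < m → Γ.src (Γ.next^[l] d) ≠ y) ∧ l < m ∧ a = Γ.next^[l] d := by
  obtain ⟨i, j, -, d, m, h1, -, h3, h4, l, hl, rfl⟩ := ha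
  have hd : d.fst ∈ (T.index₀ i).1 := h1 ▸ fst_mem_src d
  have hd' : d.fst ∈ (T.index₁ j).1 := by
    have := fst_mem_src (Γ.next^[m] d)
    rwa [h3, iterate_next_fst] at this
  obtain ⟨k, hk, hw, h⟩ := hz.exists_of_common (s := .inl i) (s' := .inr j)
    (T.index₀_ne_index₁ hT i j) hd hd'
  exact ⟨k, hk, _, _, d, m, l, h, isSource_inl i, not_isSource_inr hT j, hw, h1, h3, h4, hl, rfl⟩

theorem mem_diagramArrows {w : V} {s s' : T.Idx} (hne : T.mark s ≠ T.mark s')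
    (hs : w ∈ (T.mark s).1) (hs' : w ∈ (T.mark s').1) (h : T.diff s s' ≠ 0) {l : ℕ}
    (hl : l < dpos w (T.mark s) (T.mark s')) :
    Γ.next^[l] (half w (T.mark s)) ∈ T.diagramArrows := by
  match s, s' with
  | .inl i, .inr j =>
    refine ⟨i, j, (component_ne_zero_iff i j).2 h, half w (T.mark (.inl i)),
      dpos w (T.mark (.inl i)) (T.mark (.inr j)), src_half _ _, dpos_pos hs hs' hne, ?_, ?_, l, hl,
      rfl⟩
    · rw [dpos, iterate_pos (half_fst_eq hs hs')]
      exact src_half _ _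
    · intro k _ hk e
      have : Γ.next^[k] (half w (T.mark (.inl i))) = half w (T.mark (.inr j)) := by
        have h1 := eq_half (d := Γ.next^[k] (half w (T.mark (.inl i)))) (w := w)
          (by rw [iterate_next_fst, half_fst hs])
        rw [e] at h1
        exact h1
      exact absurd (Nat.sInf_le (s := {n | Γ.next^[n] (half w (T.mark (.inl i))) =
        half w (T.mark (.inr j))}) this) (not_le.2 hk)
  | .inl i, .inl i' => exact absurd rfl h
  | .inr i, .inl i' => exact absurd rfl h
  | .inr i, .inr i' => exact absurd rfl h

theorem isEndPoint_zero (hz : T.IsZigzag r v e) (hT : T.NoExt T) : T.IsEndPoint (e 0) := by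
  have h2 := hz.two_le
  have h01 : e 0 ≠ e 1 := fun h => by
    have := hz.e_inj (by omega) (by omega) h
    omega
  have hv0 : v 1 ∈ (e 0).1 := hz.mem_right 0 (by omega)
  have hv1 : v 1 ∈ (e 1).1 := hz.mem_left 1 (by omega)
  obtain ⟨s, hs⟩ := hz.exists_mark 0 (by omega)
  obtain ⟨s', hs'⟩ := hz.exists_mark 1 (by omega)
  have hloc {a : Γ.Arrow} (ha : a ∈ T.diagramArrows) (h : e 0 = Γ.src a ∨ e 0 = Γ.tgt a) :
      ∃ (x y : Γ.Edge) (d : Γ.Arrow) (m l : ℕ),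
      ((x = e 0 ∧ y = e 1) ∨ (x = e 1 ∧ y = e 0)) ∧ T.IsSource x ∧ ¬ T.IsSource y ∧
      d.fst = v 1 ∧ Γ.src d = x ∧ Γ.src (Γ.next^[m] d) = y ∧
      (∀ l, 0 < l → l < m → Γ.src (Γ.next^[l] d) ≠ y) ∧ l < m ∧ a = Γ.next^[l] d ∧
      a.fst = v 1 := by
    obtain ⟨k, hk, x, y, d, m, l, k1, k2, k3, k4, k5, k6, k7, k8, rfl⟩ :=
      hz.exists_of_mem_diagramArrows hT ha
    have hf : (Γ.next^[l] d).fst = v (k + 1) := by rw [iterate_next_fst, k4]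
    have hm : v (k + 1) ∈ (e 0).1 := by
      rcases h with h | h
      · rw [h, ← hf]; exact fst_mem_src _
      · rw [h, ← hf, ← Γ.next_fst]; exact fst_mem_src _
    have := (hz.v_mem_iff hk.le (by omega)).1 hm
    obtain rfl : k = 0 := by omega
    exact ⟨x, y, d, m, l, k1, k2, k3, k4, k5, k6, k7, k8, rfl, hf⟩
  rcases hz.diff_ne_zero 0 (by omega) s s' hs hs' with hd | hd
  · have hsrc : T.IsSource (e 0) := by
      match s, s' with
      | .inl i, .inr j => rw [← hs]; exact isSource_inl i
      | .inl i, .inl i' => exact absurd rfl hd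
      | .inr i, .inl i' => exact absurd rfl hd
      | .inr i, .inr i' => exact absurd rfl hd
    refine Set.ncard_eq_one.2 ⟨half (v 1) (e 0), Set.eq_singleton_iff_unique_mem.2 ⟨⟨?_, ?_⟩, ?_⟩⟩
    · have := mem_diagramArrows (w := v 1) (s := s) (s' := s') (by rwa [hs, hs'])
        (by rwa [hs]) (by rwa [hs']) hd (l := 0) (by
          rw [hs, hs']
          exact dpos_pos hv0 hv1 h01)
      rwa [hs] at this
    · exact .inl (src_half _ _).symm
    · rintro a ⟨ha, h⟩
      obtain ⟨x, y, d, m, l, k1, k2, k3, k4, k5, k6, k7, k8, rfl, k9⟩ := hloc ha h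
      have hxy : x = e 0 ∧ y = e 1 := k1.resolve_right fun hh => k3 (hh.2 ▸ hsrc)
      rcases h with h | h
      · rw [eq_half k9, ← h]
      · exfalso
        have hnext : Γ.next^[l + 1] d = d := by
          refine eq_of_src_eq_of_fst_eq ?_ (iterate_next_fst _ _)
          rw [Function.iterate_succ_apply', k5, hxy.1, h]
          rfl
        rcases Nat.lt_or_ge (l + 1) m with hlt | hge
        · refine k7 (m - (l + 1)) (by omega) (by omega) ?_
          rw [← k6]
          conv_rhs => rw [show m = m - (l + 1) + (l + 1) by omega, Function.iterate_add_apply, hnext]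
        · rw [show m = l + 1 by omega, hnext, k5, hxy.1, hxy.2] at k6
          exact h01 k6
  · have hsrc : T.IsSource (e 1) := by
      match s', s with
      | .inl i, .inr j => rw [← hs']; exact isSource_inl i
      | .inl i, .inl i' => exact absurd rfl hd
      | .inr i, .inl i' => exact absurd rfl hd
      | .inr i, .inr i' => exact absurd rfl hd
    have hpos : 0 < dpos (v 1) (e 1) (e 0) := dpos_pos hv1 hv0 (Ne.symm h01)
    have hnext : Γ.next (Γ.next^[dpos (v 1) (e 1) (e 0) - 1] (half (v 1) (e 1))) =
        half (v 1) (e 0) := by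
      rw [← Function.iterate_succ_apply' Γ.next, show (dpos (v 1) (e 1) (e 0) - 1).succ =
        dpos (v 1) (e 1) (e 0) by omega, dpos, iterate_pos (half_fst_eq hv1 hv0)]
    refine Set.ncard_eq_one.2 ⟨Γ.next^[dpos (v 1) (e 1) (e 0) - 1] (half (v 1) (e 1)),
      Set.eq_singleton_iff_unique_mem.2 ⟨⟨?_, ?_⟩, ?_⟩⟩
    · have := mem_diagramArrows (w := v 1) (s := s') (s' := s) (by rw [hs, hs']; exact h01.symm)
        (by rwa [hs']) (by rwa [hs]) hd (l := dpos (v 1) (e 1) (e 0) - 1) (by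
          rw [hs, hs']
          omega)
      rwa [hs'] at this
    · right
      rw [tgt, hnext, src_half]
    · rintro a ⟨ha, h⟩
      obtain ⟨x, y, d, m, l, k1, k2, k3, k4, k5, k6, k7, k8, rfl, k9⟩ := hloc ha h
      have hxy : x = e 1 ∧ y = e 0 := k1.resolve_left fun hh => k3 (hh.2 ▸ hsrc)
      rcases h with h | h
      · exfalso
        rcases Nat.eq_zero_or_pos l with rfl | hl
        · exact h01 (h.trans (k5.trans hxy.1))
        · exact k7 l hl k8 (h.symm.trans hxy.2.symm)
      · refine Γ.next.injective ?_
        rw [hnext, eq_half (d := Γ.next (Γ.next^[l] d)) (w := v 1) (by rw [Γ.next_fst, k9]), h]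
        rfl

theorem isOnlyVertexOn_zero (hz : T.IsZigzag r v e) (hT : T.NoExt T) {C : List Γ.Arrow}
    (hC : Γ.vertices C = {x | v 0 ∈ x.1}) : T.IsOnlyVertexOn C (e 0) := by
  have h2 := hz.two_le
  rw [IsOnlyVertexOn, hC]
  refine Set.eq_singleton_iff_unique_mem.2 ⟨⟨.inl ?_, hz.mem_left 0 (by omega)⟩, ?_⟩
  · obtain ⟨s, hs⟩ := hz.exists_mark 0 (by omega)
    match s with
    | .inl i => exact .inl ⟨i, hs⟩
    | .inr j => exact .inr ⟨j, hs⟩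
  · rintro x ⟨hx, hx0 : v 0 ∈ x.1⟩
    have hmark (s : T.Idx) (hs : T.mark s = x) : x = e 0 := by
      obtain ⟨k, hk, h⟩ := hz.exists_eq s
      rw [← hs, h, hz.v_mem_iff (by omega) hk] at hx0
      rw [← hs, h, show k = 0 by omega]
    rcases hx with (⟨i, hi⟩ | ⟨j, hj⟩) | ⟨a, ha, h⟩
    · exact hmark (.inl i) hi
    · exact hmark (.inr j) hj
    · obtain ⟨k, hk, -, -, d, -, l, -, -, -, k4, -, -, -, -, rfl⟩ :=
        hz.exists_of_mem_diagramArrows hT ha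
      have hf : (Γ.next^[l] d).fst = v (k + 1) := by rw [iterate_next_fst, k4]
      have hm : v (k + 1) ∈ x.1 := by
        rcases h with h | h
        · rw [h, ← hf]; exact fst_mem_src _
        · rw [h, ← hf, ← Γ.next_fst]; exact fst_mem_src _
      have hne : v 0 ≠ v (k + 1) := fun h => by
        have := hz.v_inj (by omega) hk.le h
        omega
      have hadj : Γ.graph.Adj (v 0) (v (k + 1)) := by
        have := x.2
        rwa [(Sym2.mem_and_mem_iff hne).1 ⟨hx0, hm⟩, SimpleGraph.mem_edgeSet] at this
      have h1 := hz.dist_eq 0 (k + 1) (by omega) hk.le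
      rw [SimpleGraph.dist_eq_one_iff_adj.2 hadj] at h1
      obtain rfl : k = 0 := by omega
      exact eq_of_mem_of_mem hne hx0 hm (hz.mem_left 0 (by omega)) (hz.mem_right 0 (by omega))

end IsZigzag

end MinPresentation

end BrauerTree

end

set_option linter.unusedSectionVars false

noncomputable section

namespace BrauerTree

variable {V : Type v} {Γ : BrauerTree V} {K : Type u} [Field K] [Finite V]

/-! ### Weights -/

theorem sum_range_alternating (a : ℕ → ℤ) (r : ℕ) :
    ∑ k ∈ Finset.range r, (-1) ^ k * (a k + a (k + 1)) = a 0 - (-1) ^ r * a r := by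
  induction r with
  | zero => simp
  | succ r ih =>
    rw [Finset.sum_range_succ, ih]
    ring

namespace MinPresentation

variable {M : ModuleCat.{max u v} (Γ.Alg K)} {T : Γ.MinPresentation K M}

open scoped Classical in
variable (T) in
/-- The sign of an edge: `1` for sources, `-1` for the other edges. -/
def sign (x : Γ.Edge) : ℤ := if T.IsSource x then 1 else -1

theorem weight_eq_sum (hT : T.NoExt T) (w : V) :
    T.weight w = ∑ s, T.sign (T.mark s) * inc w (T.mark s) := by
  rw [weight, Fintype.sum_sum_type, sub_eq_add_neg, ← Finset.sum_neg_distrib]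
  congr 1
  · exact Finset.sum_congr rfl fun i _ => by
      rw [sign, if_pos (isSource_inl i), one_mul]; rfl
  · exact Finset.sum_congr rfl fun j _ => by
      rw [sign, if_neg (not_isSource_inr hT j), neg_one_mul]; rfl

open scoped Classical in
/-- The weight at a vertex that belongs to only one marked edge. -/
theorem weight_eq_sign (hT : T.NoExt T) (hinj : Function.Injective T.mark) {w : V} {s : T.Idx}
    (hs : w ∈ (T.mark s).1) (h : ∀ s', w ∈ (T.mark s').1 → T.mark s' = T.mark s) :
    T.weight w = T.sign (T.mark s) := by
  rw [weight_eq_sum hT, Finset.sum_eq_single s]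
  · rw [inc, if_pos hs, mul_one]
  · intro s' _ hne
    rw [inc, if_neg fun h' => hne (hinj (h s' h')), mul_zero]
  · simp

namespace IsZigzag

variable {r : ℕ} {v : ℕ → V} {e : ℕ → Γ.Edge}

open scoped Classical in
theorem weight_eq (hz : T.IsZigzag r v e) (hT : T.NoExt T) (w : V) :
    T.weight w = T.sign (e 0) * ((if w = v 0 then 1 else 0) -
      (-1) ^ r * (if w = v r then 1 else 0)) := by
  have hsign (k : ℕ) (hk : k < r) : T.sign (e k) = (-1) ^ k * T.sign (e 0) := by
    induction k with
    | zero => simp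
    | succ k ih =>
      have h1 := hz.alternating k hk
      have h2 := ih (by omega)
      rw [pow_succ, mul_comm _ (-1 : ℤ), mul_assoc, ← h2]
      by_cases h : T.IsSource (e k)
      · rw [sign, sign, if_pos h, if_neg (h1.1 h), mul_one]
      · rw [sign, sign, if_neg h, if_pos (by by_contra h'; exact h (h1.2 h')), neg_one_mul,
          neg_neg]
  choose κ hκ hκ' using hz.exists_eq
  rw [weight_eq_sum hT]
  calc ∑ s, T.sign (T.mark s) * inc w (T.mark s)
      = ∑ k ∈ Finset.range r, T.sign (e k) * inc w (e k) := by
        refine Finset.sum_bij (fun s _ => κ s) (fun s _ => Finset.mem_range.2 (hκ s))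
          (fun s _ s' _ h => hz.injective (by rw [hκ' s, h, ← hκ' s']))
          (fun k hk => ?_) (fun s _ => by rw [hκ' s])
        rw [Finset.mem_range] at hk
        obtain ⟨s, hs⟩ := hz.exists_mark k hk
        exact ⟨s, Finset.mem_univ _, hz.e_inj (hκ s) hk (by rw [← hκ' s, hs])⟩
    _ = T.sign (e 0) * ∑ k ∈ Finset.range r, (-1) ^ k *
          ((if w = v k then 1 else 0) + (if w = v (k + 1) then 1 else 0)) := by
        rw [Finset.mul_sum]
        refine Finset.sum_congr rfl fun k hk => ?_
        rw [Finset.mem_range] at hk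
        rw [hsign k hk]
        have : inc w (e k) = (if w = v k then 1 else 0) + (if w = v (k + 1) then 1 else 0) := by
          by_cases h : w ∈ (e k).1
          · rw [inc, if_pos h]
            rcases (hz.mem_iff hk).1 h with rfl | rfl
            · rw [if_pos rfl, if_neg (hz.v_ne hk), add_zero]
            · rw [if_pos rfl, if_neg (hz.v_ne hk).symm, zero_add]
          · rw [inc, if_neg h]
            rw [hz.mem_iff hk] at h
            push Not at h
            rw [if_neg h.1, if_neg h.2, add_zero]
        rw [this]
        ring
    _ = _ := by rw [sum_range_alternating (fun k => if w = v k then 1 else 0)]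

theorem sign_mul_self (x : Γ.Edge) : T.sign x * T.sign x = 1 := by
  unfold sign
  split_ifs <;> rfl

theorem weight_mul_weight (hz : T.IsZigzag r v e) (hT : T.NoExt T) {w w' : V} (hne : w ≠ w')
    (hw : T.weight w ≠ 0) (hw' : T.weight w' ≠ 0) :
    T.weight w * T.weight w' = - (-1) ^ Γ.graph.dist w w' := by
  classical
  have hd := hz.dist_eq 0 r (by omega) le_rfl
  have h0r : v 0 ≠ v r := fun h => by
    have := hz.v_inj (by omega) le_rfl h
    have := hz.two_le
    omega
  have hmem {w : V} (hw : T.weight w ≠ 0) : w = v 0 ∨ w = v r := by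
    by_contra h
    push Not at h
    exact hw (by rw [hz.weight_eq hT, if_neg h.1, if_neg h.2]; ring)
  have e0 : T.weight (v 0) = T.sign (e 0) := by
    rw [hz.weight_eq hT, if_pos rfl, if_neg h0r]; ring
  have er : T.weight (v r) = - (T.sign (e 0) * (-1) ^ r) := by
    rw [hz.weight_eq hT, if_neg h0r.symm, if_pos rfl]; ring
  have hs := sign_mul_self (T := T) (e 0)
  rcases hmem hw with rfl | rfl <;> rcases hmem hw' with rfl | rfl
  · exact absurd rfl hne
  · rw [hd, e0, er, Nat.sub_zero, mul_neg, ← mul_assoc, hs, one_mul]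
  · rw [SimpleGraph.dist_comm, hd, e0, er, Nat.sub_zero, neg_mul, mul_right_comm, hs, one_mul]
  · exact absurd rfl hne

theorem exists_of_weight_ne_zero (hz : T.IsZigzag r v e) (hT : T.NoExt T) {w : V}
    (hw : T.weight w ≠ 0) : ∃ x : Γ.Edge, w ∈ x.1 ∧ T.IsEndPoint x ∧
      (∀ C, Γ.vertices C = {x | w ∈ x.1} → T.IsOnlyVertexOn C x) ∧
      ((x ∈ Set.range T.index₀ ∧ T.weight w = 1) ∨ (x ∈ Set.range T.index₁ ∧ T.weight w = -1)) := by
  classical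
  have key {v : ℕ → V} {e : ℕ → Γ.Edge} (hz : T.IsZigzag r v e) :
      ∃ x : Γ.Edge, v 0 ∈ x.1 ∧ T.IsEndPoint x ∧
      (∀ C, Γ.vertices C = {x | v 0 ∈ x.1} → T.IsOnlyVertexOn C x) ∧
      ((x ∈ Set.range T.index₀ ∧ T.weight (v 0) = 1) ∨
        (x ∈ Set.range T.index₁ ∧ T.weight (v 0) = -1)) := by
    have h2 := hz.two_le
    refine ⟨e 0, hz.mem_left 0 (by omega), hz.isEndPoint_zero hT,
      fun C hC => hz.isOnlyVertexOn_zero hT hC, ?_⟩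
    have h0r : v 0 ≠ v r := fun h => by
      have := hz.v_inj (by omega) le_rfl h
      omega
    have e0 : T.weight (v 0) = T.sign (e 0) := by
      rw [hz.weight_eq hT, if_pos rfl, if_neg h0r]; ring
    rw [e0]
    obtain ⟨s, hs⟩ := hz.exists_mark 0 (by omega)
    match s with
    | .inl i => exact .inl ⟨⟨i, hs⟩, by rw [sign, if_pos (hs ▸ isSource_inl i)]⟩
    | .inr j => exact .inr ⟨⟨j, hs⟩, by rw [sign, if_neg (hs ▸ not_isSource_inr hT j)]⟩
  by_cases h0 : w = v 0
  · rw [h0]; exact key hz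
  by_cases hr : w = v r
  · rw [hr]; exact key hz.reverse
  · exact absurd (by rw [hz.weight_eq hT, if_neg h0, if_neg hr]; ring) hw

end IsZigzag

/-- A degree-one source or sink that is the only vertex on the cycle at `w` determines the weight
at `w`. -/
theorem weight_of_isOnlyVertexOn (hT : T.NoExt T) (hinj : Function.Injective T.mark) {w : V}
    {C : List Γ.Arrow} (hC : Γ.vertices C = {x | w ∈ x.1}) {s : T.Idx}
    (h : T.IsOnlyVertexOn C (T.mark s)) : T.weight w = T.sign (T.mark s) := by
  have hmem : T.mark s ∈ T.diagramVertices ∩ Γ.vertices C := by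
    rw [show T.diagramVertices ∩ Γ.vertices C = {T.mark s} from h]; rfl
  rw [hC] at hmem
  refine weight_eq_sign hT hinj hmem.2 fun s' hs' => ?_
  have : T.mark s' ∈ T.diagramVertices ∩ Γ.vertices C := by
    refine ⟨.inl ?_, by rw [hC]; exact hs'⟩
    match s' with
    | .inl i => exact .inl ⟨i, rfl⟩
    | .inr j => exact .inr ⟨j, rfl⟩
  rw [show T.diagramVertices ∩ Γ.vertices C = {T.mark s} from h] at this
  exact this

end MinPresentation

end BrauerTree

theorem hom_nonzero_iff_common_cycle_of_ends {K : Type u} [Field K] [IsAlgClosed K]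
    {V : Type v} [Finite V] (Γ : BrauerTree V)
    [HasDerivedCategory.{w} (ModuleCat.{max u v} (Γ.Alg K))]
    (Mi Mj : ModuleCat.{max u v} (Γ.Alg K))
    (hMi : Indecomposable Mi) (hMj : Indecomposable Mj)
    (hPi : ¬ Module.Projective (Γ.Alg K) Mi) (hPj : ¬ Module.Projective (Γ.Alg K) Mj)
    (hij : IsEmpty (Mi ≅ Mj))
    (Ti : Γ.MinPresentation K Mi) (Tj : Γ.MinPresentation K Mj)
    (hT : IsPartialTilting.{w} (Ti.complex ⊞ Tj.complex)) :
    (∃ φ : (HomotopyCategory.quotient _ _).obj Ti.complex ⟶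
        (HomotopyCategory.quotient _ _).obj Tj.complex, φ ≠ 0) ↔
      (∃ C, Γ.IsACycle K C ∧ ∃ x y, Ti.IsDegreeOneSink x ∧ Tj.IsDegreeOneSink y ∧
        Ti.IsOnlyVertexOn C x ∧ Tj.IsOnlyVertexOn C y) ∨
      (∃ C, Γ.IsACycle K C ∧ ∃ x y, Ti.IsDegreeOneSource x ∧ Tj.IsDegreeOneSource y ∧
        Ti.IsOnlyVertexOn C x ∧ Tj.IsOnlyVertexOn C y) := by
  classical
  have := Fintype.ofFinite V
  have hii := Ti.noExt_of_retract Ti hT biprod.inl biprod.fst biprod.inl_fst biprod.inl biprod.fst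
    biprod.inl_fst
  have hjj := Tj.noExt_of_retract Tj hT biprod.inr biprod.snd biprod.inr_snd biprod.inr biprod.snd
    biprod.inr_snd
  have hext := Ti.noExt_of_retract Tj hT biprod.inl biprod.fst biprod.inl_fst biprod.inr biprod.snd
    biprod.inr_snd
  have hnext := Ti.noNegExt_of_retract Tj hT biprod.inl biprod.fst biprod.inl_fst biprod.inr biprod.snd
    biprod.inr_snd
  obtain ⟨r, v, e, hz⟩ := BrauerTree.MinPresentation.exists_isZigzag hii hMi hPi
  obtain ⟨r', v', e', hz'⟩ := BrauerTree.MinPresentation.exists_isZigzag hjj hMj hPj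
  rw [Ti.exists_quotient_hom_ne_zero_iff Tj hext hnext]
  constructor
  · intro h
    obtain ⟨w, -, hw⟩ := Finset.exists_lt_of_sum_lt (f := fun _ : V => (0 : ℤ)) (by simpa using h)
    have hwi : Ti.weight w ≠ 0 := fun h0 => by rw [h0, zero_mul] at hw; exact lt_irrefl _ hw
    have hwj : Tj.weight w ≠ 0 := fun h0 => by rw [h0, mul_zero] at hw; exact lt_irrefl _ hw
    obtain ⟨x, hx, hx1, hx2, hx3⟩ := hz.exists_of_weight_ne_zero hii hwi
    obtain ⟨y, hy, hy1, hy2, hy3⟩ := hz'.exists_of_weight_ne_zero hjj hwj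
    obtain ⟨C, hC, hCw⟩ := BrauerTree.exists_isACycle (K := K) hx
    rcases hx3 with ⟨hx3, hwx⟩ | ⟨hx3, hwx⟩ <;> rcases hy3 with ⟨hy3, hwy⟩ | ⟨hy3, hwy⟩
    · exact .inr ⟨C, hC, x, y, ⟨hx3, hx1⟩, ⟨hy3, hy1⟩, hx2 C hCw, hy2 C hCw⟩
    · rw [hwx, hwy] at hw; exact absurd hw (by decide)
    · rw [hwx, hwy] at hw; exact absurd hw (by decide)
    · exact .inl ⟨C, hC, x, y, ⟨hx3, hx1⟩, ⟨hy3, hy1⟩, hx2 C hCw, hy2 C hCw⟩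
  · intro h
    obtain ⟨w, hw⟩ : ∃ w, 0 < Ti.weight w * Tj.weight w := by
      rcases h with ⟨C, hC, _, _, ⟨⟨i, rfl⟩, -⟩, ⟨⟨j, rfl⟩, -⟩, hx, hy⟩ |
        ⟨C, hC, _, _, ⟨⟨i, rfl⟩, -⟩, ⟨⟨j, rfl⟩, -⟩, hx, hy⟩
      · obtain ⟨w, hw⟩ := BrauerTree.exists_vertices_eq_of_isACycle hC
        refine ⟨w, ?_⟩
        rw [BrauerTree.MinPresentation.weight_of_isOnlyVertexOn (s := .inr i) hii hz.injective hw hx,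
          BrauerTree.MinPresentation.weight_of_isOnlyVertexOn (s := .inr j) hjj hz'.injective hw hy,
          BrauerTree.MinPresentation.sign, BrauerTree.MinPresentation.sign,
          if_neg (BrauerTree.MinPresentation.not_isSource_inr hii i), if_neg (BrauerTree.MinPresentation.not_isSource_inr hjj j)]
        decide
      · obtain ⟨w, hw⟩ := BrauerTree.exists_vertices_eq_of_isACycle hC
        refine ⟨w, ?_⟩
        rw [BrauerTree.MinPresentation.weight_of_isOnlyVertexOn (s := .inl i) hii hz.injective hw hx,
          BrauerTree.MinPresentation.weight_of_isOnlyVertexOn (s := .inl j) hjj hz'.injective hw hy,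
          BrauerTree.MinPresentation.sign, BrauerTree.MinPresentation.sign,
          if_pos (BrauerTree.MinPresentation.isSource_inl i), if_pos (BrauerTree.MinPresentation.isSource_inl j)]
        decide
    refine Finset.sum_pos' (fun w' _ => ?_) ⟨w, Finset.mem_univ w, hw⟩
    by_contra hneg
    push Not at hneg
    have hwi : Ti.weight w ≠ 0 := fun h0 => by rw [h0, zero_mul] at hw; exact lt_irrefl _ hw
    have hwj : Tj.weight w ≠ 0 := fun h0 => by rw [h0, mul_zero] at hw; exact lt_irrefl _ hw
    have hwi' : Ti.weight w' ≠ 0 := fun h0 => by rw [h0, zero_mul] at hneg; exact lt_irrefl _ hneg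
    have hwj' : Tj.weight w' ≠ 0 := fun h0 => by rw [h0, mul_zero] at hneg; exact lt_irrefl _ hneg
    have hne : w ≠ w' := by rintro rfl; exact lt_asymm hw hneg
    have h1 := hz.weight_mul_weight hii hne hwi hwi'
    have h2 := hz'.weight_mul_weight hjj hne hwj hwj'
    have h3 : (Ti.weight w * Tj.weight w) * (Ti.weight w' * Tj.weight w') < 0 :=
      mul_neg_of_pos_of_neg hw hneg
    have h4 : (Ti.weight w * Tj.weight w) * (Ti.weight w' * Tj.weight w') =
        (Ti.weight w * Ti.weight w') * (Tj.weight w * Tj.weight w') := by ring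
    rw [h4, h1, h2] at h3
    exact absurd h3 (not_lt.2 (mul_self_nonneg _))

end
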